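/- The Waldschmidt constant of the H4 configuration of 60 points in ℙ³ equals 18/5; that is, the infimum over all integers m ≥ 1 of α(I(H4)^{(m)})/m, where α(I(H4)^{(m)}) is the least degree of a nonzero homogeneous polynomial in ℝ[x,y,z,w] vanishing to order at least m at every point of the H4 configuration, equals 18/5. -/

import Mathlib

open MvPolynomial

/-- A polynomial `F ∈ ℝ[x,y,z,w]` vanishes to order at least `m` at a point with
representative vector `v` if all partial derivatives of `F` of total order less
than `m` vanish at `v`. -/
def vanishesToOrderR (F : MvPolynomial (Fin 4) ℝ) (v : Fin 4 → ℝ) (m : ℕ) : Prop :=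
  ∀ l : List (Fin 4), l.length < m →
    eval v (l.foldl (fun G i => pderiv i G) F) = 0

/-- The least degree of a nonzero homogeneous polynomial vanishing to order at least `m`
at every point of the configuration `Z`. -/
noncomputable def alphaSymbolicR (Z : Set (Fin 4 → ℝ)) (m : ℕ) : ℕ :=
  sInf { d | ∃ F : MvPolynomial (Fin 4) ℝ, F ≠ 0 ∧ F.IsHomogeneous d ∧
    ∀ v ∈ Z, vanishesToOrderR F v m }

/-- The golden ratio. -/
noncomputable def gr : ℝ := (1 + Real.sqrt 5) / 2

/-- The H4 configuration: 60 points of `ℙ³` consisting of the 4 coordinate points, the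
8 points `(1:±1:±1:±1)`, and the 48 points whose coordinate vectors are the even
permutations of `(φ, ±1, ±φ⁻¹, 0)`, where `φ` is the golden ratio. -/
noncomputable def H4Config : Set (Fin 4 → ℝ) :=
  { v | ∃ i : Fin 4, v = Pi.single i 1 } ∪
  { v | v 0 = 1 ∧ ∀ i : Fin 4, i ≠ 0 → (v i = 1 ∨ v i = -1) } ∪
  { v | ∃ σ : Equiv.Perm (Fin 4), Equiv.Perm.sign σ = 1 ∧
      ∃ ε₁ ε₂ : ℝ, (ε₁ = 1 ∨ ε₁ = -1) ∧ (ε₂ = 1 ∨ ε₂ = -1) ∧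
        v = fun i => ![gr, ε₁, ε₂ * gr⁻¹, 0] (σ i) }


/-! ### The integer model of the 120 icosians (in units of one half) -/
namespace H4

/-- `a + b φ` is represented by `(a, b)`. -/
abbrev Zp := ℤ × ℤ
/-- Quaternions over `ℤ[φ]`. -/
abbrev Iq := Zp × Zp × Zp × Zp

def zadd (p q : Zp) : Zp := (p.1 + q.1, p.2 + q.2)
def zneg (p : Zp) : Zp := (-p.1, -p.2)
def zmul (p q : Zp) : Zp := (p.1 * q.1 + p.2 * q.2, p.1 * q.2 + p.2 * q.1 + p.2 * q.2)
def zhalf (p : Zp) : Zp := (p.1 / 2, p.2 / 2)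

/-- twice the half-scaled product. -/
def qmul (u v : Iq) : Iq :=
  (zadd (zmul u.1 v.1) (zneg (zadd (zmul u.2.1 v.2.1) (zadd (zmul u.2.2.1 v.2.2.1) (zmul u.2.2.2 v.2.2.2)))),
   zadd (zadd (zmul u.1 v.2.1) (zmul u.2.1 v.1)) (zadd (zmul u.2.2.1 v.2.2.2) (zneg (zmul u.2.2.2 v.2.2.1))),
   zadd (zadd (zmul u.1 v.2.2.1) (zneg (zmul u.2.1 v.2.2.2))) (zadd (zmul u.2.2.1 v.1) (zmul u.2.2.2 v.2.1)),
   zadd (zadd (zmul u.1 v.2.2.2) (zmul u.2.1 v.2.2.1)) (zadd (zneg (zmul u.2.2.1 v.2.1)) (zmul u.2.2.2 v.1)))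
def qhalf (u : Iq) : Iq := (zhalf u.1, zhalf u.2.1, zhalf u.2.2.1, zhalf u.2.2.2)
def hmul (u v : Iq) : Iq := qhalf (qmul u v)
def qdbl (u : Iq) : Iq :=
  (zadd u.1 u.1, zadd u.2.1 u.2.1, zadd u.2.2.1 u.2.2.1, zadd u.2.2.2 u.2.2.2)
def qneg (u : Iq) : Iq := (zneg u.1, zneg u.2.1, zneg u.2.2.1, zneg u.2.2.2)
def qstar (u : Iq) : Iq := (u.1, zneg u.2.1, zneg u.2.2.1, zneg u.2.2.2)

/-- six axes of the icosahedron, and of a rescaled copy -/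
def ico : List (Zp × Zp × Zp) :=
  [((0,1),(1,0),(0,0)), ((0,1),(-1,0),(0,0)), ((0,0),(0,1),(1,0)), ((0,0),(0,1),(-1,0)),
   ((1,0),(0,0),(0,1)), ((-1,0),(0,0),(0,1))]
def ico' : List (Zp × Zp × Zp) :=
  [((1,0),(-1,1),(0,0)), ((1,0),(1,-1),(0,0)), ((0,0),(1,0),(-1,1)), ((0,0),(1,0),(1,-1)),
   ((-1,1),(0,0),(1,0)), ((1,-1),(0,0),(1,0))]
/-- ten axes of the dodecahedron -/
def dod : List (Zp × Zp × Zp) :=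
  [((1,0),(1,0),(1,0)), ((1,0),(1,0),(-1,0)), ((1,0),(-1,0),(1,0)), ((1,0),(-1,0),(-1,0)),
   ((0,1),(0,0),(-1,1)), ((0,1),(0,0),(1,-1)), ((-1,1),(0,1),(0,0)), ((1,-1),(0,1),(0,0)),
   ((0,0),(-1,1),(0,1)), ((0,0),(1,-1),(0,1))]
/-- fifteen axes of the icosidodecahedron -/
def icd : List (Zp × Zp × Zp) :=
  [((2,0),(0,0),(0,0)), ((0,0),(2,0),(0,0)), ((0,0),(0,0),(2,0)),
   ((0,1),(-1,1),(1,0)), ((0,1),(-1,1),(-1,0)), ((0,1),(1,-1),(1,0)), ((0,1),(1,-1),(-1,0)),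
   ((1,0),(0,1),(-1,1)), ((1,0),(0,1),(1,-1)), ((-1,0),(0,1),(-1,1)), ((-1,0),(0,1),(1,-1)),
   ((-1,1),(1,0),(0,1)), ((-1,1),(-1,0),(0,1)), ((1,-1),(1,0),(0,1)), ((1,-1),(-1,0),(0,1))]
def neg3 (w : Zp × Zp × Zp) : Zp × Zp × Zp := (zneg w.1, zneg w.2.1, zneg w.2.2)
def pm (c : Zp) (l : List (Zp × Zp × Zp)) : List Iq :=
  l.map (fun w => (c, w)) ++ l.map (fun w => (c, neg3 w))
/-- representatives of the 60 points -/
def V : List Iq :=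
  [((2,0),(0,0),(0,0),(0,0))] ++ pm (0,1) ico' ++ pm (1,0) dod ++ pm (-1,1) ico ++ icd.map (fun w => ((0,0), w))
def L : List Iq := V ++ V.map qneg

def g1 : Iq := ((0,0),(2,0),(0,0),(0,0))
def g2 : Iq := ((0,0),(0,0),(2,0),(0,0))
def g3 : Iq := ((1,0),(1,0),(1,0),(1,0))
def g4 : Iq := ((0,1),(1,0),(-1,1),(0,0))
def e1 : Iq := ((2,0),(0,0),(0,0),(0,0))

theorem L_nodup : L.Nodup := by decide +kernel
theorem L_length : L.length = 120 := by decide +kernel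
theorem L_g1 : ∀ v ∈ L, hmul g1 v ∈ L := by decide +kernel
theorem L_g1' : ∀ v ∈ L, qdbl (hmul g1 v) = qmul g1 v := by decide +kernel
theorem L_g2 : ∀ v ∈ L, hmul g2 v ∈ L := by decide +kernel
theorem L_g2' : ∀ v ∈ L, qdbl (hmul g2 v) = qmul g2 v := by decide +kernel
theorem L_g3 : ∀ v ∈ L, hmul g3 v ∈ L := by decide +kernel
theorem L_g3' : ∀ v ∈ L, qdbl (hmul g3 v) = qmul g3 v := by decide +kernel
theorem L_g4 : ∀ v ∈ L, hmul g4 v ∈ L := by decide +kernel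
theorem L_g4' : ∀ v ∈ L, qdbl (hmul g4 v) = qmul g4 v := by decide +kernel
theorem L_word : ∀ v ∈ L, ∃ a ∈ List.range 4, ∃ b ∈ List.range 2, ∃ c ∈ List.range 6,
    ∃ d ∈ List.range 5, v = (hmul g1)^[a] ((hmul g2)^[b] ((hmul g3)^[c] ((hmul g4)^[d] e1))) := by
  decide +kernel
theorem L_star : ∀ v ∈ L, qstar v ∈ L := by decide +kernel
theorem L_neg : ∀ v ∈ L, qneg v ∈ L := by decide +kernel
theorem e1_mem : e1 ∈ L := by decide +kernel
theorem L_norm : ∀ v ∈ L, qmul v (qstar v) = ((4,0),(0,0),(0,0),(0,0)) := by decide +kernel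

noncomputable def zv (p : Zp) : ℝ := p.1 + p.2 * gr

theorem gr_sq : gr * gr = gr + 1 := by
  have h : Real.sqrt 5 * Real.sqrt 5 = 5 := Real.mul_self_sqrt (by norm_num)
  unfold gr; linarith
theorem gr_pos : 0 < gr := by unfold gr; positivity
theorem gr_inv : gr⁻¹ = gr - 1 := by
  have := gr_pos
  field_simp
  linarith [gr_sq]
theorem gr_irr : Irrational gr := by
  have : gr = Real.goldenRatio := rfl
  rw [this]; exact Real.goldenRatio_irrational

theorem zv_inj {p q : Zp} (h : zv p = zv q) : p = q := by
  unfold zv at h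
  by_cases h2 : p.2 = q.2
  · have : (p.1 : ℝ) = q.1 := by rw [h2] at h; linarith
    exact Prod.ext (by exact_mod_cast this) h2
  · exfalso
    have hne : ((p.2 - q.2 : ℤ) : ℝ) ≠ 0 := by exact_mod_cast sub_ne_zero.2 h2
    apply gr_irr
    refine ⟨((q.1 - p.1 : ℤ) : ℚ) / ((p.2 - q.2 : ℤ) : ℚ), ?_⟩
    push_cast at hne ⊢
    field_simp
    linarith
theorem zv_add (p q : Zp) : zv (zadd p q) = zv p + zv q := by
  simp [zv, zadd]; ring
theorem zv_neg (p : Zp) : zv (zneg p) = - zv p := by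
  simp [zv, zneg]; ring
theorem zv_mul (p q : Zp) : zv (zmul p q) = zv p * zv q := by
  simp only [zv, zmul]; push_cast; linear_combination (-(p.2 : ℝ) * q.2) * gr_sq

open Quaternion

noncomputable def emb (u : Iq) : ℍ[ℝ] := ⟨zv u.1 / 2, zv u.2.1 / 2, zv u.2.2.1 / 2, zv u.2.2.2 / 2⟩

theorem emb_re (u : Iq) : (emb u).re = zv u.1 / 2 := rfl
theorem emb_imI (u : Iq) : (emb u).imI = zv u.2.1 / 2 := rfl
theorem emb_imJ (u : Iq) : (emb u).imJ = zv u.2.2.1 / 2 := rfl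
theorem emb_imK (u : Iq) : (emb u).imK = zv u.2.2.2 / 2 := rfl

theorem emb_inj : Function.Injective emb := by
  intro u v h
  have h0 := congrArg QuaternionAlgebra.re h
  have h1 := congrArg QuaternionAlgebra.imI h
  have h2 := congrArg QuaternionAlgebra.imJ h
  have h3 := congrArg QuaternionAlgebra.imK h
  simp only [emb] at h0 h1 h2 h3
  refine Prod.ext (zv_inj (by linarith)) (Prod.ext (zv_inj (by linarith)) (Prod.ext (zv_inj (by linarith)) (zv_inj (by linarith))))
theorem emb_mul (u v w : Iq) (h : qdbl w = qmul u v) : emb u * emb v = emb w := by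
  have h0 := congrArg (fun t : Iq => zv t.1) h
  have h1 := congrArg (fun t : Iq => zv t.2.1) h
  have h2 := congrArg (fun t : Iq => zv t.2.2.1) h
  have h3 := congrArg (fun t : Iq => zv t.2.2.2) h
  simp only [qdbl, qmul, zv_add, zv_neg, zv_mul] at h0 h1 h2 h3
  ext <;> simp only [Quaternion.re_mul, Quaternion.imI_mul, Quaternion.imJ_mul, Quaternion.imK_mul, emb_re, emb_imI, emb_imJ, emb_imK] <;> linarith
theorem emb_star (u : Iq) : star (emb u) = emb (qstar u) := by
  ext <;> simp [emb_re, emb_imI, emb_imJ, emb_imK, qstar, zv_neg] <;> ring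
theorem emb_neg (u : Iq) : - (emb u) = emb (qneg u) := by
  ext <;> simp [emb_re, emb_imI, emb_imJ, emb_imK, qneg, zv_neg] <;> ring
theorem emb_one : emb e1 = 1 := by
  ext <;> simp [emb, e1, zv]

/-- The binary icosahedral group. -/
noncomputable def D : Finset ℍ[ℝ] := L.toFinset.map ⟨emb, emb_inj⟩

theorem mem_D {r : ℍ[ℝ]} : r ∈ D ↔ ∃ v ∈ L, emb v = r := by
  simp [D]
theorem D_card : D.card = 120 := by
  rw [D, Finset.card_map, List.toFinset_card_of_nodup L_nodup, L_length]
theorem D_one : (1 : ℍ[ℝ]) ∈ D := mem_D.2 ⟨e1, e1_mem, emb_one⟩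
theorem D_star {r : ℍ[ℝ]} (h : r ∈ D) : star r ∈ D := by
  obtain ⟨v, hv, rfl⟩ := mem_D.1 h
  exact mem_D.2 ⟨_, L_star v hv, (emb_star v).symm⟩
theorem D_neg {r : ℍ[ℝ]} (h : r ∈ D) : -r ∈ D := by
  obtain ⟨v, hv, rfl⟩ := mem_D.1 h
  exact mem_D.2 ⟨_, L_neg v hv, (emb_neg v).symm⟩
theorem D_mul_star {r : ℍ[ℝ]} (h : r ∈ D) : r * star r = 1 := by
  obtain ⟨v, hv, rfl⟩ := mem_D.1 h
  rw [emb_star, ← emb_one]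
  exact emb_mul _ _ _ ((L_norm v hv).symm ▸ by decide)
theorem D_star_mul {r : ℍ[ℝ]} (h : r ∈ D) : star r * r = 1 := by
  simpa using D_mul_star (D_star h)
theorem D_normSq {r : ℍ[ℝ]} (h : r ∈ D) : normSq r = 1 := by
  have := D_mul_star h
  rw [Quaternion.self_mul_star] at this
  exact Quaternion.coe_injective (by simpa using this)

theorem D_gen {g : Iq} (h1 : ∀ v ∈ L, hmul g v ∈ L) (h2 : ∀ v ∈ L, qdbl (hmul g v) = qmul g v) :
    ∀ r ∈ D, emb g * r ∈ D := by
  intro r hr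
  obtain ⟨v, hv, rfl⟩ := mem_D.1 hr
  exact mem_D.2 ⟨_, h1 v hv, (emb_mul _ _ _ (h2 v hv)).symm⟩
theorem iter_gen {g : Iq} (h1 : ∀ v ∈ L, hmul g v ∈ L) (h2 : ∀ v ∈ L, qdbl (hmul g v) = qmul g v)
    (n : ℕ) (v : Iq) (hv : v ∈ L) (hD : ∀ r ∈ D, emb v * r ∈ D) :
    ((hmul g)^[n] v) ∈ L ∧ ∀ r ∈ D, emb ((hmul g)^[n] v) * r ∈ D := by
  induction n with
  | zero => exact ⟨hv, hD⟩
  | succ k ih =>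
    rw [Function.iterate_succ_apply']
    refine ⟨h1 _ ih.1, fun r hr => ?_⟩
    rw [← emb_mul _ _ _ (h2 _ ih.1), mul_assoc]
    exact D_gen h1 h2 _ (ih.2 r hr)
theorem D_mul {p q : ℍ[ℝ]} (hp : p ∈ D) (hq : q ∈ D) : p * q ∈ D := by
  obtain ⟨v, hv, rfl⟩ := mem_D.1 hp
  obtain ⟨a, -, b, -, c, -, d, -, rfl⟩ := L_word v hv
  have s4 := iter_gen L_g4 L_g4' d e1 e1_mem (by intro r hr; rwa [emb_one, one_mul])
  have s3 := iter_gen L_g3 L_g3' c _ s4.1 s4.2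
  have s2 := iter_gen L_g2 L_g2' b _ s3.1 s3.2
  have s1 := iter_gen L_g1 L_g1' a _ s2.1 s2.2
  exact s1.2 q hq

/-- coordinates of a quaternion -/
def vec (x : ℍ[ℝ]) : Fin 4 → ℝ := ![x.re, x.imI, x.imJ, x.imK]
def qt (v : Fin 4 → ℝ) : ℍ[ℝ] := ⟨v 0, v 1, v 2, v 3⟩
@[simp] theorem vec_qt (v : Fin 4 → ℝ) : vec (qt v) = v := by
  ext i; fin_cases i <;> rfl
@[simp] theorem qt_vec (x : ℍ[ℝ]) : qt (vec x) = x := rfl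

end H4

namespace H4
open Quaternion

/-! ### Relation of the icosians with the H4 configuration -/

def tup (u : Iq) : Fin 4 → Zp := ![u.1, u.2.1, u.2.2.1, u.2.2.2]
def unt (t : Fin 4 → Zp) : Iq := (t 0, t 1, t 2, t 3)
def sgn (b : Bool) : ℤ := if b then 1 else -1
def base (a b : Bool) : Fin 4 → Zp := ![(0, 1), (sgn a, 0), (-sgn b, sgn b), (0, 0)]

theorem cfgA : ∀ i : Fin 4, unt (fun j => if j = i then (2, 0) else (0, 0)) ∈ L := by decide +kernel
theorem cfgB : ∀ a b c : Bool, unt ![(1, 0), (sgn a, 0), (sgn b, 0), (sgn c, 0)] ∈ L := by decide +kernel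
theorem cfgC : ∀ σ : Equiv.Perm (Fin 4), Equiv.Perm.sign σ = 1 → ∀ a b : Bool,
    unt (fun i => base a b (σ i)) ∈ L := by decide +kernel

def isA (u : Iq) : Bool := decide (∃ i : Fin 4, ∀ j : Fin 4, tup u j = if j = i then (2, 0) else (0, 0))
def isB (u : Iq) : Bool := decide (tup u 0 = (1,0) ∧ (∀ j : Fin 4, j ≠ 0 → (tup u j = (1, 0) ∨ tup u j = (-1, 0))))
def isC (u : Iq) : Bool := decide (∃ σ : Equiv.Perm (Fin 4), Equiv.Perm.sign σ = 1 ∧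
  ∃ a b : Bool, ∀ j : Fin 4, tup u j = base a b (σ j))

theorem cfgD : ∀ u ∈ L, ((isA u || isB u || isC u) || (isA (qneg u) || isB (qneg u) || isC (qneg u))) = true := by
  decide +kernel

theorem vec_emb (u : Iq) (i : Fin 4) : vec (emb u) i = zv (tup u i) / 2 := by
  fin_cases i <;> rfl
theorem tup_unt (t : Fin 4 → Zp) : tup (unt t) = t := by
  ext i <;> fin_cases i <;> rfl

theorem zv_base (a b : Bool) (i : Fin 4) :
    zv (base a b i) = (![gr, (sgn a : ℝ), (sgn b : ℝ) * gr⁻¹, 0] : Fin 4 → ℝ) i := by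
  rw [gr_inv]
  fin_cases i <;> simp [base, zv]; ring

theorem sgn_or (b : Bool) : (sgn b : ℝ) = 1 ∨ (sgn b : ℝ) = -1 := by cases b <;> simp [sgn]
theorem or_sgn {x : ℝ} (h : x = 1 ∨ x = -1) : ∃ b : Bool, x = sgn b := by
  rcases h with h | h
  · exact ⟨true, by simp [sgn, h]⟩
  · exact ⟨false, by simp [sgn, h]⟩

/-- each point of the configuration is a multiple of an icosian -/
theorem cfg_to_D {v : Fin 4 → ℝ} (hv : v ∈ H4Config) : ∃ r ∈ D, ∃ c : ℝ, c ≠ 0 ∧ v = c • vec r := by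
  have key : ∀ (t : Fin 4 → Zp) (c : ℝ), c ≠ 0 → unt t ∈ L → (∀ i, v i = c * zv (t i)) →
      ∃ r ∈ D, ∃ c : ℝ, c ≠ 0 ∧ v = c • vec r := by
    intro t c hc ht h
    refine ⟨emb (unt t), mem_D.2 ⟨_, ht, rfl⟩, 2 * c, by simpa using hc, ?_⟩
    ext i
    rw [Pi.smul_apply, vec_emb, tup_unt, h i, smul_eq_mul]; ring
  rcases hv with (⟨i, rfl⟩ | ⟨h0, h⟩) | ⟨σ, hσ, e1, e2, he1, he2, rfl⟩
  · refine key _ (1/2) (by norm_num) (cfgA i) ?_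
    intro j
    by_cases hj : j = i
    · subst hj; simp [zv]
    · simp [hj, zv]
  · obtain ⟨a, ha⟩ := or_sgn (h 1 (by decide))
    obtain ⟨b, hb⟩ := or_sgn (h 2 (by decide))
    obtain ⟨c, hc⟩ := or_sgn (h 3 (by decide))
    refine key _ 1 (by norm_num) (cfgB a b c) ?_
    intro j
    fin_cases j <;> simp [zv, h0, ha, hb, hc]
  · obtain ⟨a, rfl⟩ := or_sgn he1
    obtain ⟨b, rfl⟩ := or_sgn he2
    refine key _ 1 (by norm_num) (cfgC σ hσ a b) ?_
    intro j
    rw [zv_base, one_mul]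

theorem cfg_of {u : Iq} (h : (isA u || isB u || isC u) = true) :
    ∃ v ∈ H4Config, ∃ c : ℝ, vec (emb u) = c • v := by
  simp only [Bool.or_eq_true] at h
  rcases h with (h | h) | h
  · obtain ⟨i, hi⟩ := of_decide_eq_true h
    refine ⟨Pi.single i 1, Or.inl (Or.inl ⟨i, rfl⟩), 1, ?_⟩
    ext j
    rw [vec_emb, hi j]
    by_cases hj : j = i
    · subst hj; simp [zv]
    · simp [hj, zv]
  · obtain ⟨h0, hi⟩ := of_decide_eq_true h
    refine ⟨fun j => zv (tup u j), Or.inl (Or.inr ⟨by simp [h0, zv], ?_⟩), 1/2, ?_⟩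
    · intro i hi0
      rcases hi i hi0 with h | h <;> simp [h, zv]
    · ext j; rw [vec_emb, Pi.smul_apply, smul_eq_mul]; ring
  · obtain ⟨σ, hσ, a, b, hi⟩ := of_decide_eq_true h
    refine ⟨_, Or.inr ⟨σ, hσ, sgn a, sgn b, sgn_or a, sgn_or b, rfl⟩, 1/2, ?_⟩
    ext j
    rw [vec_emb, hi j, zv_base, Pi.smul_apply, smul_eq_mul]; ring

/-- each icosian is a multiple of a point of the configuration -/
theorem D_to_cfg {r : ℍ[ℝ]} (hr : r ∈ D) : ∃ v ∈ H4Config, ∃ c : ℝ, vec r = c • v := by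
  obtain ⟨u, hu, rfl⟩ := mem_D.1 hr
  have := cfgD u hu
  rw [Bool.or_eq_true] at this
  rcases this with h | h
  · exact cfg_of h
  · obtain ⟨v, hv, c, hc⟩ := cfg_of h
    refine ⟨v, hv, -c, ?_⟩
    rw [← emb_neg] at hc
    rw [neg_smul, ← hc]
    ext i; fin_cases i <;> simp [vec]
end H4

namespace H4
open Quaternion

/-! ### Polynomials as functions on quaternions -/

abbrev Po := MvPolynomial (Fin 4) ℝ

theorem vec_add (x y : ℍ[ℝ]) : vec (x + y) = vec x + vec y := by
  ext i; fin_cases i <;> simp [vec]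
theorem vec_smul (c : ℝ) (y : ℍ[ℝ]) : vec (c • y) = c • vec y := by
  ext i; fin_cases i <;> simp [vec]
def vecL : ℍ[ℝ] →ₗ[ℝ] (Fin 4 → ℝ) where
  toFun := vec
  map_add' := vec_add
  map_smul' := vec_smul

noncomputable def ev (x : ℍ[ℝ]) : Po →ₐ[ℝ] ℝ := aeval (vec x)
theorem ev_X (x : ℍ[ℝ]) (i : Fin 4) : ev x (X i) = vec x i := by simp [ev]
theorem ev_C (x : ℍ[ℝ]) (r : ℝ) : ev x (C r) = r := by simp [ev]

theorem po_ext {F G : Po} (h : ∀ x, ev x F = ev x G) : F = G := by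
  apply MvPolynomial.funext
  intro v
  have := h (qt v)
  simp only [ev, vec_qt, MvPolynomial.coe_aeval_eq_eval] at this
  exact this

theorem ev_smul {F : Po} {d : ℕ} (hF : F.IsHomogeneous d) (c : ℝ) (x : ℍ[ℝ]) :
    ev (c • x) F = c ^ d * ev x F := by
  have : ∀ v : Fin 4 → ℝ, aeval v F = ∑ a ∈ F.support, F.coeff a * ∏ i, v i ^ a i := by
    intro v
    rw [MvPolynomial.aeval_def, MvPolynomial.eval₂_eq']
    rfl
  simp only [ev, this, Finset.mul_sum]
  refine Finset.sum_congr rfl fun a ha => ?_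
  have hd : ∑ i, a i = d := by
    have := hF (d := a) (by simpa [MvPolynomial.mem_support_iff] using ha)
    simpa [Finsupp.weight_apply, Finsupp.sum_fintype] using this
  rw [vec_smul]
  simp only [Pi.smul_apply, smul_eq_mul, mul_pow, Finset.prod_mul_distrib, Finset.prod_pow_eq_pow_sum, hd]
  ring

/-- restriction to an affine line -/
noncomputable def line (x h : ℍ[ℝ]) : Po →ₐ[ℝ] Polynomial ℝ :=
  aeval (fun i => Polynomial.C (vec x i) + Polynomial.X * Polynomial.C (vec h i))

theorem eval_line (x h : ℍ[ℝ]) (s : ℝ) (F : Po) : (line x h F).eval s = ev (x + s • h) F := by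
  have : ((Polynomial.aeval s).comp (line x h)) = ev (x + s • h) := by
    apply MvPolynomial.algHom_ext
    intro i
    simp [line, ev, vec_add, vec_smul]; ring
  have := DFunLike.congr_fun this F
  rw [← this, AlgHom.comp_apply, Polynomial.coe_aeval_eq_eval]

/-- substitution of a linear map -/
noncomputable def sub (T : ℍ[ℝ] →ₗ[ℝ] ℍ[ℝ]) : Po →ₐ[ℝ] Po :=
  aeval (fun i => ∑ j, C (vec (T (qt (Pi.single j 1))) i) * X j)

theorem q_decomp (x : ℍ[ℝ]) : x = ∑ j, vec x j • qt (Pi.single j 1) := by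
  rw [Fin.sum_univ_four]
  ext
  · simp only [Quaternion.re_add, Quaternion.re_smul]; simp [vec, qt]
  · simp only [Quaternion.imI_add, Quaternion.imI_smul]; simp [vec, qt]
  · simp only [Quaternion.imJ_add, Quaternion.imJ_smul]; simp [vec, qt]
  · simp only [Quaternion.imK_add, Quaternion.imK_smul]; simp [vec, qt]

theorem ev_sub (T : ℍ[ℝ] →ₗ[ℝ] ℍ[ℝ]) (F : Po) (x : ℍ[ℝ]) : ev x (sub T F) = ev (T x) F := by
  have : (ev x).comp (sub T) = ev (T x) := by
    apply MvPolynomial.algHom_ext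
    intro i
    have h2 : vecL (T x) i = ∑ j, vecL (T (qt (Pi.single j 1))) i * vec x j := by
      conv_lhs => rw [q_decomp x]
      simp [map_sum, map_smul, mul_comm]
    simp only [sub, AlgHom.comp_apply, aeval_X, map_sum, map_mul, ev_C, ev_X]
    exact h2.symm
  exact DFunLike.congr_fun this F

theorem sub_hom (T : ℍ[ℝ] →ₗ[ℝ] ℍ[ℝ]) {F : Po} {d : ℕ} (hF : F.IsHomogeneous d) :
    (sub T F).IsHomogeneous d := by
  have := hF.aeval (fun i => ∑ j, C (vec (T (qt (Pi.single j 1))) i) * X j : Fin 4 → Po) (n := 1)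
    (fun i => IsHomogeneous.sum _ _ _ fun j _ => isHomogeneous_C_mul_X _ _)
  rwa [one_mul] at this

theorem line_sub (T : ℍ[ℝ] →ₗ[ℝ] ℍ[ℝ]) (F : Po) (x h : ℍ[ℝ]) :
    line x h (sub T F) = line (T x) (T h) F := by
  apply Polynomial.funext
  intro s
  rw [eval_line, eval_line, ev_sub, map_add, map_smul]

/-! ### The group -/

/-- The maps `x ↦ p x q` and `x ↦ p x* q`. -/
noncomputable def act (p q : ℍ[ℝ]) : Bool → (ℍ[ℝ] →ₗ[ℝ] ℍ[ℝ])
  | true => { toFun := fun x => p * x * q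
              map_add' := by intros; simp [mul_add, add_mul]
              map_smul' := by intros; simp }
  | false => { toFun := fun x => p * star x * q
               map_add' := by intros; simp [mul_add, add_mul]
               map_smul' := by intros; simp }
@[simp] theorem act_true (p q x : ℍ[ℝ]) : act p q true x = p * x * q := rfl
@[simp] theorem act_false (p q x : ℍ[ℝ]) : act p q false x = p * star x * q := rfl

/-- invariance -/
def Inv (F : Po) : Prop := ∀ p ∈ D, ∀ q ∈ D, ∀ e, ∀ x, ev (act p q e x) F = ev x F

theorem inv_of {F : Po} (h1 : ∀ p ∈ D, ∀ q ∈ D, ∀ x, ev (p * x * q) F = ev x F)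
    (h2 : ∀ x, ev (star x) F = ev x F) : Inv F := by
  intro p hp q hq e x
  cases e
  · rw [act_false, h1 p hp q hq, h2]
  · rw [act_true, h1 p hp q hq]

/-- scalar product -/
noncomputable def dot (r x : ℍ[ℝ]) : ℝ := (star r * x).re
theorem dot_eq (r x : ℍ[ℝ]) : dot r x = r.re * x.re + r.imI * x.imI + r.imJ * x.imJ + r.imK * x.imK := by
  simp [dot, Quaternion.re_mul]
theorem dot_act (r p q x : ℍ[ℝ]) : dot r (p * x * q) = dot (star p * r * star q) x := by
  simp only [dot_eq, Quaternion.re_mul, Quaternion.imI_mul, Quaternion.imJ_mul, Quaternion.imK_mul,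
    Quaternion.re_star, Quaternion.imI_star, Quaternion.imJ_star, Quaternion.imK_star]
  ring
theorem dot_star (r x : ℍ[ℝ]) : dot r (star x) = dot (star r) x := by
  simp [dot_eq]

noncomputable def lin (r : ℍ[ℝ]) : Po := ∑ i, C (vec r i) * X i
theorem ev_lin (r x : ℍ[ℝ]) : ev x (lin r) = dot r x := by
  simp [lin, Fin.sum_univ_four, ev_C, ev_X, dot_eq, vec]
theorem lin_hom (r : ℍ[ℝ]) : (lin r).IsHomogeneous 1 :=
  IsHomogeneous.sum _ _ _ fun j _ => isHomogeneous_C_mul_X _ _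

noncomputable def nP : Po := X 0 ^ 2 + X 1 ^ 2 + X 2 ^ 2 + X 3 ^ 2
theorem ev_nP (x : ℍ[ℝ]) : ev x nP = normSq x := by
  simp [nP, ev_X, Quaternion.normSq_def', vec]
theorem nP_hom : nP.IsHomogeneous 2 :=
  (((isHomogeneous_X_pow _ _).add (isHomogeneous_X_pow _ _)).add (isHomogeneous_X_pow _ _)).add
    (isHomogeneous_X_pow _ _)
theorem nP_inv : Inv nP := by
  apply inv_of
  · intro p hp q hq x
    simp [ev_nP, D_normSq hp, D_normSq hq]
  · intro x; simp [ev_nP]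

noncomputable def J (k : ℕ) : Po := ∑ r ∈ D, (C 2 * lin r) ^ k
theorem ev_J (k : ℕ) (x : ℍ[ℝ]) : ev x (J k) = ∑ r ∈ D, (2 * dot r x) ^ k := by
  simp [J, ev_C, ev_lin, map_sum, -map_ofNat]
theorem J_hom (k : ℕ) : (J k).IsHomogeneous k := by
  refine IsHomogeneous.sum _ _ _ fun j _ => ?_
  have := ((lin_hom j).C_mul 2).pow k
  rwa [one_mul] at this
theorem J_inv (k : ℕ) : Inv (J k) := by
  apply inv_of
  · intro p hp q hq x
    simp only [ev_J, dot_act]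
    refine Finset.sum_nbij' (fun r => star p * r * star q) (fun r => p * r * q) ?_ ?_ ?_ ?_ ?_
    · intro r hr; exact D_mul (D_mul (D_star hp) hr) (D_star hq)
    · intro r hr; exact D_mul (D_mul hp hr) hq
    · intro r hr
      simp only [← mul_assoc, D_mul_star hp, one_mul]
      simp only [mul_assoc, D_star_mul hq, mul_one]
    · intro r hr
      simp only [← mul_assoc, D_star_mul hp, one_mul]
      simp only [mul_assoc, D_mul_star hq, mul_one]
    · intro r hr; rfl
  · intro x
    simp only [ev_J, dot_star]
    refine Finset.sum_nbij' (fun r => star r) (fun r => star r) ?_ ?_ ?_ ?_ ?_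
    · intro r hr; exact D_star hr
    · intro r hr; exact D_star hr
    · intro r _; simp
    · intro r _; simp
    · intro r hr; rfl

theorem Inv.mul {F G : Po} (hF : Inv F) (hG : Inv G) : Inv (F * G) := by
  intro p hp q hq e x; simp only [map_mul, hF p hp q hq e x, hG p hp q hq e x]
theorem Inv.add {F G : Po} (hF : Inv F) (hG : Inv G) : Inv (F + G) := by
  intro p hp q hq e x; simp only [map_add, hF p hp q hq e x, hG p hp q hq e x]
theorem Inv.sub {F G : Po} (hF : Inv F) (hG : Inv G) : Inv (F - G) := by
  intro p hp q hq e x; simp only [map_sub, hF p hp q hq e x, hG p hp q hq e x]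
theorem Inv.pow {F : Po} (hF : Inv F) (k : ℕ) : Inv (F ^ k) := by
  intro p hp q hq e x; simp only [map_pow, hF p hp q hq e x]
theorem Inv.const (c : ℝ) : Inv (C c) := by
  intro p hp q hq e x; simp only [ev_C]
theorem Inv.sum {ι : Type*} (s : Finset ι) (F : ι → Po) (h : ∀ i ∈ s, Inv (F i)) : Inv (∑ i ∈ s, F i) := by
  intro p hp q hq e x; simp only [map_sum]
  exact Finset.sum_congr rfl fun i hi => h i hi p hp q hq e x

/-! ### The basic invariants -/
noncomputable def aP : Po := C (-1/3360) * (J 12 - C 15960 * nP ^ 6)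
noncomputable def bP : Po := C (1/119680) * (J 20 - C 2460240 * nP ^ 10 + C 12457600 * (aP * nP ^ 4))
noncomputable def fP : Po := nP ^ 2 * bP - aP ^ 2
noncomputable def cP : Po := C (-1/9609600) * (J 30 - C 2192135640 * nP ^ 15 + C 29464344000 * (aP * nP ^ 9)
  - C 14807520000 * (bP * nP ^ 5)) + C (-36207/176) * (nP ^ 3 * fP)
noncomputable def eP : Po := nP ^ 2 * (nP * cP - aP * bP) - C (1/2) * (aP * fP)

theorem aP_inv : Inv aP := (Inv.const _).mul ((J_inv _).sub ((Inv.const _).mul (nP_inv.pow _)))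
theorem bP_inv : Inv bP := (Inv.const _).mul (((J_inv _).sub ((Inv.const _).mul (nP_inv.pow _))).add
  ((Inv.const _).mul (aP_inv.mul (nP_inv.pow _))))
theorem fP_inv : Inv fP := ((nP_inv.pow _).mul bP_inv).sub (aP_inv.pow _)
theorem cP_inv : Inv cP := ((Inv.const _).mul ((((J_inv _).sub ((Inv.const _).mul (nP_inv.pow _))).add
  ((Inv.const _).mul (aP_inv.mul (nP_inv.pow _)))).sub ((Inv.const _).mul (bP_inv.mul (nP_inv.pow _))))).add
  ((Inv.const _).mul ((nP_inv.pow _).mul fP_inv))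
theorem eP_inv : Inv eP := ((nP_inv.pow _).mul ((nP_inv.mul cP_inv).sub (aP_inv.mul bP_inv))).sub
  ((Inv.const _).mul (aP_inv.mul fP_inv))

theorem aP_hom : aP.IsHomogeneous 12 := ((J_hom _).sub ((nP_hom.pow 6).C_mul _)).C_mul _
theorem bP_hom : bP.IsHomogeneous 20 := (((J_hom _).sub ((nP_hom.pow 10).C_mul _)).add
  ((aP_hom.mul (nP_hom.pow 4)).C_mul _)).C_mul _
theorem fP_hom : fP.IsHomogeneous 24 := ((nP_hom.pow 2).mul bP_hom).sub (aP_hom.pow 2)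
theorem cP_hom : cP.IsHomogeneous 30 := (((((J_hom _).sub ((nP_hom.pow 15).C_mul _)).add
  ((aP_hom.mul (nP_hom.pow 9)).C_mul _)).sub ((bP_hom.mul (nP_hom.pow 5)).C_mul _)).C_mul _).add
  (((nP_hom.pow 3).mul fP_hom).C_mul _)
theorem eP_hom : eP.IsHomogeneous 36 := ((nP_hom.pow 2).mul ((nP_hom.mul cP_hom).sub (aP_hom.mul bP_hom))).sub
  ((aP_hom.mul fP_hom).C_mul _)

end H4

namespace H4
open Quaternion

/-! ### Power sums of the icosahedral orbits -/
section powersums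
variable {B : Type*} [CommRing B]

def zb (p : B) (a : Zp) : B := (a.1 : B) + (a.2 : B) * p
def lf (p x y z : B) (w : Zp × Zp × Zp) : B := zb p w.1 * x + zb p w.2.1 * y + zb p w.2.2 * z
def PS (p x y z : B) (l : List (Zp × Zp × Zp)) (j : ℕ) : B := (l.map (fun w => lf p x y z w ^ j)).sum

def N (x y z : B) : B := x ^ 2 + y ^ 2 + z ^ 2
def K (p x y z : B) : B := 4 * (x ^ 2 * y ^ 2 * z ^ 2)
  - p * (x ^ 4 * y ^ 2 + y ^ 4 * z ^ 2 + z ^ 4 * x ^ 2)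
  + (p - 1) * (x ^ 4 * z ^ 2 + y ^ 4 * x ^ 2 + z ^ 4 * y ^ 2)
def M (p x y z : B) : B := (1 - p) * (x ^ 8 * y ^ 2 + y ^ 8 * z ^ 2 + z ^ 8 * x ^ 2)
  + p * (x ^ 8 * z ^ 2 + y ^ 8 * x ^ 2 + z ^ 8 * y ^ 2)
  + (2 * p - 2) * (x ^ 6 * y ^ 4 + y ^ 6 * z ^ 4 + z ^ 6 * x ^ 4)
  - 2 * p * (x ^ 6 * z ^ 4 + y ^ 6 * x ^ 4 + z ^ 6 * y ^ 4)
  - 12 * (x ^ 6 * y ^ 2 * z ^ 2 + y ^ 6 * z ^ 2 * x ^ 2 + z ^ 6 * x ^ 2 * y ^ 2)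
  + 20 * (x ^ 4 * y ^ 4 * z ^ 2 + y ^ 4 * z ^ 4 * x ^ 2 + z ^ 4 * x ^ 4 * y ^ 2)

theorem fibp {p : B} (hp : p * p = p + 1) (k : ℕ) :
    p ^ (k + 1) = (Nat.fib (k + 1) : B) * p + (Nat.fib k : B) := by
  induction k with
  | zero => simp
  | succ k ih =>
    rw [pow_succ, ih, Nat.fib_add_two (n := k)]
    push_cast
    linear_combination (Nat.fib (k + 1) : B) * hp

theorem fp2 {p : B} (hp : p * p = p + 1) : p ^ 2 = 1 * p + 1 := by
  have := fibp hp 1; norm_num [Nat.fib] at this; linear_combination this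
theorem fp3 {p : B} (hp : p * p = p + 1) : p ^ 3 = 2 * p + 1 := by
  have := fibp hp 2; norm_num [Nat.fib] at this; linear_combination this
theorem fp4 {p : B} (hp : p * p = p + 1) : p ^ 4 = 3 * p + 2 := by
  have := fibp hp 3; norm_num [Nat.fib] at this; linear_combination this
theorem fp5 {p : B} (hp : p * p = p + 1) : p ^ 5 = 5 * p + 3 := by
  have := fibp hp 4; norm_num [Nat.fib] at this; linear_combination this
theorem fp6 {p : B} (hp : p * p = p + 1) : p ^ 6 = 8 * p + 5 := by
  have := fibp hp 5; norm_num [Nat.fib] at this; linear_combination this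
theorem fp7 {p : B} (hp : p * p = p + 1) : p ^ 7 = 13 * p + 8 := by
  have := fibp hp 6; norm_num [Nat.fib] at this; linear_combination this
theorem fp8 {p : B} (hp : p * p = p + 1) : p ^ 8 = 21 * p + 13 := by
  have := fibp hp 7; norm_num [Nat.fib] at this; linear_combination this
theorem fp9 {p : B} (hp : p * p = p + 1) : p ^ 9 = 34 * p + 21 := by
  have := fibp hp 8; norm_num [Nat.fib] at this; linear_combination this
theorem fp10 {p : B} (hp : p * p = p + 1) : p ^ 10 = 55 * p + 34 := by
  have := fibp hp 9; norm_num [Nat.fib] at this; linear_combination this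
theorem fp11 {p : B} (hp : p * p = p + 1) : p ^ 11 = 89 * p + 55 := by
  have := fibp hp 10; norm_num [Nat.fib] at this; linear_combination this
theorem ps_ico_2 {p : B} (hp : p * p = p + 1) (x y z : B) :
    PS p x y z ico 2 = (4 + 2 * p) * N x y z := by
  simp only [PS, ico, lf, zb, List.map_cons, List.map_nil, List.sum_cons, List.sum_nil, N, K, M]
  push_cast
  ring_nf
  simp only [fp2 hp, fp3 hp, fp4 hp, fp5 hp, fp6 hp, fp7 hp, fp8 hp, fp9 hp, fp10 hp]
  ring
theorem ps_ico_4 {p : B} (hp : p * p = p + 1) (x y z : B) :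
    PS p x y z ico 4 = (6 + 6 * p) * N x y z ^ 2 := by
  simp only [PS, ico, lf, zb, List.map_cons, List.map_nil, List.sum_cons, List.sum_nil, N, K, M]
  push_cast
  ring_nf
  simp only [fp2 hp, fp3 hp, fp4 hp, fp5 hp, fp6 hp, fp7 hp, fp8 hp, fp9 hp, fp10 hp]
  ring
theorem ps_ico_6 {p : B} (hp : p * p = p + 1) (x y z : B) :
    PS p x y z ico 6 = (6 + 8 * p) * (2 * N x y z ^ 3 - 3 * K p x y z) := by
  simp only [PS, ico, lf, zb, List.map_cons, List.map_nil, List.sum_cons, List.sum_nil, N, K, M]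
  push_cast
  ring_nf
  simp only [fp2 hp, fp3 hp, fp4 hp, fp5 hp, fp6 hp, fp7 hp, fp8 hp, fp9 hp, fp10 hp]
  ring
theorem ps_ico_8 {p : B} (hp : p * p = p + 1) (x y z : B) :
    PS p x y z ico 8 = (28 + 42 * p) * (N x y z ^ 4 - 4 * (N x y z * K p x y z)) := by
  simp only [PS, ico, lf, zb, List.map_cons, List.map_nil, List.sum_cons, List.sum_nil, N, K, M]
  push_cast
  ring_nf
  simp only [fp2 hp, fp3 hp, fp4 hp, fp5 hp, fp6 hp, fp7 hp, fp8 hp, fp9 hp, fp10 hp]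
  ring
theorem ps_ico_10 {p : B} (hp : p * p = p + 1) (x y z : B) :
    PS p x y z ico 10 = (14 + 22 * p) * (5 * N x y z ^ 5 + 2 * M p x y z - 38 * (N x y z ^ 2 * K p x y z)) := by
  simp only [PS, ico, lf, zb, List.map_cons, List.map_nil, List.sum_cons, List.sum_nil, N, K, M]
  push_cast
  ring_nf
  simp only [fp2 hp, fp3 hp, fp4 hp, fp5 hp, fp6 hp, fp7 hp, fp8 hp, fp9 hp, fp10 hp]
  ring
theorem ps_icoB_2 {p : B} (hp : p * p = p + 1) (x y z : B) :
    PS p x y z ico' 2 = (6 + -2 * p) * N x y z := by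
  simp only [PS, ico', lf, zb, List.map_cons, List.map_nil, List.sum_cons, List.sum_nil, N, K, M]
  push_cast
  ring_nf
  simp only [fp2 hp, fp3 hp, fp4 hp, fp5 hp, fp6 hp, fp7 hp, fp8 hp, fp9 hp, fp10 hp]
  ring
theorem ps_icoB_4 {p : B} (hp : p * p = p + 1) (x y z : B) :
    PS p x y z ico' 4 = (12 + -6 * p) * N x y z ^ 2 := by
  simp only [PS, ico', lf, zb, List.map_cons, List.map_nil, List.sum_cons, List.sum_nil, N, K, M]
  push_cast
  ring_nf
  simp only [fp2 hp, fp3 hp, fp4 hp, fp5 hp, fp6 hp, fp7 hp, fp8 hp, fp9 hp, fp10 hp]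
  ring
theorem ps_icoB_6 {p : B} (hp : p * p = p + 1) (x y z : B) :
    PS p x y z ico' 6 = (14 + -8 * p) * (2 * N x y z ^ 3 - 3 * K p x y z) := by
  simp only [PS, ico', lf, zb, List.map_cons, List.map_nil, List.sum_cons, List.sum_nil, N, K, M]
  push_cast
  ring_nf
  simp only [fp2 hp, fp3 hp, fp4 hp, fp5 hp, fp6 hp, fp7 hp, fp8 hp, fp9 hp, fp10 hp]
  ring
theorem ps_icoB_8 {p : B} (hp : p * p = p + 1) (x y z : B) :
    PS p x y z ico' 8 = (70 + -42 * p) * (N x y z ^ 4 - 4 * (N x y z * K p x y z)) := by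
  simp only [PS, ico', lf, zb, List.map_cons, List.map_nil, List.sum_cons, List.sum_nil, N, K, M]
  push_cast
  ring_nf
  simp only [fp2 hp, fp3 hp, fp4 hp, fp5 hp, fp6 hp, fp7 hp, fp8 hp, fp9 hp, fp10 hp]
  ring
theorem ps_icoB_10 {p : B} (hp : p * p = p + 1) (x y z : B) :
    PS p x y z ico' 10 = (36 + -22 * p) * (5 * N x y z ^ 5 + 2 * M p x y z - 38 * (N x y z ^ 2 * K p x y z)) := by
  simp only [PS, ico', lf, zb, List.map_cons, List.map_nil, List.sum_cons, List.sum_nil, N, K, M]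
  push_cast
  ring_nf
  simp only [fp2 hp, fp3 hp, fp4 hp, fp5 hp, fp6 hp, fp7 hp, fp8 hp, fp9 hp, fp10 hp]
  ring
theorem ps_dod_2 {p : B} (hp : p * p = p + 1) (x y z : B) :
    PS p x y z dod 2 = 10 * N x y z := by
  simp only [PS, dod, lf, zb, List.map_cons, List.map_nil, List.sum_cons, List.sum_nil, N, K, M]
  push_cast
  ring_nf
  simp only [fp2 hp, fp3 hp, fp4 hp, fp5 hp, fp6 hp, fp7 hp, fp8 hp, fp9 hp, fp10 hp]
  ring
theorem ps_dod_4 {p : B} (hp : p * p = p + 1) (x y z : B) :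
    PS p x y z dod 4 = 18 * N x y z ^ 2 := by
  simp only [PS, dod, lf, zb, List.map_cons, List.map_nil, List.sum_cons, List.sum_nil, N, K, M]
  push_cast
  ring_nf
  simp only [fp2 hp, fp3 hp, fp4 hp, fp5 hp, fp6 hp, fp7 hp, fp8 hp, fp9 hp, fp10 hp]
  ring
theorem ps_dod_6 {p : B} (hp : p * p = p + 1) (x y z : B) :
    PS p x y z dod 6 = (40 * N x y z ^ 3 + 30 * K p x y z) := by
  simp only [PS, dod, lf, zb, List.map_cons, List.map_nil, List.sum_cons, List.sum_nil, N, K, M]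
  push_cast
  ring_nf
  simp only [fp2 hp, fp3 hp, fp4 hp, fp5 hp, fp6 hp, fp7 hp, fp8 hp, fp9 hp, fp10 hp]
  ring
theorem ps_dod_8 {p : B} (hp : p * p = p + 1) (x y z : B) :
    PS p x y z dod 8 = (98 * N x y z ^ 4 + 168 * (N x y z * K p x y z)) := by
  simp only [PS, dod, lf, zb, List.map_cons, List.map_nil, List.sum_cons, List.sum_nil, N, K, M]
  push_cast
  ring_nf
  simp only [fp2 hp, fp3 hp, fp4 hp, fp5 hp, fp6 hp, fp7 hp, fp8 hp, fp9 hp, fp10 hp]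
  ring
theorem ps_dod_10 {p : B} (hp : p * p = p + 1) (x y z : B) :
    PS p x y z dod 10 = (250 * N x y z ^ 5 + 100 * M p x y z + 620 * (N x y z ^ 2 * K p x y z)) := by
  simp only [PS, dod, lf, zb, List.map_cons, List.map_nil, List.sum_cons, List.sum_nil, N, K, M]
  push_cast
  ring_nf
  simp only [fp2 hp, fp3 hp, fp4 hp, fp5 hp, fp6 hp, fp7 hp, fp8 hp, fp9 hp, fp10 hp]
  ring
end powersums
end H4

namespace H4
open Quaternion

/-! ### Truncated expansions of the power sums over the icosians -/
section trunc
variable {B : Type*} [CommRing B]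

def lf4 (p t x y z : B) (u : Iq) : B := zb p u.1 * t + lf p x y z u.2
def JL (p t x y z : B) (k : ℕ) : B := (L.map (fun u => lf4 p t x y z u ^ k)).sum

theorem zb_neg (p : B) (a : Zp) : zb p (zneg a) = - zb p a := by
  simp only [zb, zneg]; push_cast; ring
theorem lf_neg (p x y z : B) (w : Zp × Zp × Zp) : lf p x y z (neg3 w) = - lf p x y z w := by
  simp only [lf, neg3, zb_neg]; ring
theorem lf4_neg (p t x y z : B) (w : Iq) : lf4 p t x y z (qneg w) = - lf4 p t x y z w := by
  simp only [lf4, lf, qneg, zb_neg]; ring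
theorem JL_V (p t x y z : B) (k : ℕ) (hk : Even k) :
    JL p t x y z k = 2 * (V.map (fun u => lf4 p t x y z u ^ k)).sum := by
  rw [JL, L, List.map_append, List.sum_append, List.map_map, two_mul]
  congr 3
  funext u
  simp only [Function.comp, lf4_neg, hk.neg_pow]
theorem pair12 (c w : B) (hw : w ^ 12 = 0) : (c + w) ^ 12 + (c + -w) ^ 12 =
    2 * (c ^ 12 + 66 * (c ^ 10 * w ^ 2) + 495 * (c ^ 8 * w ^ 4) + 924 * (c ^ 6 * w ^ 6) + 495 * (c ^ 4 * w ^ 8) + 66 * (c ^ 2 * w ^ 10)) := by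
  linear_combination (2 * (c ^ 0 * w ^ 0)) * hw
theorem pm12 (p t x y z : B) (hw : ∀ w, lf p x y z w ^ 12 = 0) (c : Zp) (l : List (Zp × Zp × Zp)) :
    ((pm c l).map (fun u => lf4 p t x y z u ^ 12)).sum = 2 * ((l.length : B) * (zb p c * t) ^ 12 +
    66 * ((zb p c * t) ^ 10 * PS p x y z l 2) + 495 * ((zb p c * t) ^ 8 * PS p x y z l 4) + 924 * ((zb p c * t) ^ 6 * PS p x y z l 6) + 495 * ((zb p c * t) ^ 4 * PS p x y z l 8) + 66 * ((zb p c * t) ^ 2 * PS p x y z l 10)) := by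
  rw [pm, List.map_append, List.sum_append, List.map_map, List.map_map]
  induction l with
  | nil => simp [PS]
  | cons w l ih =>
    have h := pair12 (zb p c * t) (lf p x y z w) (hw w)
    simp only [List.map_cons, List.sum_cons, Function.comp, PS, lf4, lf_neg, List.length_cons] at ih ⊢
    push_cast
    linear_combination ih + h
theorem icd12 (p t x y z : B) (hw : ∀ w, lf p x y z w ^ 12 = 0) (l : List (Zp × Zp × Zp)) :
    ((l.map (fun w => (((0,0) : Zp), w))).map (fun u => lf4 p t x y z u ^ 12)).sum = 0 := by
  rw [List.map_map]
  induction l with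
  | nil => simp
  | cons w l ih =>
    rw [List.map_cons, List.sum_cons, ih, add_zero]
    simp only [Function.comp, lf4, zb, Int.cast_zero, zero_mul, add_zero, zero_add]
    linear_combination (lf p x y z w ^ 0) * hw w
theorem co12_0 {p : B} (hp : p * p = p + 1) : p ^ 12 * (6 + 0 * p) + (p - 1) ^ 12 * (6 + 0 * p) = 1932 := by
  have h1 := fibp hp 11
  have h2 := fibp (p := 1 - p) (by linear_combination hp) 11
  have h3 : (p - 1) ^ 12 = (1 - p) ^ 12 := by
    rw [← Even.neg_pow (by decide), neg_sub]
  norm_num [Nat.fib] at h1 h2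
  rw [h3, h1, h2]
  linear_combination (0) * hp
theorem co12_1 {p : B} (hp : p * p = p + 1) : p ^ 10 * (6 + -2 * p) + (p - 1) ^ 10 * (4 + 2 * p) = 340 := by
  have h1 := fibp hp 9
  have h2 := fibp (p := 1 - p) (by linear_combination hp) 9
  have h3 : (p - 1) ^ 10 = (1 - p) ^ 10 := by
    rw [← Even.neg_pow (by decide), neg_sub]
  norm_num [Nat.fib] at h1 h2
  rw [h3, h1, h2]
  linear_combination (-220) * hp
theorem co12_2 {p : B} (hp : p * p = p + 1) : p ^ 8 * (12 + -6 * p) + (p - 1) ^ 8 * (6 + 6 * p) = 108 := by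
  have h1 := fibp hp 7
  have h2 := fibp (p := 1 - p) (by linear_combination hp) 7
  have h3 : (p - 1) ^ 8 = (1 - p) ^ 8 := by
    rw [← Even.neg_pow (by decide), neg_sub]
  norm_num [Nat.fib] at h1 h2
  rw [h3, h1, h2]
  linear_combination (-252) * hp
theorem co12_3 {p : B} (hp : p * p = p + 1) : p ^ 6 * (14 + -8 * p) + (p - 1) ^ 6 * (6 + 8 * p) = 20 := by
  have h1 := fibp hp 5
  have h2 := fibp (p := 1 - p) (by linear_combination hp) 5
  have h3 : (p - 1) ^ 6 = (1 - p) ^ 6 := by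
    rw [← Even.neg_pow (by decide), neg_sub]
  norm_num [Nat.fib] at h1 h2
  rw [h3, h1, h2]
  linear_combination (-128) * hp
theorem co12_4 {p : B} (hp : p * p = p + 1) : p ^ 4 * (70 + -42 * p) + (p - 1) ^ 4 * (28 + 42 * p) = 28 := by
  have h1 := fibp hp 3
  have h2 := fibp (p := 1 - p) (by linear_combination hp) 3
  have h3 : (p - 1) ^ 4 = (1 - p) ^ 4 := by
    rw [← Even.neg_pow (by decide), neg_sub]
  norm_num [Nat.fib] at h1 h2
  rw [h3, h1, h2]
  linear_combination (-252) * hp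
theorem co12_5 {p : B} (hp : p * p = p + 1) : p ^ 2 * (36 + -22 * p) + (p - 1) ^ 2 * (14 + 22 * p) = 20 := by
  linear_combination (6 + 0 * p) * hp
theorem JL12 {p : B} (hp : p * p = p + 1) (t x y z n k m : B) (hw : ∀ w, lf p x y z w ^ 12 = 0)
    (hn : n = N x y z) (hk : k = K p x y z) (hm : m = M p x y z) :
    JL p t x y z 12 = 15960 * t ^ 12 + 264 * (t ^ 10 * (340 * n + 10 * n)) + 1980 * (t ^ 8 * (108 * n ^ 2 + 18 * n ^ 2)) + 3696 * (t ^ 6 * (20 * (2 * n ^ 3 - 3 * k) + (40 * n ^ 3 + 30 * k))) + 1980 * (t ^ 4 * (28 * (n ^ 4 - 4 * (n * k)) + (98 * n ^ 4 + 168 * (n * k)))) + 264 * (t ^ 2 * (20 * (5 * n ^ 5 + 2 * m - 38 * (n ^ 2 * k)) + (250 * n ^ 5 + 100 * m + 620 * (n ^ 2 * k)))) := by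
  rw [JL_V _ _ _ _ _ _ (by decide), V]
  simp only [List.map_append, List.sum_append, pm12 p t x y z hw, icd12 p t x y z hw, ps_ico_2 hp, ps_ico_4 hp, ps_ico_6 hp,
    ps_ico_8 hp, ps_ico_10 hp, ps_icoB_2 hp, ps_icoB_4 hp, ps_icoB_6 hp, ps_icoB_8 hp, ps_icoB_10 hp,
    ps_dod_2 hp, ps_dod_4 hp, ps_dod_6 hp, ps_dod_8 hp, ps_dod_10 hp, ← hn, ← hk, ← hm]
  simp only [ico, ico', dod, List.map_cons, List.map_nil, List.sum_cons, List.sum_nil, List.length_cons, List.length_nil, lf4, lf, zb]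
  push_cast
  linear_combination (4 * t ^ 12) * co12_0 hp + (264 * (t ^ 10 * n)) * co12_1 hp + (1980 * (t ^ 8 * n ^ 2)) * co12_2 hp + (3696 * (t ^ 6 * (2 * n ^ 3 - 3 * k))) * co12_3 hp + (1980 * (t ^ 4 * (n ^ 4 - 4 * (n * k)))) * co12_4 hp + (264 * (t ^ 2 * (5 * n ^ 5 + 2 * m - 38 * (n ^ 2 * k)))) * co12_5 hp
theorem pair20 (c w : B) (hw : w ^ 12 = 0) : (c + w) ^ 20 + (c + -w) ^ 20 =
    2 * (c ^ 20 + 190 * (c ^ 18 * w ^ 2) + 4845 * (c ^ 16 * w ^ 4) + 38760 * (c ^ 14 * w ^ 6) + 125970 * (c ^ 12 * w ^ 8) + 184756 * (c ^ 10 * w ^ 10)) := by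
  linear_combination (251940 * (c ^ 8 * w ^ 0) + 77520 * (c ^ 6 * w ^ 2) + 9690 * (c ^ 4 * w ^ 4) + 380 * (c ^ 2 * w ^ 6) + 2 * (c ^ 0 * w ^ 8)) * hw
theorem pm20 (p t x y z : B) (hw : ∀ w, lf p x y z w ^ 12 = 0) (c : Zp) (l : List (Zp × Zp × Zp)) :
    ((pm c l).map (fun u => lf4 p t x y z u ^ 20)).sum = 2 * ((l.length : B) * (zb p c * t) ^ 20 +
    190 * ((zb p c * t) ^ 18 * PS p x y z l 2) + 4845 * ((zb p c * t) ^ 16 * PS p x y z l 4) + 38760 * ((zb p c * t) ^ 14 * PS p x y z l 6) + 125970 * ((zb p c * t) ^ 12 * PS p x y z l 8) + 184756 * ((zb p c * t) ^ 10 * PS p x y z l 10)) := by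
  rw [pm, List.map_append, List.sum_append, List.map_map, List.map_map]
  induction l with
  | nil => simp [PS]
  | cons w l ih =>
    have h := pair20 (zb p c * t) (lf p x y z w) (hw w)
    simp only [List.map_cons, List.sum_cons, Function.comp, PS, lf4, lf_neg, List.length_cons] at ih ⊢
    push_cast
    linear_combination ih + h
theorem icd20 (p t x y z : B) (hw : ∀ w, lf p x y z w ^ 12 = 0) (l : List (Zp × Zp × Zp)) :
    ((l.map (fun w => (((0,0) : Zp), w))).map (fun u => lf4 p t x y z u ^ 20)).sum = 0 := by
  rw [List.map_map]
  induction l with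
  | nil => simp
  | cons w l ih =>
    rw [List.map_cons, List.sum_cons, ih, add_zero]
    simp only [Function.comp, lf4, zb, Int.cast_zero, zero_mul, add_zero, zero_add]
    linear_combination (lf p x y z w ^ 8) * hw w
theorem co20_0 {p : B} (hp : p * p = p + 1) : p ^ 20 * (6 + 0 * p) + (p - 1) ^ 20 * (6 + 0 * p) = 90762 := by
  have h1 := fibp hp 19
  have h2 := fibp (p := 1 - p) (by linear_combination hp) 19
  have h3 : (p - 1) ^ 20 = (1 - p) ^ 20 := by
    rw [← Even.neg_pow (by decide), neg_sub]
  norm_num [Nat.fib] at h1 h2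
  rw [h3, h1, h2]
  linear_combination (0) * hp
theorem co20_1 {p : B} (hp : p * p = p + 1) : p ^ 18 * (6 + -2 * p) + (p - 1) ^ 18 * (4 + 2 * p) = 15970 := by
  have h1 := fibp hp 17
  have h2 := fibp (p := 1 - p) (by linear_combination hp) 17
  have h3 : (p - 1) ^ 18 = (1 - p) ^ 18 := by
    rw [← Even.neg_pow (by decide), neg_sub]
  norm_num [Nat.fib] at h1 h2
  rw [h3, h1, h2]
  linear_combination (-10336) * hp
theorem co20_2 {p : B} (hp : p * p = p + 1) : p ^ 16 * (12 + -6 * p) + (p - 1) ^ 16 * (6 + 6 * p) = 5058 := by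
  have h1 := fibp hp 15
  have h2 := fibp (p := 1 - p) (by linear_combination hp) 15
  have h3 : (p - 1) ^ 16 = (1 - p) ^ 16 := by
    rw [← Even.neg_pow (by decide), neg_sub]
  norm_num [Nat.fib] at h1 h2
  rw [h3, h1, h2]
  linear_combination (-11844) * hp
theorem co20_3 {p : B} (hp : p * p = p + 1) : p ^ 14 * (14 + -8 * p) + (p - 1) ^ 14 * (6 + 8 * p) = 890 := by
  have h1 := fibp hp 13
  have h2 := fibp (p := 1 - p) (by linear_combination hp) 13
  have h3 : (p - 1) ^ 14 = (1 - p) ^ 14 := by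
    rw [← Even.neg_pow (by decide), neg_sub]
  norm_num [Nat.fib] at h1 h2
  rw [h3, h1, h2]
  linear_combination (-6032) * hp
theorem co20_4 {p : B} (hp : p * p = p + 1) : p ^ 12 * (70 + -42 * p) + (p - 1) ^ 12 * (28 + 42 * p) = 658 := by
  have h1 := fibp hp 11
  have h2 := fibp (p := 1 - p) (by linear_combination hp) 11
  have h3 : (p - 1) ^ 12 = (1 - p) ^ 12 := by
    rw [← Even.neg_pow (by decide), neg_sub]
  norm_num [Nat.fib] at h1 h2
  rw [h3, h1, h2]
  linear_combination (-12096) * hp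
theorem co20_5 {p : B} (hp : p * p = p + 1) : p ^ 10 * (36 + -22 * p) + (p - 1) ^ 10 * (14 + 22 * p) = 50 := by
  have h1 := fibp hp 9
  have h2 := fibp (p := 1 - p) (by linear_combination hp) 9
  have h3 : (p - 1) ^ 10 = (1 - p) ^ 10 := by
    rw [← Even.neg_pow (by decide), neg_sub]
  norm_num [Nat.fib] at h1 h2
  rw [h3, h1, h2]
  linear_combination (-2420) * hp
theorem JL20 {p : B} (hp : p * p = p + 1) (t x y z n k m : B) (hw : ∀ w, lf p x y z w ^ 12 = 0)
    (hn : n = N x y z) (hk : k = K p x y z) (hm : m = M p x y z) :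
    JL p t x y z 20 = 2460240 * t ^ 20 + 760 * (t ^ 18 * (15970 * n + 10 * n)) + 19380 * (t ^ 16 * (5058 * n ^ 2 + 18 * n ^ 2)) + 155040 * (t ^ 14 * (890 * (2 * n ^ 3 - 3 * k) + (40 * n ^ 3 + 30 * k))) + 503880 * (t ^ 12 * (658 * (n ^ 4 - 4 * (n * k)) + (98 * n ^ 4 + 168 * (n * k)))) + 739024 * (t ^ 10 * (50 * (5 * n ^ 5 + 2 * m - 38 * (n ^ 2 * k)) + (250 * n ^ 5 + 100 * m + 620 * (n ^ 2 * k)))) := by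
  rw [JL_V _ _ _ _ _ _ (by decide), V]
  simp only [List.map_append, List.sum_append, pm20 p t x y z hw, icd20 p t x y z hw, ps_ico_2 hp, ps_ico_4 hp, ps_ico_6 hp,
    ps_ico_8 hp, ps_ico_10 hp, ps_icoB_2 hp, ps_icoB_4 hp, ps_icoB_6 hp, ps_icoB_8 hp, ps_icoB_10 hp,
    ps_dod_2 hp, ps_dod_4 hp, ps_dod_6 hp, ps_dod_8 hp, ps_dod_10 hp, ← hn, ← hk, ← hm]
  simp only [ico, ico', dod, List.map_cons, List.map_nil, List.sum_cons, List.sum_nil, List.length_cons, List.length_nil, lf4, lf, zb]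
  push_cast
  linear_combination (4 * t ^ 20) * co20_0 hp + (760 * (t ^ 18 * n)) * co20_1 hp + (19380 * (t ^ 16 * n ^ 2)) * co20_2 hp + (155040 * (t ^ 14 * (2 * n ^ 3 - 3 * k))) * co20_3 hp + (503880 * (t ^ 12 * (n ^ 4 - 4 * (n * k)))) * co20_4 hp + (739024 * (t ^ 10 * (5 * n ^ 5 + 2 * m - 38 * (n ^ 2 * k)))) * co20_5 hp
theorem pair30 (c w : B) (hw : w ^ 12 = 0) : (c + w) ^ 30 + (c + -w) ^ 30 =
    2 * (c ^ 30 + 435 * (c ^ 28 * w ^ 2) + 27405 * (c ^ 26 * w ^ 4) + 593775 * (c ^ 24 * w ^ 6) + 5852925 * (c ^ 22 * w ^ 8) + 30045015 * (c ^ 20 * w ^ 10)) := by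
  linear_combination (172986450 * (c ^ 18 * w ^ 0) + 290845350 * (c ^ 16 * w ^ 2) + 290845350 * (c ^ 14 * w ^ 4) + 172986450 * (c ^ 12 * w ^ 6) + 60090030 * (c ^ 10 * w ^ 8) + 11705850 * (c ^ 8 * w ^ 10) + 1187550 * (c ^ 6 * w ^ 12) + 54810 * (c ^ 4 * w ^ 14) + 870 * (c ^ 2 * w ^ 16) + 2 * (c ^ 0 * w ^ 18)) * hw
theorem pm30 (p t x y z : B) (hw : ∀ w, lf p x y z w ^ 12 = 0) (c : Zp) (l : List (Zp × Zp × Zp)) :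
    ((pm c l).map (fun u => lf4 p t x y z u ^ 30)).sum = 2 * ((l.length : B) * (zb p c * t) ^ 30 +
    435 * ((zb p c * t) ^ 28 * PS p x y z l 2) + 27405 * ((zb p c * t) ^ 26 * PS p x y z l 4) + 593775 * ((zb p c * t) ^ 24 * PS p x y z l 6) + 5852925 * ((zb p c * t) ^ 22 * PS p x y z l 8) + 30045015 * ((zb p c * t) ^ 20 * PS p x y z l 10)) := by
  rw [pm, List.map_append, List.sum_append, List.map_map, List.map_map]
  induction l with
  | nil => simp [PS]
  | cons w l ih =>
    have h := pair30 (zb p c * t) (lf p x y z w) (hw w)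
    simp only [List.map_cons, List.sum_cons, Function.comp, PS, lf4, lf_neg, List.length_cons] at ih ⊢
    push_cast
    linear_combination ih + h
theorem icd30 (p t x y z : B) (hw : ∀ w, lf p x y z w ^ 12 = 0) (l : List (Zp × Zp × Zp)) :
    ((l.map (fun w => (((0,0) : Zp), w))).map (fun u => lf4 p t x y z u ^ 30)).sum = 0 := by
  rw [List.map_map]
  induction l with
  | nil => simp
  | cons w l ih =>
    rw [List.map_cons, List.sum_cons, ih, add_zero]
    simp only [Function.comp, lf4, zb, Int.cast_zero, zero_mul, add_zero, zero_add]
    linear_combination (lf p x y z w ^ 18) * hw w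
theorem co30_0 {p : B} (hp : p * p = p + 1) : p ^ 30 * (6 + 0 * p) + (p - 1) ^ 30 * (6 + 0 * p) = 11162988 := by
  have h1 := fibp hp 29
  have h2 := fibp (p := 1 - p) (by linear_combination hp) 29
  have h3 : (p - 1) ^ 30 = (1 - p) ^ 30 := by
    rw [← Even.neg_pow (by decide), neg_sub]
  norm_num [Nat.fib] at h1 h2
  rw [h3, h1, h2]
  linear_combination (0) * hp
theorem co30_1 {p : B} (hp : p * p = p + 1) : p ^ 28 * (6 + -2 * p) + (p - 1) ^ 28 * (4 + 2 * p) = 1964180 := by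
  have h1 := fibp hp 27
  have h2 := fibp (p := 1 - p) (by linear_combination hp) 27
  have h3 : (p - 1) ^ 28 = (1 - p) ^ 28 := by
    rw [← Even.neg_pow (by decide), neg_sub]
  norm_num [Nat.fib] at h1 h2
  rw [h3, h1, h2]
  linear_combination (-1271244) * hp
theorem co30_2 {p : B} (hp : p * p = p + 1) : p ^ 26 * (12 + -6 * p) + (p - 1) ^ 26 * (6 + 6 * p) = 622092 := by
  have h1 := fibp hp 25
  have h2 := fibp (p := 1 - p) (by linear_combination hp) 25
  have h3 : (p - 1) ^ 26 = (1 - p) ^ 26 := by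
    rw [← Even.neg_pow (by decide), neg_sub]
  norm_num [Nat.fib] at h1 h2
  rw [h3, h1, h2]
  linear_combination (-1456716) * hp
theorem co30_3 {p : B} (hp : p * p = p + 1) : p ^ 24 * (14 + -8 * p) + (p - 1) ^ 24 * (6 + 8 * p) = 109460 := by
  have h1 := fibp hp 23
  have h2 := fibp (p := 1 - p) (by linear_combination hp) 23
  have h3 : (p - 1) ^ 24 = (1 - p) ^ 24 := by
    rw [← Even.neg_pow (by decide), neg_sub]
  norm_num [Nat.fib] at h1 h2
  rw [h3, h1, h2]
  linear_combination (-741888) * hp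
theorem co30_4 {p : B} (hp : p * p = p + 1) : p ^ 22 * (70 + -42 * p) + (p - 1) ^ 22 * (28 + 42 * p) = 80892 := by
  have h1 := fibp hp 21
  have h2 := fibp (p := 1 - p) (by linear_combination hp) 21
  have h3 : (p - 1) ^ 22 = (1 - p) ^ 22 := by
    rw [← Even.neg_pow (by decide), neg_sub]
  norm_num [Nat.fib] at h1 h2
  rw [h3, h1, h2]
  linear_combination (-1487724) * hp
theorem co30_5 {p : B} (hp : p * p = p + 1) : p ^ 20 * (36 + -22 * p) + (p - 1) ^ 20 * (14 + 22 * p) = 6100 := by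
  have h1 := fibp hp 19
  have h2 := fibp (p := 1 - p) (by linear_combination hp) 19
  have h3 : (p - 1) ^ 20 = (1 - p) ^ 20 := by
    rw [← Even.neg_pow (by decide), neg_sub]
  norm_num [Nat.fib] at h1 h2
  rw [h3, h1, h2]
  linear_combination (-297660) * hp
theorem JL30 {p : B} (hp : p * p = p + 1) (t x y z n k m : B) (hw : ∀ w, lf p x y z w ^ 12 = 0)
    (hn : n = N x y z) (hk : k = K p x y z) (hm : m = M p x y z) :
    JL p t x y z 30 = 2192135640 * t ^ 30 + 1740 * (t ^ 28 * (1964180 * n + 10 * n)) + 109620 * (t ^ 26 * (622092 * n ^ 2 + 18 * n ^ 2)) + 2375100 * (t ^ 24 * (109460 * (2 * n ^ 3 - 3 * k) + (40 * n ^ 3 + 30 * k))) + 23411700 * (t ^ 22 * (80892 * (n ^ 4 - 4 * (n * k)) + (98 * n ^ 4 + 168 * (n * k)))) + 120180060 * (t ^ 20 * (6100 * (5 * n ^ 5 + 2 * m - 38 * (n ^ 2 * k)) + (250 * n ^ 5 + 100 * m + 620 * (n ^ 2 * k)))) := by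
  rw [JL_V _ _ _ _ _ _ (by decide), V]
  simp only [List.map_append, List.sum_append, pm30 p t x y z hw, icd30 p t x y z hw, ps_ico_2 hp, ps_ico_4 hp, ps_ico_6 hp,
    ps_ico_8 hp, ps_ico_10 hp, ps_icoB_2 hp, ps_icoB_4 hp, ps_icoB_6 hp, ps_icoB_8 hp, ps_icoB_10 hp,
    ps_dod_2 hp, ps_dod_4 hp, ps_dod_6 hp, ps_dod_8 hp, ps_dod_10 hp, ← hn, ← hk, ← hm]
  simp only [ico, ico', dod, List.map_cons, List.map_nil, List.sum_cons, List.sum_nil, List.length_cons, List.length_nil, lf4, lf, zb]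
  push_cast
  linear_combination (4 * t ^ 30) * co30_0 hp + (1740 * (t ^ 28 * n)) * co30_1 hp + (109620 * (t ^ 26 * n ^ 2)) * co30_2 hp + (2375100 * (t ^ 24 * (2 * n ^ 3 - 3 * k))) * co30_3 hp + (23411700 * (t ^ 22 * (n ^ 4 - 4 * (n * k)))) * co30_4 hp + (120180060 * (t ^ 20 * (5 * n ^ 5 + 2 * m - 38 * (n ^ 2 * k)))) * co30_5 hp
end trunc
end H4

namespace H4
open Quaternion

/-! ### Leading terms of the basic invariants -/
section leading
variable {B : Type*} [CommRing B]

theorem nup2 (t n : B) (hn6 : n ^ 6 = 0) : (t ^ 2 + n) ^ 2 = (1) * t ^ 4 + (2) * t ^ 2 * n ^ 1 + (1) * n ^ 2 := by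
  linear_combination 0
theorem nup3 (t n : B) (hn6 : n ^ 6 = 0) : (t ^ 2 + n) ^ 3 = (1) * t ^ 6 + (3) * t ^ 4 * n ^ 1 + (3) * t ^ 2 * n ^ 2 + (1) * n ^ 3 := by
  linear_combination 0
theorem nup4 (t n : B) (hn6 : n ^ 6 = 0) : (t ^ 2 + n) ^ 4 = (1) * t ^ 8 + (4) * t ^ 6 * n ^ 1 + (6) * t ^ 4 * n ^ 2 + (4) * t ^ 2 * n ^ 3 + (1) * n ^ 4 := by
  linear_combination 0
theorem nup5 (t n : B) (hn6 : n ^ 6 = 0) : (t ^ 2 + n) ^ 5 = (1) * t ^ 10 + (5) * t ^ 8 * n ^ 1 + (10) * t ^ 6 * n ^ 2 + (10) * t ^ 4 * n ^ 3 + (5) * t ^ 2 * n ^ 4 + (1) * n ^ 5 := by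
  linear_combination 0
theorem nup6 (t n : B) (hn6 : n ^ 6 = 0) : (t ^ 2 + n) ^ 6 = (1) * t ^ 12 + (6) * t ^ 10 * n ^ 1 + (15) * t ^ 8 * n ^ 2 + (20) * t ^ 6 * n ^ 3 + (15) * t ^ 4 * n ^ 4 + (6) * t ^ 2 * n ^ 5 := by
  linear_combination ((1)) * hn6
theorem nup9 (t n : B) (hn6 : n ^ 6 = 0) : (t ^ 2 + n) ^ 9 = (1) * t ^ 18 + (9) * t ^ 16 * n ^ 1 + (36) * t ^ 14 * n ^ 2 + (84) * t ^ 12 * n ^ 3 + (126) * t ^ 10 * n ^ 4 + (126) * t ^ 8 * n ^ 5 := by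
  linear_combination ((84) * t ^ 6 + (36) * t ^ 4 * n ^ 1 + (9) * t ^ 2 * n ^ 2 + (1) * n ^ 3) * hn6
theorem nup10 (t n : B) (hn6 : n ^ 6 = 0) : (t ^ 2 + n) ^ 10 = (1) * t ^ 20 + (10) * t ^ 18 * n ^ 1 + (45) * t ^ 16 * n ^ 2 + (120) * t ^ 14 * n ^ 3 + (210) * t ^ 12 * n ^ 4 + (252) * t ^ 10 * n ^ 5 := by
  linear_combination ((210) * t ^ 8 + (120) * t ^ 6 * n ^ 1 + (45) * t ^ 4 * n ^ 2 + (10) * t ^ 2 * n ^ 3 + (1) * n ^ 4) * hn6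
theorem nup15 (t n : B) (hn6 : n ^ 6 = 0) : (t ^ 2 + n) ^ 15 = (1) * t ^ 30 + (15) * t ^ 28 * n ^ 1 + (105) * t ^ 26 * n ^ 2 + (455) * t ^ 24 * n ^ 3 + (1365) * t ^ 22 * n ^ 4 + (3003) * t ^ 20 * n ^ 5 := by
  linear_combination ((5005) * t ^ 18 + (6435) * t ^ 16 * n ^ 1 + (6435) * t ^ 14 * n ^ 2 + (5005) * t ^ 12 * n ^ 3 + (3003) * t ^ 10 * n ^ 4 + (1365) * t ^ 8 * n ^ 5 + (455) * t ^ 6 * n ^ 6 + (105) * t ^ 4 * n ^ 7 + (15) * t ^ 2 * n ^ 8 + (1) * n ^ 9) * hn6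
theorem lead_a (t n k m a j : B) (hn6 : n ^ 6 = 0) (hnk : n ^ 3 * k = 0) (hkk : k ^ 2 = 0) (hnm : n * m = 0) (hkm : k * m = 0) (hmm : m ^ 2 = 0)
    (hj : j = 15960 * t ^ 12 + 264 * (t ^ 10 * (340 * n + 10 * n)) + 1980 * (t ^ 8 * (108 * n ^ 2 + 18 * n ^ 2)) + 3696 * (t ^ 6 * (20 * (2 * n ^ 3 - 3 * k) + (40 * n ^ 3 + 30 * k))) + 1980 * (t ^ 4 * (28 * (n ^ 4 - 4 * (n * k)) + (98 * n ^ 4 + 168 * (n * k)))) + 264 * (t ^ 2 * (20 * (5 * n ^ 5 + 2 * m - 38 * (n ^ 2 * k)) + (250 * n ^ 5 + 100 * m + 620 * (n ^ 2 * k)))))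
    (ha : (-3360) * a = j - 15960 * (t ^ 2 + n) ^ 6) : 3360 * a = 3360 * ((1) * t ^ 10 * n ^ 1 + (-3) * t ^ 8 * n ^ 2 + (7) * t ^ 6 * n ^ 3 + (33) * t ^ 6 * k ^ 1 + (-3) * t ^ 4 * n ^ 4 + (-33) * t ^ 4 * n ^ 1 * k ^ 1 + (1) * t ^ 2 * n ^ 5 + (11) * t ^ 2 * n ^ 2 * k ^ 1 + (-11) * t ^ 2 * m ^ 1) := by
  rw [nup6 t n hn6] at ha
  linear_combination (-1) * ha - hj
theorem lead_b (t n k m a b j : B) (hn6 : n ^ 6 = 0) (hnk : n ^ 3 * k = 0) (hkk : k ^ 2 = 0) (hnm : n * m = 0) (hkm : k * m = 0) (hmm : m ^ 2 = 0)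
    (hj : j = 2460240 * t ^ 20 + 760 * (t ^ 18 * (15970 * n + 10 * n)) + 19380 * (t ^ 16 * (5058 * n ^ 2 + 18 * n ^ 2)) + 155040 * (t ^ 14 * (890 * (2 * n ^ 3 - 3 * k) + (40 * n ^ 3 + 30 * k))) + 503880 * (t ^ 12 * (658 * (n ^ 4 - 4 * (n * k)) + (98 * n ^ 4 + 168 * (n * k)))) + 739024 * (t ^ 10 * (50 * (5 * n ^ 5 + 2 * m - 38 * (n ^ 2 * k)) + (250 * n ^ 5 + 100 * m + 620 * (n ^ 2 * k)))))
    (ha : a = (1) * t ^ 10 * n ^ 1 + (-3) * t ^ 8 * n ^ 2 + (7) * t ^ 6 * n ^ 3 + (33) * t ^ 6 * k ^ 1 + (-3) * t ^ 4 * n ^ 4 + (-33) * t ^ 4 * n ^ 1 * k ^ 1 + (1) * t ^ 2 * n ^ 5 + (11) * t ^ 2 * n ^ 2 * k ^ 1 + (-11) * t ^ 2 * m ^ 1)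
    (hb : 119680 * b = j - 2460240 * (t ^ 2 + n) ^ 10 + 12457600 * (a * (t ^ 2 + n) ^ 4)) : 119680 * b = 119680 * ((1) * t ^ 16 * n ^ 2 + (-5) * t ^ 14 * n ^ 3 + (15) * t ^ 14 * k ^ 1 + (11) * t ^ 12 * n ^ 4 + (-69) * t ^ 12 * n ^ 1 * k ^ 1 + (-11) * t ^ 10 * n ^ 5 + (111) * t ^ 10 * n ^ 2 * k ^ 1 + (90) * t ^ 10 * m ^ 1) := by
  rw [nup10 t n hn6, nup4 t n hn6, ha, hj] at hb
  linear_combination hb + ((137033600) * t ^ 8 + (12457600) * t ^ 6 * n ^ 1 + (12457600) * t ^ 4 * n ^ 2 + (12457600) * t ^ 2 * n ^ 3) * hn6 + ((-274067200) * t ^ 8 + (-411100800) * t ^ 6 * n ^ 1 + (137033600) * t ^ 4 * n ^ 2 + (137033600) * t ^ 2 * n ^ 3) * hnk + ((-548134400) * t ^ 8 + (-822201600) * t ^ 6 * n ^ 1 + (-548134400) * t ^ 4 * n ^ 2 + (-137033600) * t ^ 2 * n ^ 3) * hnm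
theorem lead_f (t n k m a b f : B) (hn6 : n ^ 6 = 0) (hnk : n ^ 3 * k = 0) (hkk : k ^ 2 = 0) (hnm : n * m = 0) (hkm : k * m = 0) (hmm : m ^ 2 = 0)
    (ha : a = (1) * t ^ 10 * n ^ 1 + (-3) * t ^ 8 * n ^ 2 + (7) * t ^ 6 * n ^ 3 + (33) * t ^ 6 * k ^ 1 + (-3) * t ^ 4 * n ^ 4 + (-33) * t ^ 4 * n ^ 1 * k ^ 1 + (1) * t ^ 2 * n ^ 5 + (11) * t ^ 2 * n ^ 2 * k ^ 1 + (-11) * t ^ 2 * m ^ 1)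
    (hb : b = (1) * t ^ 16 * n ^ 2 + (-5) * t ^ 14 * n ^ 3 + (15) * t ^ 14 * k ^ 1 + (11) * t ^ 12 * n ^ 4 + (-69) * t ^ 12 * n ^ 1 * k ^ 1 + (-11) * t ^ 10 * n ^ 5 + (111) * t ^ 10 * n ^ 2 * k ^ 1 + (90) * t ^ 10 * m ^ 1)
    (hf : f = (t ^ 2 + n) ^ 2 * b - a ^ 2) : f = (3) * t ^ 18 * n ^ 3 + (15) * t ^ 18 * k ^ 1 + (-21) * t ^ 16 * n ^ 4 + (-105) * t ^ 16 * n ^ 1 * k ^ 1 + (54) * t ^ 14 * n ^ 5 + (252) * t ^ 14 * n ^ 2 * k ^ 1 + (90) * t ^ 14 * m ^ 1 := by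
  rw [nup2 t n hn6, ha, hb] at hf
  linear_combination hf + ((-80) * t ^ 12 + (37) * t ^ 10 * n ^ 1 + (-23) * t ^ 8 * n ^ 2 + (6) * t ^ 6 * n ^ 3 + (-1) * t ^ 4 * n ^ 4) * hn6 + ((202) * t ^ 12 + (24) * t ^ 10 * n ^ 1 + (154) * t ^ 8 * n ^ 2 + (-66) * t ^ 6 * n ^ 3 + (-726) * t ^ 6 * k ^ 1 + (22) * t ^ 4 * n ^ 4 + (242) * t ^ 4 * n ^ 1 * k ^ 1) * hnm + ((-529) * t ^ 12 + (837) * t ^ 10 * n ^ 1 + (-418) * t ^ 8 * n ^ 2 + (132) * t ^ 6 * n ^ 3 + (-22) * t ^ 4 * n ^ 4) * hnk + ((-1089) * t ^ 12 + (2178) * t ^ 10 * n ^ 1 + (-1815) * t ^ 8 * n ^ 2 + (726) * t ^ 6 * n ^ 3 + (-121) * t ^ 4 * n ^ 4) * hkk + ((726) * t ^ 8) * hkm + ((-121) * t ^ 4) * hmm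
theorem lead_c (t n k m a b f c j : B) (hn6 : n ^ 6 = 0) (hnk : n ^ 3 * k = 0) (hkk : k ^ 2 = 0) (hnm : n * m = 0) (hkm : k * m = 0) (hmm : m ^ 2 = 0)
    (hj : j = 2192135640 * t ^ 30 + 1740 * (t ^ 28 * (1964180 * n + 10 * n)) + 109620 * (t ^ 26 * (622092 * n ^ 2 + 18 * n ^ 2)) + 2375100 * (t ^ 24 * (109460 * (2 * n ^ 3 - 3 * k) + (40 * n ^ 3 + 30 * k))) + 23411700 * (t ^ 22 * (80892 * (n ^ 4 - 4 * (n * k)) + (98 * n ^ 4 + 168 * (n * k)))) + 120180060 * (t ^ 20 * (6100 * (5 * n ^ 5 + 2 * m - 38 * (n ^ 2 * k)) + (250 * n ^ 5 + 100 * m + 620 * (n ^ 2 * k)))))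
    (ha : a = (1) * t ^ 10 * n ^ 1 + (-3) * t ^ 8 * n ^ 2 + (7) * t ^ 6 * n ^ 3 + (33) * t ^ 6 * k ^ 1 + (-3) * t ^ 4 * n ^ 4 + (-33) * t ^ 4 * n ^ 1 * k ^ 1 + (1) * t ^ 2 * n ^ 5 + (11) * t ^ 2 * n ^ 2 * k ^ 1 + (-11) * t ^ 2 * m ^ 1)
    (hb : b = (1) * t ^ 16 * n ^ 2 + (-5) * t ^ 14 * n ^ 3 + (15) * t ^ 14 * k ^ 1 + (11) * t ^ 12 * n ^ 4 + (-69) * t ^ 12 * n ^ 1 * k ^ 1 + (-11) * t ^ 10 * n ^ 5 + (111) * t ^ 10 * n ^ 2 * k ^ 1 + (90) * t ^ 10 * m ^ 1)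
    (hf : f = (3) * t ^ 18 * n ^ 3 + (15) * t ^ 18 * k ^ 1 + (-21) * t ^ 16 * n ^ 4 + (-105) * t ^ 16 * n ^ 1 * k ^ 1 + (54) * t ^ 14 * n ^ 5 + (252) * t ^ 14 * n ^ 2 * k ^ 1 + (90) * t ^ 14 * m ^ 1)
    (hc : 9609600 * c = -(j - 2192135640 * (t ^ 2 + n) ^ 15 + 29464344000 * (a * (t ^ 2 + n) ^ 9)
      - 14807520000 * (b * (t ^ 2 + n) ^ 5)) - 1976902200 * ((t ^ 2 + n) ^ 3 * f)) :
    960960 * (10 * c) = 960960 * ((10) * t ^ 24 * n ^ 3 + (-75) * t ^ 22 * n ^ 4 + (225) * t ^ 22 * n ^ 1 * k ^ 1 + (252) * t ^ 20 * n ^ 5 + (-1935) * t ^ 20 * n ^ 2 * k ^ 1 + (675) * t ^ 20 * m ^ 1) := by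
  rw [nup15 t n hn6, nup9 t n hn6, nup5 t n hn6, nup3 t n hn6, ha, hb, hf, hj] at hc
  linear_combination hc + ((-7036618352400) * t ^ 18 + (-9119854762200) * t ^ 16 * n ^ 1 + (-18320238190800) * t ^ 14 * n ^ 2 + (6773483808000) * t ^ 12 * n ^ 3 + (-3875390064000) * t ^ 10 * n ^ 4) * hn6 + ((-50267845555200) * t ^ 18 + (-46462701940200) * t ^ 16 * n ^ 1 + (-16173367610400) * t ^ 14 * n ^ 2 + (88871616288000) * t ^ 12 * n ^ 3 + (-39193946064000) * t ^ 10 * n ^ 4) * hnk + ((9046590462000) * t ^ 18 + (24460884630000) * t ^ 16 * n ^ 1 + (40373900658000) * t ^ 14 * n ^ 2 + (47500964784000) * t ^ 12 * n ^ 3 + (42170257584000) * t ^ 10 * n ^ 4) * hnm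
theorem lead_e (t n k m a b f c e : B) (hn6 : n ^ 6 = 0) (hnk : n ^ 3 * k = 0) (hkk : k ^ 2 = 0) (hnm : n * m = 0) (hkm : k * m = 0) (hmm : m ^ 2 = 0)
    (ha : a = (1) * t ^ 10 * n ^ 1 + (-3) * t ^ 8 * n ^ 2 + (7) * t ^ 6 * n ^ 3 + (33) * t ^ 6 * k ^ 1 + (-3) * t ^ 4 * n ^ 4 + (-33) * t ^ 4 * n ^ 1 * k ^ 1 + (1) * t ^ 2 * n ^ 5 + (11) * t ^ 2 * n ^ 2 * k ^ 1 + (-11) * t ^ 2 * m ^ 1)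
    (hb : b = (1) * t ^ 16 * n ^ 2 + (-5) * t ^ 14 * n ^ 3 + (15) * t ^ 14 * k ^ 1 + (11) * t ^ 12 * n ^ 4 + (-69) * t ^ 12 * n ^ 1 * k ^ 1 + (-11) * t ^ 10 * n ^ 5 + (111) * t ^ 10 * n ^ 2 * k ^ 1 + (90) * t ^ 10 * m ^ 1)
    (hf : f = (3) * t ^ 18 * n ^ 3 + (15) * t ^ 18 * k ^ 1 + (-21) * t ^ 16 * n ^ 4 + (-105) * t ^ 16 * n ^ 1 * k ^ 1 + (54) * t ^ 14 * n ^ 5 + (252) * t ^ 14 * n ^ 2 * k ^ 1 + (90) * t ^ 14 * m ^ 1)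
    (hc : 10 * c = (10) * t ^ 24 * n ^ 3 + (-75) * t ^ 22 * n ^ 4 + (225) * t ^ 22 * n ^ 1 * k ^ 1 + (252) * t ^ 20 * n ^ 5 + (-1935) * t ^ 20 * n ^ 2 * k ^ 1 + (675) * t ^ 20 * m ^ 1)
    (he : 2 * e = 2 * ((t ^ 2 + n) ^ 2 * ((t ^ 2 + n) * c - a * b)) - a * f) :
    10 * e = (27) * t ^ 26 * n ^ 5 + (675) * t ^ 26 * m ^ 1 := by
  have hg : (t ^ 2 + n) * (10 * c) - 10 * (a * b) = (15) * t ^ 24 * n ^ 4 + (75) * t ^ 24 * n ^ 1 * k ^ 1 + (-153) * t ^ 22 * n ^ 5 + (-900) * t ^ 22 * n ^ 2 * k ^ 1 + (675) * t ^ 22 * m ^ 1 := by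
    rw [hc, ha, hb]
    linear_combination ((1072) * t ^ 20 + (-1260) * t ^ 18 * n ^ 1 + (1150) * t ^ 16 * n ^ 2 + (-440) * t ^ 14 * n ^ 3 + (110) * t ^ 12 * n ^ 4) * hn6 + ((-225) * t ^ 20 + (2810) * t ^ 18 * n ^ 1 + (-6850) * t ^ 16 * n ^ 2 + (3910) * t ^ 14 * n ^ 3 + (22110) * t ^ 14 * k ^ 1 + (-2110) * t ^ 12 * n ^ 4 + (2310) * t ^ 12 * n ^ 1 * k ^ 1) * hnm + ((-4185) * t ^ 20 + (3220) * t ^ 18 * n ^ 1 + (-2180) * t ^ 16 * n ^ 2 + (-820) * t ^ 14 * n ^ 3 + (100) * t ^ 12 * n ^ 4) * hnk + ((-4950) * t ^ 20 + (27720) * t ^ 18 * n ^ 1 + (-61050) * t ^ 16 * n ^ 2 + (44220) * t ^ 14 * n ^ 3 + (-12210) * t ^ 12 * n ^ 4) * hkk + ((-28050) * t ^ 16) * hkm + ((9900) * t ^ 12) * hmm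
  have h2 : 10 * e = (t ^ 2 + n) ^ 2 * ((t ^ 2 + n) * (10 * c) - 10 * (a * b)) - 5 * (a * f) := by
    linear_combination 5 * he
  rw [hg, nup2 t n hn6, ha, hf] at h2
  linear_combination h2 + ((-981) * t ^ 24 + (1437) * t ^ 22 * n ^ 1 + (-2220) * t ^ 20 * n ^ 2 + (915) * t ^ 18 * n ^ 3 + (-270) * t ^ 16 * n ^ 4) * hn6 + ((900) * t ^ 24 + (2025) * t ^ 22 * n ^ 1 + (-2985) * t ^ 20 * n ^ 2 + (195) * t ^ 18 * n ^ 3 + (9075) * t ^ 18 * k ^ 1 + (2520) * t ^ 16 * n ^ 4 + (8910) * t ^ 16 * n ^ 1 * k ^ 1) * hnm + ((-5580) * t ^ 24 + (10740) * t ^ 22 * n ^ 1 + (-23010) * t ^ 20 * n ^ 2 + (14370) * t ^ 18 * n ^ 3 + (-4230) * t ^ 16 * n ^ 4) * hnk + ((-2475) * t ^ 24 + (19800) * t ^ 22 * n ^ 1 + (-59730) * t ^ 20 * n ^ 2 + (47355) * t ^ 18 * n ^ 3 + (-13860) * t ^ 16 * n ^ 4) * hkk + ((-14025) * t ^ 20)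 * hkm + ((4950) * t ^ 16) * hmm
end leading
end H4

namespace H4
open Quaternion

/-! ### Expansion at the identity -/

theorem J_eq_JL (k : ℕ) : J k = JL (C gr) (X 0) (X 1) (X 2) (X 3) k := by
  rw [J, D, Finset.sum_map, List.sum_toFinset _ L_nodup, JL]
  congr 1
  apply List.map_congr_left
  intro u _
  congr 1
  have hz : ∀ a : Zp, (C 2 * C (zv a / 2) : Po) = zb (C gr) a := by
    intro a
    rw [← C_mul, zb, show 2 * (zv a / 2) = zv a by ring, zv]
    simp
  simp only [lin, Fin.sum_univ_four, Function.Embedding.coeFn_mk, vec_emb, tup, lf4, lf, ← hz, mul_add]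
  simp [mul_assoc, add_assoc]

/-- the ideal of the first point -/
noncomputable def I0 : Ideal Po := Ideal.span {X 1, X 2, X 3}
theorem X1_mem : (X 1 : Po) ∈ I0 := Ideal.subset_span (by simp)
theorem X2_mem : (X 2 : Po) ∈ I0 := Ideal.subset_span (by simp)
theorem X3_mem : (X 3 : Po) ∈ I0 := Ideal.subset_span (by simp)

theorem lf_mem (w : Zp × Zp × Zp) : lf (C gr) (X 1) (X 2) (X 3) w ∈ I0 := by
  unfold lf
  exact I0.add_mem (I0.add_mem (I0.mul_mem_left _ X1_mem) (I0.mul_mem_left _ X2_mem)) (I0.mul_mem_left _ X3_mem)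

noncomputable def NP : Po := N (X 1) (X 2) (X 3)
noncomputable def KP : Po := K (C gr) (X 1) (X 2) (X 3)
noncomputable def MP : Po := M (C gr) (X 1) (X 2) (X 3)

theorem pw3 (i j k d : ℕ) (h : i + j + k = d) : (X 1 ^ i * X 2 ^ j * X 3 ^ k : Po) ∈ I0 ^ d := by
  subst h
  rw [pow_add, pow_add]
  exact Ideal.mul_mem_mul (Ideal.mul_mem_mul (Ideal.pow_mem_pow X1_mem _) (Ideal.pow_mem_pow X2_mem _)) (Ideal.pow_mem_pow X3_mem _)

theorem NP_mem : NP ∈ I0 ^ 2 := by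
  have : NP = X 1 ^ 2 * X 2 ^ 0 * X 3 ^ 0 + X 1 ^ 0 * X 2 ^ 2 * X 3 ^ 0 + X 1 ^ 0 * X 2 ^ 0 * X 3 ^ 2 := by
    simp [NP, N]
  rw [this]
  exact add_mem (add_mem (pw3 _ _ _ _ rfl) (pw3 _ _ _ _ rfl)) (pw3 _ _ _ _ rfl)
theorem KP_mem : KP ∈ I0 ^ 6 := by
  have : KP = 4 * (X 1 ^ 2 * X 2 ^ 2 * X 3 ^ 2) + -C gr * (X 1 ^ 4 * X 2 ^ 2 * X 3 ^ 0) + -C gr * (X 1 ^ 0 * X 2 ^ 4 * X 3 ^ 2) + -C gr * (X 1 ^ 2 * X 2 ^ 0 * X 3 ^ 4) + (C gr - 1) * (X 1 ^ 4 * X 2 ^ 0 * X 3 ^ 2) + (C gr - 1) * (X 1 ^ 2 * X 2 ^ 4 * X 3 ^ 0) + (C gr - 1) * (X 1 ^ 0 * X 2 ^ 2 * X 3 ^ 4) := by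
    simp only [KP, K]; ring
  rw [this]
  repeat' apply add_mem
  all_goals exact Ideal.mul_mem_left _ _ (pw3 _ _ _ _ rfl)
theorem MP_mem : MP ∈ I0 ^ 10 := by
  have : MP = (1 - C gr) * (X 1 ^ 8 * X 2 ^ 2 * X 3 ^ 0) + (1 - C gr) * (X 1 ^ 0 * X 2 ^ 8 * X 3 ^ 2) + (1 - C gr) * (X 1 ^ 2 * X 2 ^ 0 * X 3 ^ 8) + C gr * (X 1 ^ 8 * X 2 ^ 0 * X 3 ^ 2) + C gr * (X 1 ^ 2 * X 2 ^ 8 * X 3 ^ 0) + C gr * (X 1 ^ 0 * X 2 ^ 2 * X 3 ^ 8) + (2 * C gr - 2) * (X 1 ^ 6 * X 2 ^ 4 * X 3 ^ 0) + (2 * C gr - 2) * (X 1 ^ 0 * X 2 ^ 6 * X 3 ^ 4) + (2 * C gr - 2) * (X 1 ^ 4 * X 2 ^ 0 * X 3 ^ 6) + (-2 * C gr) * (X 1 ^ 6 * X 2 ^ 0 * X 3 ^ 4) + (-2 * C gr) * (X 1 ^ 4 * X 2 ^ 6 * X 3 ^ 0) + (-2 * C gr) * (X 1 ^ 0 * X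 2 ^ 4 * X 3 ^ 6) + (-12) * (X 1 ^ 6 * X 2 ^ 2 * X 3 ^ 2) + (-12) * (X 1 ^ 2 * X 2 ^ 6 * X 3 ^ 2) + (-12) * (X 1 ^ 2 * X 2 ^ 2 * X 3 ^ 6) + 20 * (X 1 ^ 4 * X 2 ^ 4 * X 3 ^ 2) + 20 * (X 1 ^ 2 * X 2 ^ 4 * X 3 ^ 4) + 20 * (X 1 ^ 4 * X 2 ^ 2 * X 3 ^ 4) := by
    simp only [MP, M]; ring
  rw [this]
  repeat' apply add_mem
  all_goals exact Ideal.mul_mem_left _ _ (pw3 _ _ _ _ rfl)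

abbrev Qt := Po ⧸ (I0 ^ 12)
noncomputable abbrev mkq : Po →+* Qt := Ideal.Quotient.mk (I0 ^ 12)

theorem mk0 {F : Po} {d : ℕ} (hF : F ∈ I0 ^ d) (hd : 12 ≤ d) : mkq F = 0 :=
  Ideal.Quotient.eq_zero_iff_mem.2 (Ideal.pow_le_pow_right hd hF)

theorem JL_map {R S : Type*} [CommRing R] [CommRing S] (g : R →+* S) (p t x y z : R) (k : ℕ) :
    g (JL p t x y z k) = JL (g p) (g t) (g x) (g y) (g z) k := by
  rw [JL, JL, map_list_sum, List.map_map]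
  congr 1
  apply List.map_congr_left
  intro u _
  simp [lf4, lf, zb]
theorem lf_map {R S : Type*} [CommRing R] [CommRing S] (g : R →+* S) (p x y z : R) (w : Zp × Zp × Zp) :
    g (lf p x y z w) = lf (g p) (g x) (g y) (g z) w := by
  simp [lf, zb]
theorem N_map {R S : Type*} [CommRing R] [CommRing S] (g : R →+* S) (x y z : R) :
    g (N x y z) = N (g x) (g y) (g z) := by simp [N]
theorem K_map {R S : Type*} [CommRing R] [CommRing S] (g : R →+* S) (p x y z : R) :
    g (K p x y z) = K (g p) (g x) (g y) (g z) := by simp [K, map_ofNat]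
theorem M_map {R S : Type*} [CommRing R] [CommRing S] (g : R →+* S) (p x y z : R) :
    g (M p x y z) = M (g p) (g x) (g y) (g z) := by simp [M, map_ofNat]

theorem cancelq (c : ℝ) (hc : c ≠ 0) {a b : Qt} (h : mkq (C c) * a = mkq (C c) * b) : a = b := by
  have h1 : mkq (C c⁻¹) * mkq (C c) = 1 := by
    rw [← map_mul, ← C_mul, inv_mul_cancel₀ hc]; simp
  calc a = mkq (C c⁻¹) * (mkq (C c) * a) := by rw [← mul_assoc, h1, one_mul]
    _ = b := by rw [h, ← mul_assoc, h1, one_mul]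

theorem grq : (mkq (C gr)) * mkq (C gr) = mkq (C gr) + 1 := by
  rw [← map_mul, ← C_mul, gr_sq]; simp
theorem hwq (w : Zp × Zp × Zp) : lf (mkq (C gr)) (mkq (X 1)) (mkq (X 2)) (mkq (X 3)) w ^ 12 = 0 := by
  rw [← lf_map, ← map_pow]
  exact mk0 (Ideal.pow_mem_pow (lf_mem w) 12) le_rfl

theorem qn6 : mkq NP ^ 6 = 0 := by
  rw [← map_pow]; refine mk0 (d := 2 * 6) ?_ (by norm_num)
  rw [pow_mul]; exact Ideal.pow_mem_pow NP_mem 6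
theorem qnk : mkq NP ^ 3 * mkq KP = 0 := by
  rw [← map_pow, ← map_mul]; refine mk0 (d := 2 * 3 + 6) ?_ (by norm_num)
  rw [pow_add]; exact Ideal.mul_mem_mul (by rw [pow_mul]; exact Ideal.pow_mem_pow NP_mem 3) KP_mem
theorem qkk : mkq KP ^ 2 = 0 := by
  rw [← map_pow]; refine mk0 (d := 6 * 2) ?_ (by norm_num)
  rw [pow_mul]; exact Ideal.pow_mem_pow KP_mem 2
theorem qnm : mkq NP * mkq MP = 0 := by
  rw [← map_mul]; refine mk0 (d := 2 + 10) ?_ (by norm_num)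
  rw [pow_add]; exact Ideal.mul_mem_mul NP_mem MP_mem
theorem qkm : mkq KP * mkq MP = 0 := by
  rw [← map_mul]; refine mk0 (d := 6 + 10) ?_ (by norm_num)
  rw [pow_add]; exact Ideal.mul_mem_mul KP_mem MP_mem
theorem qmm : mkq MP ^ 2 = 0 := by
  rw [← map_pow]; refine mk0 (d := 10 * 2) ?_ (by norm_num)
  rw [pow_mul]; exact Ideal.pow_mem_pow MP_mem 2
theorem qnu : mkq nP = mkq (X 0) ^ 2 + mkq NP := by
  rw [← map_pow, ← map_add]; congr 1; simp only [nP, NP, N]; ring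
theorem mkN (k : ℕ) [k.AtLeastTwo] : mkq (C (OfNat.ofNat k : ℝ)) = (OfNat.ofNat k : Qt) := by
  rw [map_ofNat, map_ofNat]

theorem exp_a : mkq aP = (1) * mkq (X 0) ^ 10 * mkq NP ^ 1 + (-3) * mkq (X 0) ^ 8 * mkq NP ^ 2 + (7) * mkq (X 0) ^ 6 * mkq NP ^ 3 + (33) * mkq (X 0) ^ 6 * mkq KP ^ 1 + (-3) * mkq (X 0) ^ 4 * mkq NP ^ 4 + (-33) * mkq (X 0) ^ 4 * mkq NP ^ 1 * mkq KP ^ 1 + (1) * mkq (X 0) ^ 2 * mkq NP ^ 5 + (11) * mkq (X 0) ^ 2 * mkq NP ^ 2 * mkq KP ^ 1 + (-11) * mkq (X 0) ^ 2 * mkq MP ^ 1 := by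
  apply cancelq 3360 (by norm_num)
  rw [mkN]
  refine lead_a (mkq (X 0)) (mkq NP) (mkq KP) (mkq MP) _ (mkq (J 12)) qn6 qnk qkk qnm qkm qmm (by rw [J_eq_JL, JL_map]; exact JL12 grq _ _ _ _ _ _ _ hwq (N_map _ _ _ _) (K_map _ _ _ _ _) (M_map _ _ _ _ _)) ?_
  rw [← qnu]
  have : (C (-3360) : Po) * aP = J 12 - C 15960 * nP ^ 6 := by
    rw [aP, ← mul_assoc, ← C_mul]; norm_num
  have := congrArg mkq this
  simpa only [map_mul, map_sub, map_pow, map_neg, map_ofNat] using this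
theorem exp_b : mkq bP = (1) * mkq (X 0) ^ 16 * mkq NP ^ 2 + (-5) * mkq (X 0) ^ 14 * mkq NP ^ 3 + (15) * mkq (X 0) ^ 14 * mkq KP ^ 1 + (11) * mkq (X 0) ^ 12 * mkq NP ^ 4 + (-69) * mkq (X 0) ^ 12 * mkq NP ^ 1 * mkq KP ^ 1 + (-11) * mkq (X 0) ^ 10 * mkq NP ^ 5 + (111) * mkq (X 0) ^ 10 * mkq NP ^ 2 * mkq KP ^ 1 + (90) * mkq (X 0) ^ 10 * mkq MP ^ 1 := by
  apply cancelq 119680 (by norm_num)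
  rw [mkN]
  refine lead_b (mkq (X 0)) (mkq NP) (mkq KP) (mkq MP) _ _ (mkq (J 20)) qn6 qnk qkk qnm qkm qmm (by rw [J_eq_JL, JL_map]; exact JL20 grq _ _ _ _ _ _ _ hwq (N_map _ _ _ _) (K_map _ _ _ _ _) (M_map _ _ _ _ _)) exp_a ?_
  rw [← qnu]
  have : (C 119680 : Po) * bP = J 20 - C 2460240 * nP ^ 10 + C 12457600 * (aP * nP ^ 4) := by
    rw [bP, ← mul_assoc, ← C_mul]; norm_num
  have := congrArg mkq this
  simpa only [map_mul, map_sub, map_add, map_pow, map_neg, map_ofNat] using this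
theorem exp_f : mkq fP = (3) * mkq (X 0) ^ 18 * mkq NP ^ 3 + (15) * mkq (X 0) ^ 18 * mkq KP ^ 1 + (-21) * mkq (X 0) ^ 16 * mkq NP ^ 4 + (-105) * mkq (X 0) ^ 16 * mkq NP ^ 1 * mkq KP ^ 1 + (54) * mkq (X 0) ^ 14 * mkq NP ^ 5 + (252) * mkq (X 0) ^ 14 * mkq NP ^ 2 * mkq KP ^ 1 + (90) * mkq (X 0) ^ 14 * mkq MP ^ 1 := by
  refine lead_f (mkq (X 0)) (mkq NP) (mkq KP) (mkq MP) _ _ _ qn6 qnk qkk qnm qkm qmm exp_a exp_b ?_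
  rw [← qnu, fP]
  simp only [map_mul, map_sub, map_add, map_pow]
theorem exp_c : 10 * mkq cP = (10) * mkq (X 0) ^ 24 * mkq NP ^ 3 + (-75) * mkq (X 0) ^ 22 * mkq NP ^ 4 + (225) * mkq (X 0) ^ 22 * mkq NP ^ 1 * mkq KP ^ 1 + (252) * mkq (X 0) ^ 20 * mkq NP ^ 5 + (-1935) * mkq (X 0) ^ 20 * mkq NP ^ 2 * mkq KP ^ 1 + (675) * mkq (X 0) ^ 20 * mkq MP ^ 1 := by
  apply cancelq 960960 (by norm_num)
  rw [mkN]
  refine lead_c (mkq (X 0)) (mkq NP) (mkq KP) (mkq MP) _ _ _ _ (mkq (J 30)) qn6 qnk qkk qnm qkm qmm (by rw [J_eq_JL, JL_map]; exact JL30 grq _ _ _ _ _ _ _ hwq (N_map _ _ _ _) (K_map _ _ _ _ _) (M_map _ _ _ _ _)) exp_a exp_b exp_f ?_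
  rw [← qnu]
  have : (C 9609600 : Po) * cP = -(J 30 - C 2192135640 * nP ^ 15 + C 29464344000 * (aP * nP ^ 9)
      - C 14807520000 * (bP * nP ^ 5)) - C 1976902200 * (nP ^ 3 * fP) := by
    have h1 : (C (-1/9609600) : Po) = - C (1/9609600) := by rw [← C_neg]; norm_num
    have h2 : (C (-36207/176) : Po) = - (C (1/9609600) * C 1976902200) := by rw [← C_mul, ← C_neg]; norm_num
    have h3 : (C 9609600 : Po) * C (1/9609600) = 1 := by rw [← C_mul]; norm_num
    rw [cP, h1, h2]
    linear_combination (-(J 30 - C 2192135640 * nP ^ 15 + C 29464344000 * (aP * nP ^ 9)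
      - C 14807520000 * (bP * nP ^ 5)) - C 1976902200 * (nP ^ 3 * fP)) * h3
  have := congrArg mkq this
  simpa only [map_mul, map_sub, map_add, map_pow, map_neg, map_ofNat] using this
theorem exp_e : 10 * mkq eP = (27) * mkq (X 0) ^ 26 * mkq NP ^ 5 + (675) * mkq (X 0) ^ 26 * mkq MP ^ 1 := by
  refine lead_e (mkq (X 0)) (mkq NP) (mkq KP) (mkq MP) _ _ _ _ _ qn6 qnk qkk qnm qkm qmm exp_a exp_b exp_f exp_c ?_
  rw [← qnu]
  have : (C 2 : Po) * eP = C 2 * (nP ^ 2 * (nP * cP - aP * bP)) - aP * fP := by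
    have h3 : (C 2 : Po) * C (1/2) = 1 := by rw [← C_mul]; norm_num
    rw [eP]
    linear_combination (-aP * fP) * h3
  have := congrArg mkq this
  simpa only [map_mul, map_sub, map_add, map_pow, map_neg, map_ofNat] using this
end H4

namespace H4
open Quaternion

/-- an imaginary quaternion -/
def im3 (h1 h2 h3 : ℝ) : ℍ[ℝ] := ⟨0, h1, h2, h3⟩
noncomputable abbrev ln (h1 h2 h3 : ℝ) : Po →ₐ[ℝ] Polynomial ℝ := line 1 (im3 h1 h2 h3)
theorem ln_X0 (h1 h2 h3 : ℝ) : ln h1 h2 h3 (X 0) = 1 := by simp [ln, line, vec, im3]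
theorem ln_X1 (h1 h2 h3 : ℝ) : ln h1 h2 h3 (X 1) = Polynomial.X * Polynomial.C h1 := by simp [ln, line, vec, im3]
theorem ln_X2 (h1 h2 h3 : ℝ) : ln h1 h2 h3 (X 2) = Polynomial.X * Polynomial.C h2 := by simp [ln, line, vec, im3]
theorem ln_X3 (h1 h2 h3 : ℝ) : ln h1 h2 h3 (X 3) = Polynomial.X * Polynomial.C h3 := by simp [ln, line, vec, im3]
theorem ln_C (h1 h2 h3 c : ℝ) : ln h1 h2 h3 (C c) = Polynomial.C c := by
  rw [← MvPolynomial.algebraMap_eq, AlgHom.commutes]; rfl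
theorem ln_I (h1 h2 h3 : ℝ) (d : ℕ) {F : Po} (hF : F ∈ I0 ^ d) : Polynomial.X ^ d ∣ ln h1 h2 h3 F := by
  have h1' : I0.map (ln h1 h2 h3 : Po →+* Polynomial ℝ) ≤ Ideal.span {Polynomial.X} := by
    rw [I0, Ideal.map_span, Ideal.span_le]
    rintro _ ⟨y, hy, rfl⟩
    simp only [SetLike.mem_coe, Ideal.mem_span_singleton]
    rcases hy with rfl | rfl | rfl
    · exact ⟨_, ln_X1 h1 h2 h3⟩
    · exact ⟨_, ln_X2 h1 h2 h3⟩
    · exact ⟨_, ln_X3 h1 h2 h3⟩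
  have h2' : (ln h1 h2 h3 : Po →+* Polynomial ℝ) F ∈ (Ideal.span {Polynomial.X} : Ideal (Polynomial ℝ)) ^ d := by
    refine Ideal.pow_right_mono h1' d ?_
    rw [← Ideal.map_pow]
    exact Ideal.mem_map_of_mem _ hF
  rwa [Ideal.span_singleton_pow, Ideal.mem_span_singleton] at h2'
theorem ln_N (h1 h2 h3 : ℝ) : ln h1 h2 h3 NP = Polynomial.X ^ 2 * Polynomial.C (N h1 h2 h3) := by
  have := N_map (ln h1 h2 h3 : Po →+* Polynomial ℝ) (X 1) (X 2) (X 3)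
  have h2 := N_map (Polynomial.C : ℝ →+* Polynomial ℝ) h1 h2 h3
  simp only [RingHom.coe_coe, ln_X1, ln_X2, ln_X3] at this
  rw [NP, this, h2]
  simp only [N]; ring
theorem ln_K (h1 h2 h3 : ℝ) : ln h1 h2 h3 KP = Polynomial.X ^ 6 * Polynomial.C (K gr h1 h2 h3) := by
  have := K_map (ln h1 h2 h3 : Po →+* Polynomial ℝ) (C gr) (X 1) (X 2) (X 3)
  have h2 := K_map (Polynomial.C : ℝ →+* Polynomial ℝ) gr h1 h2 h3
  simp only [RingHom.coe_coe, ln_X1, ln_X2, ln_X3, ln_C] at this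
  rw [KP, this, h2]
  simp only [K]; ring
theorem ln_M (h1 h2 h3 : ℝ) : ln h1 h2 h3 MP = Polynomial.X ^ 10 * Polynomial.C (M gr h1 h2 h3) := by
  have := M_map (ln h1 h2 h3 : Po →+* Polynomial ℝ) (C gr) (X 1) (X 2) (X 3)
  have h2 := M_map (Polynomial.C : ℝ →+* Polynomial ℝ) gr h1 h2 h3
  simp only [RingHom.coe_coe, ln_X1, ln_X2, ln_X3, ln_C] at this
  rw [MP, this, h2]
  simp only [M]; ring
theorem ln_mk (h1 h2 h3 : ℝ) {F G : Po} (h : mkq F = mkq G) :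
    ∃ r, ln h1 h2 h3 F = ln h1 h2 h3 G + Polynomial.X ^ 12 * r := by
  have := (Ideal.Quotient.eq (I := I0 ^ 12)).1 h
  obtain ⟨r, hr⟩ := ln_I h1 h2 h3 12 this
  refine ⟨r, ?_⟩
  rw [← hr, map_sub]; ring
theorem low_a (h1 h2 h3 : ℝ) : ∃ r, ln h1 h2 h3 aP = Polynomial.X ^ 2 *
    (Polynomial.C (N h1 h2 h3) + Polynomial.X * r) := by
  have h : mkq (aP) = mkq ((1) * X 0 ^ 10 * NP ^ 1 + (-3) * X 0 ^ 8 * NP ^ 2 + (7) * X 0 ^ 6 * NP ^ 3 + (33) * X 0 ^ 6 * KP ^ 1 + (-3) * X 0 ^ 4 * NP ^ 4 + (-33) * X 0 ^ 4 * NP ^ 1 * KP ^ 1 + (1) * X 0 ^ 2 * NP ^ 5 + (11) * X 0 ^ 2 * NP ^ 2 * KP ^ 1 + (-11) * X 0 ^ 2 * MP ^ 1) := by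
    simp only [map_add, map_mul, map_pow, map_neg, map_ofNat, map_one]
    exact exp_a
  obtain ⟨r, hr⟩ := ln_mk h1 h2 h3 h
  refine ⟨(-3) * Polynomial.X ^ 1 * Polynomial.C (N h1 h2 h3) ^ 2 + (7) * Polynomial.X ^ 3 * Polynomial.C (N h1 h2 h3) ^ 3 + (33) * Polynomial.X ^ 3 * Polynomial.C (K gr h1 h2 h3) ^ 1 + (-3) * Polynomial.X ^ 5 * Polynomial.C (N h1 h2 h3) ^ 4 + (-33) * Polynomial.X ^ 5 * Polynomial.C (N h1 h2 h3) ^ 1 * Polynomial.C (K gr h1 h2 h3) ^ 1 + (1) * Polynomial.X ^ 7 * Polynomial.C (N h1 h2 h3) ^ 5 + (-11) * Polynomial.X ^ 7 * Polynomial.C (M gr h1 h2 h3) ^ 1 + (11) * Polynomial.X ^ 7 * Polynomial.C (N h1 h2 h3) ^ 2 * Polynomial.C (K gr h1 h2 h3) ^ 1 + Polynomial.X ^ 9 * r, ?_⟩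
  simp only [map_add, map_mul, map_pow, map_neg, map_ofNat, map_one, ln_X0, ln_N, ln_K, ln_M] at hr ⊢
  rw [hr]
  ring
theorem low_f (h1 h2 h3 : ℝ) : ∃ r, ln h1 h2 h3 fP = Polynomial.X ^ 6 *
    (Polynomial.C (3 * N h1 h2 h3 ^ 3 + 15 * K gr h1 h2 h3) + Polynomial.X * r) := by
  have h : mkq (fP) = mkq ((3) * X 0 ^ 18 * NP ^ 3 + (15) * X 0 ^ 18 * KP ^ 1 + (-21) * X 0 ^ 16 * NP ^ 4 + (-105) * X 0 ^ 16 * NP ^ 1 * KP ^ 1 + (54) * X 0 ^ 14 * NP ^ 5 + (252) * X 0 ^ 14 * NP ^ 2 * KP ^ 1 + (90) * X 0 ^ 14 * MP ^ 1) := by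
    simp only [map_add, map_mul, map_pow, map_neg, map_ofNat, map_one]
    exact exp_f
  obtain ⟨r, hr⟩ := ln_mk h1 h2 h3 h
  refine ⟨(-21) * Polynomial.X ^ 1 * Polynomial.C (N h1 h2 h3) ^ 4 + (-105) * Polynomial.X ^ 1 * Polynomial.C (N h1 h2 h3) ^ 1 * Polynomial.C (K gr h1 h2 h3) ^ 1 + (54) * Polynomial.X ^ 3 * Polynomial.C (N h1 h2 h3) ^ 5 + (90) * Polynomial.X ^ 3 * Polynomial.C (M gr h1 h2 h3) ^ 1 + (252) * Polynomial.X ^ 3 * Polynomial.C (N h1 h2 h3) ^ 2 * Polynomial.C (K gr h1 h2 h3) ^ 1 + Polynomial.X ^ 5 * r, ?_⟩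
  simp only [map_add, map_mul, map_pow, map_neg, map_ofNat, map_one, ln_X0, ln_N, ln_K, ln_M] at hr ⊢
  rw [hr]
  ring
theorem low_e (h1 h2 h3 : ℝ) : ∃ r, 10 * ln h1 h2 h3 eP = Polynomial.X ^ 10 *
    (Polynomial.C (27 * N h1 h2 h3 ^ 5 + 675 * M gr h1 h2 h3) + Polynomial.X * r) := by
  have h : mkq (10 * eP) = mkq ((27) * X 0 ^ 26 * NP ^ 5 + (675) * X 0 ^ 26 * MP ^ 1) := by
    simp only [map_add, map_mul, map_pow, map_neg, map_ofNat, map_one]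
    exact exp_e
  obtain ⟨r, hr⟩ := ln_mk h1 h2 h3 h
  refine ⟨0 + Polynomial.X ^ 1 * r, ?_⟩
  simp only [map_add, map_mul, map_pow, map_neg, map_ofNat, map_one, ln_X0, ln_N, ln_K, ln_M] at hr ⊢
  rw [hr]
  ring
theorem eP_mem : eP ∈ I0 ^ 10 := by
  have h : mkq (10 * eP) = mkq ((27) * X 0 ^ 26 * NP ^ 5 + (675) * X 0 ^ 26 * MP ^ 1) := by
    simp only [map_add, map_mul, map_pow, map_neg, map_ofNat, map_one]
    exact exp_e
  have h1 := Ideal.pow_le_pow_right (I := I0) (show 10 ≤ 12 by norm_num) ((Ideal.Quotient.eq (I := I0 ^ 12)).1 h)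
  have h2 : ((27) * X 0 ^ 26 * NP ^ 5 + (675) * X 0 ^ 26 * MP ^ 1 : Po) ∈ I0 ^ 10 := by
    apply add_mem
    · refine Ideal.mul_mem_left _ _ ?_
      have := Ideal.pow_mem_pow NP_mem 5
      rwa [← pow_mul] at this
    · rw [pow_one]
      exact Ideal.mul_mem_left _ _ MP_mem
  have h3 := add_mem h1 h2
  rw [sub_add_cancel] at h3
  have h4 : eP = C (1/10) * (10 * eP) := by
    have : (C (1/10) : Po) * C 10 = 1 := by rw [← C_mul]; norm_num
    have h10 : (C 10 : Po) = 10 := map_ofNat C 10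
    rw [h10] at this
    rw [← mul_assoc, this, one_mul]
  rw [h4]
  exact Ideal.mul_mem_left _ _ h3
end H4

namespace H4
open Quaternion

/-- lowest coefficient of a sum -/
theorem low_sum {ι : Type*} (S : Finset ι) (e : ι → ℕ) (g : ι → Polynomial ℝ) (m : ℕ)
    (hm : ∀ s ∈ S, m ≤ e s) (h : (∑ s ∈ S, Polynomial.X ^ e s * g s).coeff m = 0) :
    ∑ s ∈ S with e s = m, (g s).coeff 0 = 0 := by
  rw [Polynomial.finsetSum_coeff] at h
  rw [← h, Finset.sum_filter]
  refine Finset.sum_congr rfl fun s hs => ?_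
  rw [Polynomial.coeff_X_pow_mul']
  have := hm s hs
  by_cases h1 : e s = m
  · simp [h1]
  · have : ¬ e s ≤ m := by omega
    simp [h1, this]

theorem poly_zero_of_ge (p : Polynomial ℝ) (c : ℝ) (h : ∀ x, c ≤ x → p.eval x = 0) : p = 0 :=
  Polynomial.eq_zero_of_infinite_isRoot p ((Set.Ici_infinite c).mono fun x hx => h x hx)

section
variable {B : Type*} [CommRing B]
def KX (p x y z : B) : B := 4 * (x * y * z)
  - p * (x ^ 2 * y + y ^ 2 * z + z ^ 2 * x)
  + (p - 1) * (x ^ 2 * z + y ^ 2 * x + z ^ 2 * y)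
def MX (p x y z : B) : B := (1 - p) * (x ^ 4 * y + y ^ 4 * z + z ^ 4 * x)
  + p * (x ^ 4 * z + y ^ 4 * x + z ^ 4 * y)
  + (2 * p - 2) * (x ^ 3 * y ^ 2 + y ^ 3 * z ^ 2 + z ^ 3 * x ^ 2)
  - 2 * p * (x ^ 3 * z ^ 2 + y ^ 3 * x ^ 2 + z ^ 3 * y ^ 2)
  - 12 * (x ^ 3 * y * z + y ^ 3 * z * x + z ^ 3 * x * y)
  + 20 * (x ^ 2 * y ^ 2 * z + y ^ 2 * z ^ 2 * x + z ^ 2 * x ^ 2 * y)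
theorem K_KX (p x y z : B) : K p x y z = KX p (x ^ 2) (y ^ 2) (z ^ 2) := by
  simp only [K, KX]; ring
theorem M_MX (p x y z : B) : M p x y z = MX p (x ^ 2) (y ^ 2) (z ^ 2) := by
  simp only [M, MX]; ring
theorem KX_map {B' : Type*} [CommRing B'] (φ : B →+* B') (p x y z : B) :
    φ (KX p x y z) = KX (φ p) (φ x) (φ y) (φ z) := by
  simp only [KX, map_add, map_sub, map_mul, map_pow, map_ofNat, map_one]
theorem MX_map {B' : Type*} [CommRing B'] (φ : B →+* B') (p x y z : B) :
    φ (MX p x y z) = MX (φ p) (φ x) (φ y) (φ z) := by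
  simp only [MX, map_add, map_sub, map_mul, map_pow, map_ofNat, map_one]
theorem KX_curve {p : B} (hp : p * p = p + 1) (t : B) :
    KX p (0 - (1 + p ^ 2 + t)) 1 (p ^ 2 + t) =
      t * (16 * p + (12 * p - 4) * t + (2 * p - 1) * t ^ 2) := by
  have h2 : p ^ 2 = p + 1 := by rw [sq, hp]
  have h3 : p ^ 3 = 2 * p + 1 := by linear_combination (p + 1) * hp
  have h4 : p ^ 4 = 3 * p + 2 := by linear_combination (p ^ 2 + p + 2) * hp
  have h5 : p ^ 5 = 5 * p + 3 := by linear_combination (p ^ 3 + p ^ 2 + 2 * p + 3) * hp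
  have h6 : p ^ 6 = 8 * p + 5 := by linear_combination (p ^ 4 + p ^ 3 + 2 * p ^ 2 + 3 * p + 5) * hp
  rw [h2]; simp only [KX]
  linear_combination (-1 + 15 * t + 6 * t ^ 2) * h2 + (8 + 6 * t) * h3 + 2 * h4
theorem MX_curve {p : B} (hp : p * p = p + 1) (t : B) :
    MX p (0 - (1 + p ^ 2 + t)) 1 (p ^ 2 + t) =
      (1792 + 2816 * p) + t * ((2560 + 3840 * p) + (1472 + 2016 * p) * t +
        (432 + 496 * p) * t ^ 2 + (55 + 60 * p) * t ^ 3 + (6 * p - 3) * t ^ 4) := by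
  have h2 : p ^ 2 = p + 1 := by rw [sq, hp]
  have h3 : p ^ 3 = 2 * p + 1 := by linear_combination (p + 1) * hp
  have h4 : p ^ 4 = 3 * p + 2 := by linear_combination (p ^ 2 + p + 2) * hp
  have h5 : p ^ 5 = 5 * p + 3 := by linear_combination (p ^ 3 + p ^ 2 + 2 * p + 3) * hp
  have h6 : p ^ 6 = 8 * p + 5 := by linear_combination (p ^ 4 + p ^ 3 + 2 * p ^ 2 + 3 * p + 5) * hp
  rw [h2]; simp only [MX]
  linear_combination (665 + 990 * t + 528 * t ^ 2 + 150 * t ^ 3 + 30 * t ^ 4) * h2 +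
    (384 + 478 * t + 240 * t ^ 2 + 60 * t ^ 3) * h3 + (151 + 165 * t + 60 * t ^ 2) * h4 +
    (42 + 30 * t) * h5 + 6 * h6
end

/-- the leading forms are algebraically independent (weighted homogeneous version) -/
theorem indep (S : Finset (Fin 3 →₀ ℕ)) (q : (Fin 3 →₀ ℕ) → ℝ) (w : ℕ)
    (hw : ∀ s ∈ S, s 0 + 3 * s 1 + 5 * s 2 = w) (hq : ∀ s ∈ S, q s ≠ 0)
    (H : ∀ h1 h2 h3 : ℝ, ∑ s ∈ S, q s * N h1 h2 h3 ^ s 0 *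
      (3 * N h1 h2 h3 ^ 3 + 15 * K gr h1 h2 h3) ^ s 1 *
      (27 * N h1 h2 h3 ^ 5 + 675 * M gr h1 h2 h3) ^ s 2 = 0) : S = ∅ := by
  by_contra hS
  have hne : S.Nonempty := Finset.nonempty_iff_ne_empty.2 hS
  obtain ⟨s0, hs0, hmin0⟩ := Finset.exists_min_image S (fun s => s 0) hne
  set S1 := S.filter (fun s => s 0 = s0 0) with hS1
  have hne1 : S1.Nonempty := ⟨s0, by simp [hS1, hs0]⟩
  obtain ⟨s1, hs1, hmin1⟩ := Finset.exists_min_image S1 (fun s => s 1) hne1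
  have hg2 := gr_sq
  have hgp := gr_pos
  have step1 : ∀ t : ℝ, 0 ≤ t → ∑ s ∈ S1, q s *
      (15 * (t * (16 * gr + (12 * gr - 4) * t + (2 * gr - 1) * t ^ 2))) ^ s 1 *
      (675 * ((1792 + 2816 * gr) + t * ((2560 + 3840 * gr) + (1472 + 2016 * gr) * t +
        (432 + 496 * gr) * t ^ 2 + (55 + 60 * gr) * t ^ 3 + (6 * gr - 3) * t ^ 4))) ^ s 2 = 0 := by
    intro t ht
    set x0 := 1 + gr ^ 2 + t with hx0
    set FF : Polynomial ℝ := 3 * Polynomial.X ^ 3 + 15 * KX (Polynomial.C gr)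
      (Polynomial.X - Polynomial.C x0) (Polynomial.C 1) (Polynomial.C (gr ^ 2 + t)) with hFF
    set EE : Polynomial ℝ := 27 * Polynomial.X ^ 5 + 675 * MX (Polynomial.C gr)
      (Polynomial.X - Polynomial.C x0) (Polynomial.C 1) (Polynomial.C (gr ^ 2 + t)) with hEE
    have eF : ∀ y, FF.eval y = 3 * y ^ 3 + 15 * KX gr (y - x0) 1 (gr ^ 2 + t) := by
      intro y
      have := KX_map (Polynomial.evalRingHom y) (Polynomial.C gr)
        (Polynomial.X - Polynomial.C x0) (Polynomial.C 1) (Polynomial.C (gr ^ 2 + t))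
      simp only [Polynomial.coe_evalRingHom, Polynomial.eval_C, Polynomial.eval_sub, Polynomial.eval_X] at this
      simp only [hFF, Polynomial.eval_add, Polynomial.eval_mul, Polynomial.eval_pow, Polynomial.eval_X, this,
        Polynomial.eval_ofNat]
    have eE : ∀ y, EE.eval y = 27 * y ^ 5 + 675 * MX gr (y - x0) 1 (gr ^ 2 + t) := by
      intro y
      have := MX_map (Polynomial.evalRingHom y) (Polynomial.C gr)
        (Polynomial.X - Polynomial.C x0) (Polynomial.C 1) (Polynomial.C (gr ^ 2 + t))
      simp only [Polynomial.coe_evalRingHom, Polynomial.eval_C, Polynomial.eval_sub, Polynomial.eval_X] at this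
      simp only [hEE, Polynomial.eval_add, Polynomial.eval_mul, Polynomial.eval_pow, Polynomial.eval_X, this,
        Polynomial.eval_ofNat]
    have hz : ∑ s ∈ S, Polynomial.X ^ s 0 * (Polynomial.C (q s) * FF ^ s 1 * EE ^ s 2) = 0 := by
      apply poly_zero_of_ge _ x0
      intro y hy
      have h := H (Real.sqrt (y - x0)) 1 (Real.sqrt (gr ^ 2 + t))
      have e1 : Real.sqrt (y - x0) ^ 2 = y - x0 := Real.sq_sqrt (by linarith)
      have e2 : Real.sqrt (gr ^ 2 + t) ^ 2 = gr ^ 2 + t := Real.sq_sqrt (by positivity)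
      have e3 : N (Real.sqrt (y - x0)) 1 (Real.sqrt (gr ^ 2 + t)) = y := by
        simp only [N, e1, e2]; rw [hx0]; ring
      rw [K_KX, M_MX, e1, e2, e3, one_pow] at h
      rw [← h, Polynomial.eval_finsetSum]
      refine Finset.sum_congr rfl fun s _ => ?_
      simp only [Polynomial.eval_mul, Polynomial.eval_pow, Polynomial.eval_X, Polynomial.eval_C, eF, eE]
      ring
    have := low_sum S (fun s => s 0) _ (s0 0) hmin0 (by rw [hz]; simp)
    rw [← this]
    refine Finset.sum_congr rfl fun s _ => ?_
    rw [Polynomial.coeff_zero_eq_eval_zero]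
    simp only [Polynomial.eval_mul, Polynomial.eval_pow, Polynomial.eval_C, eF, eE]
    rw [hx0, KX_curve hg2, MX_curve hg2]
    simp
  set UU : Polynomial ℝ := 15 * (Polynomial.C (16 * gr) + Polynomial.C (12 * gr - 4) * Polynomial.X +
    Polynomial.C (2 * gr - 1) * Polynomial.X ^ 2) with hUU
  set WW : Polynomial ℝ := 675 * (Polynomial.C (1792 + 2816 * gr) + Polynomial.X *
    (Polynomial.C (2560 + 3840 * gr) + Polynomial.C (1472 + 2016 * gr) * Polynomial.X +
        Polynomial.C (432 + 496 * gr) * Polynomial.X ^ 2 + Polynomial.C (55 + 60 * gr) * Polynomial.X ^ 3 +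
        Polynomial.C (6 * gr - 3) * Polynomial.X ^ 4)) with hWW
  have hz : ∑ s ∈ S1, Polynomial.X ^ s 1 * (Polynomial.C (q s) * UU ^ s 1 * WW ^ s 2) = 0 := by
    apply poly_zero_of_ge _ 0
    intro y hy
    rw [← step1 y hy, Polynomial.eval_finsetSum]
    refine Finset.sum_congr rfl fun s _ => ?_
    simp only [hUU, hWW, Polynomial.eval_mul, Polynomial.eval_pow, Polynomial.eval_X, Polynomial.eval_C,
      Polynomial.eval_add, Polynomial.eval_ofNat, mul_pow]
    ring
  have h2 := low_sum S1 (fun s => s 1) _ (s1 1) hmin1 (by rw [hz]; simp)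
  have hfil : S1.filter (fun s => s 1 = s1 1) = {s1} := by
    ext s
    simp only [Finset.mem_filter, Finset.mem_singleton]
    constructor
    · rintro ⟨ha, hb⟩
      have a1 := (Finset.mem_filter.1 (hS1 ▸ ha))
      have a2 := (Finset.mem_filter.1 (hS1 ▸ hs1))
      have b1 := hw s a1.1
      have b2 := hw s1 a2.1
      have a3 := a1.2
      have a4 := a2.2
      ext i
      fin_cases i
      · simp; omega
      · simp; omega
      · simp; omega
    · rintro rfl; exact ⟨hs1, rfl⟩
  rw [hfil, Finset.sum_singleton, Polynomial.coeff_zero_eq_eval_zero] at h2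
  simp only [hUU, hWW, Polynomial.eval_mul, Polynomial.eval_pow, Polynomial.eval_X, Polynomial.eval_C,
      Polynomial.eval_add, Polynomial.eval_ofNat] at h2
  have hq1 := hq s1 (Finset.mem_filter.1 (hS1 ▸ hs1)).1
  have n1 : (15 * (16 * gr + (12 * gr - 4) * 0 + (2 * gr - 1) * 0 ^ 2)) ≠ 0 := by
    have : (15 * (16 * gr + (12 * gr - 4) * 0 + (2 * gr - 1) * 0 ^ 2)) = 240 * gr := by ring
    rw [this]; positivity
  have n2 : 0 < 675 * (1792 + 2816 * gr) := by positivity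
  simp only [zero_mul, add_zero] at h2
  exact mul_ne_zero (mul_ne_zero hq1 (pow_ne_zero _ n1)) (pow_ne_zero _ n2.ne') h2
end H4

namespace H4
open Quaternion

abbrev P3 := MvPolynomial (Fin 3) ℝ

/-- change of coordinates `(a,b,c) → (a,f,10 e)` at `n = 1` -/
noncomputable def Qof (R : P3) : P3 :=
  aeval ![X 0, X 1 + X 0 ^ 2, C (1/10) * X 2 + C (3/2) * X 0 * X 1 + X 0 ^ 3] R

theorem aeval_Qof {A : Type*} [CommRing A] [Algebra ℝ A] (R : P3) (a f e : A) :
    aeval ![a, f, e] (Qof R) = aeval ![a, f + a ^ 2, algebraMap ℝ A (1/10) * e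
      + algebraMap ℝ A (3/2) * a * f + a ^ 3] R := by
  have : ((aeval ![a, f, e] : P3 →ₐ[ℝ] A).comp
      (aeval ![X 0, X 1 + X 0 ^ 2, C (1/10) * X 2 + C (3/2) * X 0 * X 1 + X 0 ^ 3])) =
      aeval ![a, f + a ^ 2, algebraMap ℝ A (1/10) * e + algebraMap ℝ A (3/2) * a * f + a ^ 3] := by
    apply MvPolynomial.algHom_ext
    intro i
    fin_cases i
    · simp
    · simp
    · simp [-one_div, MvPolynomial.algHom_C]
  rw [← this]; rfl

theorem R_zero {R : P3} (h : Qof R = 0) : R = 0 := by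
  apply MvPolynomial.funext
  intro v
  have h1 := aeval_Qof R (v 0) (v 1 - v 0 ^ 2) (10 * (v 2 - 3/2 * v 0 * (v 1 - v 0 ^ 2) - v 0 ^ 3))
  rw [h, map_zero] at h1
  have h2 : ![v 0, v 1 - v 0 ^ 2 + v 0 ^ 2, algebraMap ℝ ℝ (1/10) *
      (10 * (v 2 - 3/2 * v 0 * (v 1 - v 0 ^ 2) - v 0 ^ 3)) + algebraMap ℝ ℝ (3/2) * v 0 * (v 1 - v 0 ^ 2)
      + v 0 ^ 3] = v := by
    ext i; fin_cases i
    · simp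
    · simp
    · simp only [Algebra.algebraMap_self, RingHom.id_apply]
      simp; ring
  rw [h2] at h1
  rw [map_zero, ← MvPolynomial.coe_aeval_eq_eval]; exact h1.symm

theorem aeval_sum3 {A : Type*} [CommRing A] [Algebra ℝ A] (R : P3) (a b c : A) :
    aeval ![a, b, c] R = ∑ d ∈ R.support, algebraMap ℝ A (R.coeff d) * (a ^ d 0 * b ^ d 1 * c ^ d 2) := by
  rw [MvPolynomial.aeval_def, MvPolynomial.eval₂_eq']
  simp [Fin.prod_univ_three]

/-- curve argument -/
theorem curve (R : P3) (ν m : ℕ) (hR : ∀ d ∈ R.support, 6 * d 0 + 10 * d 1 + 15 * d 2 ≤ ν)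
    (hQ : ∀ d ∈ (Qof R).support, m ≤ 2 * (d 0 + 3 * d 1 + 5 * d 2)) (hlt : 5 * ν < 9 * m) : R = 0 := by
  apply R_zero
  have key : ∀ (κ t n : ℝ), aeval ![κ * (t ^ 2 - n / 2), - κ ^ 3 * t, 5 * κ ^ 5] (Qof R) = 0 := by
    intro κ t n
    set z := κ - t ^ 3 + 3 / 2 * n * t with hz
    set q : Polynomial ℝ := Polynomial.X ^ 3 + (Polynomial.C (- (3/2) * n) * Polynomial.X + Polynomial.C z) with hq
    have hdeg : q.natDegree = 3 := by
      rw [hq]; compute_degree!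
    set a : Polynomial ℝ := q * (Polynomial.X ^ 2 - Polynomial.C (n / 2)) with ha
    set f : Polynomial ℝ := - q ^ 3 * Polynomial.X with hf
    set e : Polynomial ℝ := 5 * q ^ 5 with he
    set P := aeval ![a, f, e] (Qof R) with hP
    have hd1 : q ^ ((m + 1) / 2) ∣ P := by
      rw [hP, aeval_sum3]
      refine Finset.dvd_sum fun d hd => ?_
      have := hQ d hd
      have h1 : q ^ ((m + 1) / 2) ∣ q ^ (d 0 + 3 * d 1 + 5 * d 2) := pow_dvd_pow _ (by omega)
      refine h1.trans ⟨algebraMap ℝ _ ((Qof R).coeff d) * ((Polynomial.X ^ 2 - Polynomial.C (n / 2)) ^ d 0 *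
        (- Polynomial.X) ^ d 1 * 5 ^ d 2), ?_⟩
      rw [ha, hf, he, mul_pow, neg_mul_comm, mul_pow, mul_pow]
      ring
    have hb : f + a ^ 2 = q ^ 2 * (Polynomial.C (n / 2) * Polynomial.X ^ 2 - Polynomial.C z * Polynomial.X + Polynomial.C (n ^ 2 / 4)) := by
      have e1 : Polynomial.C (n / 2) ^ 2 = Polynomial.C (n ^ 2 / 4) := by
        rw [← Polynomial.C_pow]; congr 1; ring
      have e2 : Polynomial.C (- (3/2) * n) = -3 * Polynomial.C (n / 2) := by
        have : (-3 : Polynomial ℝ) = Polynomial.C (-3) := by rw [Polynomial.C_neg, map_ofNat]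
        rw [this, ← Polynomial.C_mul]; congr 1; ring
      rw [← e1, hf, ha, hq, e2]; ring
    have hc : ∃ g : Polynomial ℝ, g.natDegree ≤ 3 ∧ algebraMap ℝ (Polynomial ℝ) (1/10) * e
      + algebraMap ℝ (Polynomial ℝ) (3/2) * a * f + a ^ 3 = q ^ 3 * g := by
      refine ⟨Polynomial.C (z ^ 2 / 2 - n ^ 3 / 8) + Polynomial.C (- 3 * n * z / 4) * Polynomial.X
          + Polynomial.C (3 * n ^ 2 / 4) * Polynomial.X ^ 2 + Polynomial.C (- z / 2) * Polynomial.X ^ 3, by compute_degree, ?_⟩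
      simp only [Polynomial.algebraMap_eq]
      apply Polynomial.funext
      intro x
      simp only [he, hf, ha, hq, Polynomial.eval_mul, Polynomial.eval_pow, Polynomial.eval_X, Polynomial.eval_C,
        Polynomial.eval_add, Polynomial.eval_sub, Polynomial.eval_neg, Polynomial.eval_ofNat]
      ring
    obtain ⟨g, hg, hc⟩ := hc
    have hda : a.natDegree ≤ 5 := by
      rw [ha]; refine (Polynomial.natDegree_mul_le).trans ?_
      have : (Polynomial.X ^ 2 - Polynomial.C (n / 2)).natDegree ≤ 2 := by compute_degree
      omega
    have hdb : (f + a ^ 2).natDegree ≤ 8 := by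
      rw [hb]; refine (Polynomial.natDegree_mul_le).trans ?_
      have : (Polynomial.C (n / 2) * Polynomial.X ^ 2 - Polynomial.C z * Polynomial.X + Polynomial.C (n ^ 2 / 4)).natDegree ≤ 2 := by
        compute_degree
      have := Polynomial.natDegree_pow_le (p := q) (n := 2)
      omega
    have hdc : (q ^ 3 * g).natDegree ≤ 12 := by
      refine (Polynomial.natDegree_mul_le).trans ?_
      have := Polynomial.natDegree_pow_le (p := q) (n := 3)
      omega
    have hd2 : P.natDegree ≤ 5 * ν / 6 := by
      rw [hP, aeval_Qof, hc, aeval_sum3]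
      refine Polynomial.natDegree_sum_le_of_forall_le _ _ fun d hd => ?_
      have := hR d hd
      refine (Polynomial.natDegree_C_mul_le _ _).trans ?_
      refine (Polynomial.natDegree_mul_le).trans ?_
      have h1 := (Polynomial.natDegree_mul_le (p := a ^ d 0) (q := (f + a ^ 2) ^ d 1))
      have h2 := Polynomial.natDegree_pow_le_of_le (d 0) hda
      have h3 := Polynomial.natDegree_pow_le_of_le (d 1) hdb
      have h4 := Polynomial.natDegree_pow_le_of_le (d 2) hdc
      omega
    have hP0 : P = 0 := by
      by_contra hne
      have h1 := Polynomial.natDegree_le_of_dvd hd1 hne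
      rw [Polynomial.natDegree_pow, hdeg] at h1
      omega
    have h5 : (Polynomial.aeval t : Polynomial ℝ →ₐ[ℝ] ℝ) P = 0 := by rw [hP0, map_zero]
    rw [hP, ← AlgHom.comp_apply, MvPolynomial.comp_aeval] at h5
    have h6 : (fun i => (Polynomial.aeval t : Polynomial ℝ →ₐ[ℝ] ℝ) (![a, f, e] i)) =
        ![κ * (t ^ 2 - n / 2), - κ ^ 3 * t, 5 * κ ^ 5] := by
      have hqt : (Polynomial.aeval t : Polynomial ℝ →ₐ[ℝ] ℝ) q = κ := by
        simp only [hq, Polynomial.coe_aeval_eq_eval, Polynomial.eval_mul, Polynomial.eval_pow, Polynomial.eval_X, Polynomial.eval_C,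
        Polynomial.eval_add, hz]
        ring
      have hTt : (Polynomial.aeval t : Polynomial ℝ →ₐ[ℝ] ℝ) Polynomial.X = t := Polynomial.aeval_X t
      ext i; fin_cases i
      · simp only [ha, hqt, hTt, map_mul, map_sub, map_pow, Polynomial.aeval_C, Fin.zero_eta, Matrix.cons_val_zero]; rfl
      · show (Polynomial.aeval t : Polynomial ℝ →ₐ[ℝ] ℝ) f = - κ ^ 3 * t
        rw [hf, map_mul, map_neg, map_pow, hqt, hTt]
      · show (Polynomial.aeval t : Polynomial ℝ →ₐ[ℝ] ℝ) e = 5 * κ ^ 5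
        rw [he, map_mul, map_ofNat, map_pow, hqt]
    rw [h6] at h5
    exact h5
  apply MvPolynomial.funext_set (s := fun _ => Set.Ioi (0:ℝ)) (fun _ => Set.Ioi_infinite 0)
  intro v hv
  rw [map_zero]
  have hv2 : 0 < v 2 := hv 2 trivial
  obtain ⟨κ, hκ, hκ5⟩ : ∃ κ : ℝ, 0 < κ ∧ 5 * κ ^ 5 = v 2 := by
    refine ⟨(v 2 / 5) ^ ((1:ℝ) / 5), by positivity, ?_⟩
    have : ((v 2 / 5) ^ ((1:ℝ) / 5)) ^ (5:ℕ) = v 2 / 5 := by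
      rw [← Real.rpow_natCast, ← Real.rpow_mul (by positivity)]; norm_num
    rw [this]; ring
  have := key κ (- v 1 / κ ^ 3) (2 * ((- v 1 / κ ^ 3) ^ 2 - v 0 / κ))
  have h2 : ![κ * ((- v 1 / κ ^ 3) ^ 2 - (2 * ((- v 1 / κ ^ 3) ^ 2 - v 0 / κ)) / 2),
    - κ ^ 3 * (- v 1 / κ ^ 3), 5 * κ ^ 5] = v := by
    ext i; fin_cases i
    · simp; field_simp

    · simp; field_simp
    · simp [hκ5]
  rw [h2] at this
  rw [← MvPolynomial.coe_aeval_eq_eval]; exact this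
end H4

namespace H4
open Quaternion

theorem ev_low {x : ℍ[ℝ]} (hx : normSq x ≠ 0) (R : P3) :
    aeval ![ev x aP / normSq x ^ 6, ev x bP / normSq x ^ 10, ev x cP / normSq x ^ 15] R =
    aeval ![ev x aP / normSq x ^ 6, ev x fP / normSq x ^ 12, 10 * ev x eP / normSq x ^ 18] (Qof R) := by
  rw [aeval_Qof]
  congr 2
  have hf : ev x fP = normSq x ^ 2 * ev x bP - ev x aP ^ 2 := by
    simp [fP, ev_nP]
  have he : ev x eP = normSq x ^ 2 * (normSq x * ev x cP - ev x aP * ev x bP) - 1 / 2 * (ev x aP * ev x fP) := by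
    simp only [eP, map_sub, map_mul, map_pow, ev_nP, ev_C]
  ext i; fin_cases i
  · simp
  · simp [hf]; field_simp; ring
  · simp only [Algebra.algebraMap_self, RingHom.id_apply]
    simp [he, hf]; field_simp; ring

theorem lemmaS (G : Po) (R : P3) (ν m : ℕ) (hR0 : R ≠ 0)
    (hR : ∀ d ∈ R.support, 6 * d 0 + 10 * d 1 + 15 * d 2 ≤ ν)
    (hG : ∀ x : ℍ[ℝ], normSq x ≠ 0 → ev x G = normSq x ^ ν *
      aeval ![ev x aP / normSq x ^ 6, ev x bP / normSq x ^ 10, ev x cP / normSq x ^ 15] R)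
    (hdiv : ∀ h1 h2 h3, Polynomial.X ^ m ∣ ln h1 h2 h3 G) : 9 * m ≤ 5 * ν := by
  by_contra hlt
  push Not at hlt
  refine hR0 (curve R ν m hR ?_ hlt)
  by_contra hcon
  push Not at hcon
  obtain ⟨d1, hd1, hd1m⟩ := hcon
  set S := (Qof R).support with hS
  set wt : (Fin 3 →₀ ℕ) → ℕ := fun d => d 0 + 3 * d 1 + 5 * d 2 with hwt
  obtain ⟨d0, hd0, hmin⟩ := Finset.exists_min_image S wt ⟨d1, hd1⟩
  have hd0m : 2 * wt d0 < m := lt_of_le_of_lt (Nat.mul_le_mul_left 2 (hmin d1 hd1)) hd1m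
  set Lb := S.sup (fun d => 6 * d 0 + 12 * d 1 + 18 * d 2) with hLb
  have hLd : ∀ d ∈ S, 6 * d 0 + 12 * d 1 + 18 * d 2 ≤ Lb := fun d hd =>
    Finset.le_sup (f := fun d : Fin 3 →₀ ℕ => 6 * d 0 + 12 * d 1 + 18 * d 2) hd
  have hind := indep (S.filter (fun d => 2 * wt d = 2 * wt d0)) (fun d => (Qof R).coeff d) (wt d0)
    (by intro s hs; have := (Finset.mem_filter.1 hs).2; simp only [hwt] at this ⊢; omega)
    (by intro s hs; exact MvPolynomial.mem_support_iff.1 (Finset.mem_filter.1 hs).1) ?_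
  · have : d0 ∈ S.filter (fun d => 2 * wt d = 2 * wt d0) := Finset.mem_filter.2 ⟨hd0, rfl⟩
    rw [hind] at this
    simp at this
  intro h1 h2 h3
  obtain ⟨ra, hra⟩ := low_a h1 h2 h3
  obtain ⟨rf, hrf⟩ := low_f h1 h2 h3
  obtain ⟨re, hre⟩ := low_e h1 h2 h3
  set n := ln h1 h2 h3 nP with hn
  have id1 : n ^ Lb * ln h1 h2 h3 G = n ^ ν * ∑ d ∈ S, Polynomial.C ((Qof R).coeff d) *
      n ^ (Lb - (6 * d 0 + 12 * d 1 + 18 * d 2)) * (ln h1 h2 h3 aP) ^ d 0 * (ln h1 h2 h3 fP) ^ d 1 *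
      (10 * ln h1 h2 h3 eP) ^ d 2 := by
    apply Polynomial.funext
    intro s
    set x := (1 : ℍ[ℝ]) + s • im3 h1 h2 h3 with hx
    have hnx : 0 < normSq x := by
      have : normSq x = 1 + s ^ 2 * (h1 ^ 2 + h2 ^ 2 + h3 ^ 2) := by
        rw [Quaternion.normSq_def', hx]
        simp only [Quaternion.re_add, Quaternion.imI_add, Quaternion.imJ_add, Quaternion.imK_add,
          Quaternion.re_smul, Quaternion.imI_smul, Quaternion.imJ_smul, Quaternion.imK_smul]
        simp [im3]; ring
      rw [this]; positivity
    simp only [Polynomial.eval_mul, Polynomial.eval_pow, Polynomial.eval_finsetSum, Polynomial.eval_C,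
      Polynomial.eval_ofNat, ln, hn, eval_line, ← hx]
    rw [hG x hnx.ne', ev_low hnx.ne', aeval_sum3, ev_nP, ← mul_assoc, mul_comm (normSq x ^ Lb), mul_assoc,
      Finset.mul_sum]
    congr 1
    refine Finset.sum_congr rfl fun d hd => ?_
    obtain ⟨l, hl⟩ := Nat.exists_eq_add_of_le (hLd d hd)
    have hl2 : Lb - (6 * d 0 + 12 * d 1 + 18 * d 2) = l := by omega
    rw [hl2, hl]
    simp only [Algebra.algebraMap_self, RingHom.id_apply, div_pow, ← pow_mul, pow_add]
    field_simp
  have id2 : n ^ Lb * ln h1 h2 h3 G = ∑ d ∈ S, Polynomial.X ^ (2 * wt d) * (Polynomial.C ((Qof R).coeff d) *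
      n ^ (ν + (Lb - (6 * d 0 + 12 * d 1 + 18 * d 2))) *
      (Polynomial.C (N h1 h2 h3) + Polynomial.X * ra) ^ d 0 *
      (Polynomial.C (3 * N h1 h2 h3 ^ 3 + 15 * K gr h1 h2 h3) + Polynomial.X * rf) ^ d 1 *
      (Polynomial.C (27 * N h1 h2 h3 ^ 5 + 675 * M gr h1 h2 h3) + Polynomial.X * re) ^ d 2) := by
    rw [id1, Finset.mul_sum]
    refine Finset.sum_congr rfl fun d hd => ?_
    rw [hra, hrf, hre, mul_pow, mul_pow, mul_pow, hwt]
    ring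
  have hco : (n ^ Lb * ln h1 h2 h3 G).coeff (2 * wt d0) = 0 := by
    have := (Polynomial.X_pow_dvd_iff.1 ((hdiv h1 h2 h3).mul_left (n ^ Lb))) (2 * wt d0) hd0m
    exact this
  rw [id2] at hco
  have hfin := low_sum S (fun d => 2 * wt d) _ (2 * wt d0) (fun d hd => Nat.mul_le_mul_left 2 (hmin d hd)) hco
  rw [← hfin]
  refine Finset.sum_congr rfl fun d hd => ?_
  have hn1 : n.eval 0 = 1 := by
    rw [hn, ln, eval_line, ev_nP]; simp
  rw [Polynomial.coeff_zero_eq_eval_zero]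
  simp only [Polynomial.eval_mul, Polynomial.eval_pow, Polynomial.eval_add, Polynomial.eval_C, Polynomial.eval_X,
    hn1, one_pow, zero_mul, add_zero, mul_one]
end H4

namespace H4
open Quaternion

theorem der_line (x h : ℍ[ℝ]) (F : Po) : Polynomial.derivative (line x h F) =
    ∑ i, Polynomial.C (vec h i) * line x h (pderiv i F) := by
  induction F using MvPolynomial.induction_on with
  | C a =>
    have : line x h (C a) = Polynomial.C a := by
      rw [← MvPolynomial.algebraMap_eq, AlgHom.commutes]; rfl
    rw [this]; simp
  | add p q hp hq => simp only [map_add, hp, hq, mul_add, Finset.sum_add_distrib]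
  | mul_X p j hp =>
    have hX : line x h (X j) = Polynomial.C (vec x j) + Polynomial.X * Polynomial.C (vec h j) := by
      simp [line]
    rw [map_mul, Polynomial.derivative_mul, hp]
    have h2 : ∀ i, line x h (pderiv i (p * X j)) = line x h p * (if i = j then 1 else 0) +
        line x h (X j) * line x h (pderiv i p) := by
      intro i
      rw [Derivation.leibniz, pderiv_X]
      simp only [smul_eq_mul, map_add, map_mul, Pi.single_apply]
      by_cases hij : i = j
      · simp [hij]
      · simp [hij, Ne.symm hij]
    simp only [h2, mul_add, Finset.sum_add_distrib]
    have h3 : Polynomial.derivative (line x h (X j)) = Polynomial.C (vec h j) := by rw [hX]; simp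
    rw [h3]
    have h4 : ∑ i, Polynomial.C (vec h i) * (line x h p * (if i = j then 1 else 0)) =
      Polynomial.C (vec h j) * line x h p := by simp
    have h5 : ∑ i, Polynomial.C (vec h i) * (line x h (X j) * line x h (pderiv i p)) =
      (∑ i, Polynomial.C (vec h i) * line x h (pderiv i p)) * line x h (X j) := by
      rw [Finset.sum_mul]
      refine Finset.sum_congr rfl fun i _ => ?_
      rw [mul_comm (line x h (X j)), mul_assoc]
    rw [h4, h5, add_comm, mul_comm (line x h p)]

theorem order_line (m : ℕ) : ∀ (F : Po) (x h : ℍ[ℝ]), vanishesToOrderR F (vec x) m →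
    Polynomial.X ^ m ∣ line x h F := by
  induction m with
  | zero => intro F x h _; simp
  | succ m ih =>
    intro F x h hF
    have h0 : (line x h F).coeff 0 = 0 := by
      rw [Polynomial.coeff_zero_eq_eval_zero, eval_line]
      have := hF [] (by simp)
      simp only [List.foldl_nil] at this
      simp only [zero_smul, add_zero, ev]
      rw [← this, ← MvPolynomial.coe_aeval_eq_eval]; rfl
    have h1 : Polynomial.X ^ m ∣ Polynomial.derivative (line x h F) := by
      rw [der_line]
      refine Finset.dvd_sum fun i _ => Dvd.dvd.mul_left (ih _ x h ?_) _
      intro l hl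
      exact hF (i :: l) (by simpa using hl)
    rw [Polynomial.X_pow_dvd_iff] at h1 ⊢
    intro d hd
    cases d with
    | zero => exact h0
    | succ d =>
      have := h1 d (by omega)
      rw [Polynomial.coeff_derivative] at this
      have h2 : ((d : ℝ) + 1) ≠ 0 := by positivity
      exact (mul_eq_zero.1 this).resolve_right h2

theorem pd_pow (I : Ideal Po) (i : Fin 4) (m : ℕ) : ∀ F ∈ I ^ (m + 1), pderiv i F ∈ I ^ m := by
  induction m with
  | zero => intro F _; simp
  | succ m ih =>
    intro F hF
    rw [pow_succ I (m + 1)] at hF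
    refine Submodule.mul_induction_on hF ?_ ?_
    · intro a ha b hb
      rw [Derivation.leibniz, smul_eq_mul, smul_eq_mul]
      refine add_mem (Ideal.mul_mem_right _ _ ha) ?_
      rw [pow_succ, mul_comm b]
      exact Ideal.mul_mem_mul (ih a ha) hb
    · intro a b ha hb
      rw [map_add]; exact add_mem ha hb

theorem van_of_mem (v : Fin 4 → ℝ) (m : ℕ) : ∀ F ∈ (RingHom.ker (eval v : Po →+* ℝ)) ^ m, vanishesToOrderR F v m := by
  induction m with
  | zero => intro F _ l hl; simp at hl
  | succ m ih =>
    intro F hF l hl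
    cases l with
    | nil =>
      have := Ideal.pow_le_self (Nat.succ_ne_zero m) hF
      exact this
    | cons i l => exact ih _ (pd_pow _ i m F hF) l (by simpa using hl)

theorem eP_van {v : Fin 4 → ℝ} (hv : v ∈ H4Config) (k : ℕ) : vanishesToOrderR (eP ^ k) v (10 * k) := by
  obtain ⟨r, hr, c, hc, rfl⟩ := cfg_to_D hv
  apply van_of_mem
  rw [pow_mul]
  apply Ideal.pow_mem_pow
  set T := act (star r) 1 true with hT
  have h1 : sub T eP = eP := by
    apply po_ext
    intro x
    rw [ev_sub]
    exact eP_inv _ (D_star hr) _ D_one true x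
  have h2 : I0.map (sub T : Po →+* Po) ≤ RingHom.ker (eval (c • vec r) : Po →+* ℝ) := by
    have key : ∀ i : Fin 4, i ≠ 0 → (sub T : Po →+* Po) (X i) ∈ RingHom.ker (eval (c • vec r) : Po →+* ℝ) := by
      intro i hi
      rw [RingHom.mem_ker]
      have : ev (c • r) (sub T (X i)) = 0 := by
        rw [ev_sub, ev_X, hT, act_true, mul_smul_comm, D_star_mul hr, mul_one, vec_smul]
        fin_cases i
        · exact absurd rfl hi
        all_goals simp [vec]
      rw [ev, vec_smul] at this
      rw [← this, ← MvPolynomial.coe_aeval_eq_eval]; rfl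
    rw [I0, Ideal.map_span, Ideal.span_le]
    rintro _ ⟨y, hy, rfl⟩
    rcases hy with rfl | rfl | rfl
    · exact key 1 (by decide)
    · exact key 2 (by decide)
    · exact key 3 (by decide)
  refine Ideal.pow_right_mono h2 10 ?_
  rw [← Ideal.map_pow, ← h1]
  exact Ideal.mem_map_of_mem (sub T : Po →+* Po) eP_mem

theorem eP_ne : eP ≠ 0 := by
  intro h
  obtain ⟨r, hr⟩ := low_e 1 0 0
  rw [h, map_zero, mul_zero] at hr
  have := (mul_eq_zero.1 hr.symm).resolve_left (pow_ne_zero _ Polynomial.X_ne_zero)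
  have := congrArg (Polynomial.eval 0) this
  simp [N, M] at this

theorem alpha_mem (k : ℕ) : ∃ F : Po, F ≠ 0 ∧ F.IsHomogeneous (36 * k) ∧
    ∀ v ∈ H4Config, vanishesToOrderR F v (10 * k) :=
  ⟨eP ^ k, pow_ne_zero _ eP_ne, eP_hom.pow k, fun v hv => eP_van hv k⟩

theorem van_mono {F : Po} {v : Fin 4 → ℝ} {m n : ℕ} (h : vanishesToOrderR F v n) (hmn : m ≤ n) :
    vanishesToOrderR F v m := fun l hl => h l (lt_of_lt_of_le hl hmn)

/-- reduction to the lower bound -/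
theorem reduce (H : ∀ (m d : ℕ) (F : Po), F ≠ 0 → F.IsHomogeneous d →
    (∀ v ∈ H4Config, vanishesToOrderR F v m) → 18 * m ≤ 5 * d) :
    sInf { x : ℝ | ∃ m : ℕ, 1 ≤ m ∧ x = (alphaSymbolicR H4Config m : ℝ) / m } = 18 / 5 := by
  have lb : ∀ m, 18 * m ≤ 5 * alphaSymbolicR H4Config m := by
    intro m
    have hne : { d | ∃ F : MvPolynomial (Fin 4) ℝ, F ≠ 0 ∧ F.IsHomogeneous d ∧
      ∀ v ∈ H4Config, vanishesToOrderR F v m }.Nonempty := by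
      obtain ⟨F, h1, h2, h3⟩ := alpha_mem m
      exact ⟨_, F, h1, h2, fun v hv => van_mono (h3 v hv) (by omega)⟩
    obtain ⟨F, h1, h2, h3⟩ := Nat.sInf_mem hne
    exact H m _ F h1 h2 h3
  have ub : alphaSymbolicR H4Config 10 ≤ 36 := by
    obtain ⟨F, h1, h2, h3⟩ := alpha_mem 1
    exact Nat.sInf_le ⟨F, h1, h2, h3⟩
  have e10 : alphaSymbolicR H4Config 10 = 36 := by
    have := lb 10; omega
  apply IsLeast.csInf_eq
  constructor
  · refine ⟨10, by norm_num, ?_⟩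
    rw [e10]; norm_num
  · rintro x ⟨m, hm, rfl⟩
    have hm' : (0:ℝ) < m := by exact_mod_cast hm
    rw [div_le_div_iff₀ (by norm_num) hm']
    have := lb m
    have h2 : ((18 * m : ℕ) : ℝ) ≤ ((5 * alphaSymbolicR H4Config m : ℕ) : ℝ) := by exact_mod_cast this
    push_cast at h2
    linarith
end H4

namespace H4
open Quaternion

/-! ### Counting -/

/-- exponents of degree `e` -/
noncomputable def TT (e : ℕ) : Finset (Fin 4 →₀ ℕ) := Finset.finsuppAntidiag Finset.univ e
theorem mem_TT {e : ℕ} {d : Fin 4 →₀ ℕ} : d ∈ TT e ↔ d 0 + d 1 + d 2 + d 3 = e := by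
  simp [TT, Finset.mem_finsuppAntidiag, Fin.sum_univ_four]
theorem card_TT (e : ℕ) : 6 * (TT e).card = (e + 1) * (e + 2) * (e + 3) := by
  rw [TT, Finset.card_finsuppAntidiag_nat_eq_choose]
  have h1 : (Finset.univ : Finset (Fin 4)).card + e - 1 = e + 3 := by simp; omega
  rw [h1, Nat.choose_symm_add]
  have h2 := Nat.descFactorial_eq_factorial_mul_choose (e + 3) 3
  have h3 : Nat.factorial 3 = 6 := rfl
  rw [h3] at h2
  rw [← h2]
  simp [Nat.descFactorial_succ]
  ring

noncomputable def rho (d : Fin 4 →₀ ℕ) : Fin 3 →₀ ℕ :=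
  Finsupp.equivFunOnFinite.symm ![d 0 / 6, d 1 / 10, d 2 / 15]
theorem rho0 (d : Fin 4 →₀ ℕ) : rho d 0 = d 0 / 6 := rfl
theorem rho1 (d : Fin 4 →₀ ℕ) : rho d 1 = d 1 / 10 := rfl
theorem rho2 (d : Fin 4 →₀ ℕ) : rho d 2 = d 2 / 15 := rfl
noncomputable def Idx (ν : ℕ) : Finset (Fin 3 →₀ ℕ) := (TT ν).image rho
theorem Idx_wt {ν : ℕ} {s : Fin 3 →₀ ℕ} (hs : s ∈ Idx ν) : 6 * s 0 + 10 * s 1 + 15 * s 2 ≤ ν := by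
  obtain ⟨d, hd, rfl⟩ := Finset.mem_image.1 hs
  have := mem_TT.1 hd
  rw [rho0, rho1, rho2]
  omega
theorem card_Idx (ν : ℕ) : (TT ν).card ≤ 900 * (Idx ν).card := by
  apply Finset.card_le_mul_card_image
  intro a _
  have : 900 = (Finset.range 6 ×ˢ Finset.range 10 ×ˢ Finset.range 15).card := by simp
  rw [this]
  refine Finset.card_le_card_of_injOn (fun d => (d 0 % 6, d 1 % 10, d 2 % 15)) ?_ ?_
  · intro d _
    simp only [Finset.coe_product, Set.mem_prod, Finset.mem_coe, Finset.mem_range]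
    omega
  · intro d hd d' hd' h
    simp only [Finset.coe_filter, Set.mem_setOf_eq] at hd hd'
    have e1 := mem_TT.1 hd.1
    have e2 := mem_TT.1 hd'.1
    have e3 := hd.2.trans hd'.2.symm
    have r0 := DFunLike.congr_fun e3 0
    have r1 := DFunLike.congr_fun e3 1
    have r2 := DFunLike.congr_fun e3 2
    rw [rho0, rho0] at r0
    rw [rho1, rho1] at r1
    rw [rho2, rho2] at r2
    simp only [Prod.mk.injEq] at h
    have f0 : d 0 = d' 0 := by omega
    have f1 : d 1 = d' 1 := by omega
    have f2 : d 2 = d' 2 := by omega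
    have f3 : d 3 = d' 3 := by omega
    ext i; fin_cases i
    · exact f0
    · exact f1
    · exact f2
    · exact f3

/-- linear dependence from dimension count -/
theorem dep {ι : Type*} [Fintype ι] (P : ι → Po) (e : ℕ) (hP : ∀ i, (P i).IsHomogeneous e)
    (hc : (TT e).card < Fintype.card ι) : ∃ c : ι → ℝ, c ≠ 0 ∧ ∑ i, C (c i) * P i = 0 := by
  let Φ : (ι → ℝ) →ₗ[ℝ] (TT e → ℝ) :=
    { toFun := fun c t => ∑ i, c i * (P i).coeff t
      map_add' := by intro x y; ext t; simp [add_mul, Finset.sum_add_distrib]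
      map_smul' := by intro r y; ext t; simp [Finset.mul_sum, mul_assoc] }
  have hk : LinearMap.ker Φ ≠ ⊥ := by
    apply LinearMap.ker_ne_bot_of_finrank_lt
    simpa using hc
  obtain ⟨c, hc1, hc2⟩ := (Submodule.ne_bot_iff _).1 hk
  refine ⟨c, hc2, ?_⟩
  ext t
  by_cases ht : t ∈ TT e
  · have := congrFun (LinearMap.mem_ker.1 hc1) ⟨t, ht⟩
    rw [MvPolynomial.coeff_sum]
    simp only [MvPolynomial.coeff_C_mul, MvPolynomial.coeff_zero]
    exact this
  · rw [MvPolynomial.coeff_sum]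
    simp only [MvPolynomial.coeff_C_mul, MvPolynomial.coeff_zero]
    refine Finset.sum_eq_zero fun i _ => ?_
    rw [(hP i).coeff_eq_zero, mul_zero]
    intro h
    apply ht
    rw [mem_TT, ← h, Finsupp.degree_eq_sum, Fin.sum_univ_four]

theorem cubic_aux (A B ν ν' : ℕ) (hA : 1 ≤ A)
    (hν' : ν' = 12 * B ^ 2 * A + 6 * B * A ^ 2 + A ^ 3) (h2 : ν ≤ B * ν') :
    (2 * ν + A) ^ 3 < 8 * ν ^ 3 + 8 * ν' ^ 3 := by
  have h1 : 1 ≤ ν' := by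
    have : 1 ≤ A ^ 3 := Nat.one_le_pow _ _ hA
    omega
  have e1 : (2 * ν + A) ^ 3 = 8 * ν ^ 3 + (12 * ν ^ 2 * A + 6 * ν * A ^ 2 + A ^ 3) := by ring
  have e2 : 12 * ν ^ 2 * A + 6 * ν * A ^ 2 + A ^ 3 ≤
    12 * (B * ν') ^ 2 * A + 6 * (B * ν') * A ^ 2 + A ^ 3 := by gcongr
  have e3 : 12 * (B * ν') ^ 2 * A + 6 * (B * ν') * A ^ 2 + A ^ 3 ≤
    12 * (B * ν') ^ 2 * A + 6 * (B * ν' ^ 2) * A ^ 2 + A ^ 3 * ν' ^ 2 := by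
    have h0 : ν' ≤ ν' ^ 2 := by nlinarith
    have h' : 1 ≤ ν' ^ 2 := by omega
    have h3 : 6 * (B * ν') * A ^ 2 ≤ 6 * (B * ν' ^ 2) * A ^ 2 := by gcongr
    have h4 : A ^ 3 ≤ A ^ 3 * ν' ^ 2 := Nat.le_mul_of_pos_right _ h'
    omega
  have e4 : 12 * (B * ν') ^ 2 * A + 6 * (B * ν' ^ 2) * A ^ 2 + A ^ 3 * ν' ^ 2 = ν' ^ 3 := by
    have : ν' ^ 3 = (12 * B ^ 2 * A + 6 * B * A ^ 2 + A ^ 3) * ν' ^ 2 := by rw [← hν']; ring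
    rw [this]; ring
  have e5 : 0 < ν' ^ 3 := by positivity
  omega

theorem cube_le (a b c x : ℕ) (h1 : x ≤ a) (h2 : x ≤ b) (h3 : x ≤ c) : x ^ 3 ≤ a * b * c := by
  have : x ^ 3 = x * x * x := by ring
  rw [this]
  exact Nat.mul_le_mul (Nat.mul_le_mul h1 h2) h3
theorem le_cube (a b c x : ℕ) (h1 : a ≤ x) (h2 : b ≤ x) (h3 : c ≤ x) : a * b * c ≤ x ^ 3 := by
  have : x ^ 3 = x * x * x := by ring
  rw [this]
  exact Nat.mul_le_mul (Nat.mul_le_mul h1 h2) h3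

theorem count_aux (A B δ ν ν' e : ℕ) (hA : 1 ≤ A) (he : e + 3 = 2 * ν + A) (hB : B = 1 + 6 * δ)
    (hν' : ν' = 12 * B ^ 2 * A + 6 * B * A ^ 2 + A ^ 3) (hν : ν = ν' + (5 * ν' + 1) * δ) :
    (TT e).card < 7200 * ((Idx ν).card + (Idx ν').card) := by
  have h1 : 1 ≤ ν' := by
    have : 1 ≤ A ^ 3 := Nat.one_le_pow _ _ hA
    omega
  have h2 : ν ≤ B * ν' := by
    clear hν'
    subst hν hB
    nlinarith
  have k2 := cubic_aux A B ν ν' hA hν' h2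
  have t1 := card_TT e
  have t2 := card_TT ν
  have t3 := card_TT ν'
  have c1 := card_Idx ν
  have c2 := card_Idx ν'
  have k1 := le_cube (e + 1) (e + 2) (e + 3) (2 * ν + A) (by omega) (by omega) (by omega)
  have k3 := cube_le (ν + 1) (ν + 2) (ν + 3) ν (by omega) (by omega) (by omega)
  have k4 := cube_le (ν' + 1) (ν' + 2) (ν' + 3) ν' (by omega) (by omega) (by omega)
  rw [← t1] at k1
  rw [← t2] at k3
  rw [← t3] at k4
  clear hν' hν h2 t1 t2 t3
  generalize (2 * ν + A) ^ 3 = a1 at *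
  generalize ν ^ 3 = a2 at *
  generalize ν' ^ 3 = a3 at *
  omega

theorem count_ineq (δ : ℕ) : ∃ ν' : ℕ, ∀ ν, ν = ν' + (5 * ν' + 1) * δ →
    (TT (2 * ν + 14398)).card < 7200 * ((Idx ν).card + (Idx ν').card) := by
  obtain ⟨A, hA⟩ : ∃ A : ℕ, A = 14401 := ⟨_, rfl⟩
  refine ⟨12 * (1 + 6 * δ) ^ 2 * A + 6 * (1 + 6 * δ) * A ^ 2 + A ^ 3, ?_⟩
  intro ν hν
  exact count_aux A (1 + 6 * δ) δ ν _ _ (by omega) (by omega) rfl rfl hν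
end H4

namespace H4
open Quaternion

/-! ### Norm over the group -/

theorem prod_mulr {f : ℍ[ℝ] → ℝ} {r : ℍ[ℝ]} (hr : r ∈ D) : ∏ p ∈ D, f (p * r) = ∏ p ∈ D, f p := by
  refine Finset.prod_nbij' (fun p => p * r) (fun p => p * star r) ?_ ?_ ?_ ?_ ?_
  · intro p hp; exact D_mul hp hr
  · intro p hp; exact D_mul hp (D_star hr)
  · intro p _; simp only [mul_assoc, D_mul_star hr, mul_one]
  · intro p _; simp only [mul_assoc, D_star_mul hr, mul_one]
  · intro p _; rfl
theorem prod_mull {f : ℍ[ℝ] → ℝ} {r : ℍ[ℝ]} (hr : r ∈ D) : ∏ p ∈ D, f (r * p) = ∏ p ∈ D, f p := by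
  refine Finset.prod_nbij' (fun p => r * p) (fun p => star r * p) ?_ ?_ ?_ ?_ ?_
  · intro p hp; exact D_mul hr hp
  · intro p hp; exact D_mul (D_star hr) hp
  · intro p _; simp only [← mul_assoc, D_star_mul hr, one_mul]
  · intro p _; simp only [← mul_assoc, D_mul_star hr, one_mul]
  · intro p _; rfl

noncomputable def GG (F : Po) : Po := (∏ p ∈ D, ∏ q ∈ D, sub (act p q true) F) *
  (∏ p ∈ D, ∏ q ∈ D, sub (act p q false) F)

theorem ev_GG (F : Po) (x : ℍ[ℝ]) : ev x (GG F) = (∏ p ∈ D, ∏ q ∈ D, ev (p * x * q) F) *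
    (∏ p ∈ D, ∏ q ∈ D, ev (p * star x * q) F) := by
  simp only [GG, map_mul, map_prod, ev_sub, act_true, act_false]

theorem prod2 (F : Po) {a b : ℍ[ℝ]} (ha : a ∈ D) (hb : b ∈ D) (x : ℍ[ℝ]) :
    ∏ p ∈ D, ∏ q ∈ D, ev (p * (a * x * b) * q) F = ∏ p ∈ D, ∏ q ∈ D, ev (p * x * q) F := by
  have h1 : ∀ p ∈ D, ∏ q ∈ D, ev (p * (a * x * b) * q) F = ∏ q ∈ D, ev ((p * a) * x * q) F := by
    intro p _
    rw [← prod_mull (f := fun q => ev ((p * a) * x * q) F) hb]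
    refine Finset.prod_congr rfl fun q _ => ?_
    simp only [mul_assoc]
  rw [Finset.prod_congr rfl h1]
  exact prod_mulr (f := fun p => ∏ q ∈ D, ev (p * x * q) F) ha

theorem GG_inv (F : Po) : Inv (GG F) := by
  apply inv_of
  · intro p hp q hq x
    rw [ev_GG, ev_GG, prod2 F hp hq]
    have : star (p * x * q) = star q * star x * star p := by simp [mul_assoc]
    rw [this, prod2 F (D_star hq) (D_star hp)]
  · intro x
    rw [ev_GG, ev_GG, star_star, mul_comm]

theorem act_surj {p q : ℍ[ℝ]} (hp : p ∈ D) (hq : q ∈ D) (e : Bool) (y : ℍ[ℝ]) : ∃ x, act p q e x = y := by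
  have h : p * (star p * y * star q) * q = y := by
    have : p * (star p * y * star q) * q = (p * star p) * y * (star q * q) := by simp only [mul_assoc]
    rw [this, D_mul_star hp, D_star_mul hq, one_mul, mul_one]
  cases e
  · exact ⟨star (star p * y * star q), by rw [act_false, star_star, h]⟩
  · exact ⟨star p * y * star q, by rw [act_true, h]⟩

theorem sub_ne {F : Po} (hF : F ≠ 0) {p q : ℍ[ℝ]} (hp : p ∈ D) (hq : q ∈ D) (e : Bool) :
    sub (act p q e) F ≠ 0 := by
  intro h
  apply hF
  apply po_ext
  intro y
  obtain ⟨x, rfl⟩ := act_surj hp hq e y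
  rw [← ev_sub, h, map_zero, map_zero]

theorem GG_ne {F : Po} (hF : F ≠ 0) : GG F ≠ 0 := by
  refine mul_ne_zero ?_ ?_ <;>
  exact Finset.prod_ne_zero_iff.2 fun p hp => Finset.prod_ne_zero_iff.2 fun q hq => sub_ne hF hp hq _

theorem GG_hom {F : Po} {d : ℕ} (hF : F.IsHomogeneous d) : (GG F).IsHomogeneous (28800 * d) := by
  have key : ∀ e, (∏ p ∈ D, ∏ q ∈ D, sub (act p q e) F).IsHomogeneous (14400 * d) := by
    intro e
    have h1 : ∀ p ∈ D, (∏ q ∈ D, sub (act p q e) F).IsHomogeneous (120 * d) := by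
      intro p _
      have := IsHomogeneous.prod D (fun q => sub (act p q e) F) (fun _ => d) (fun q _ => sub_hom _ hF)
      rwa [Finset.sum_const, D_card, smul_eq_mul] at this
    have := IsHomogeneous.prod D (fun p => ∏ q ∈ D, sub (act p q e) F) (fun _ => 120 * d) h1
    rw [Finset.sum_const, D_card, smul_eq_mul] at this
    convert this using 1; ring
  have := (key true).mul (key false)
  have h2 : 28800 * d = 14400 * d + 14400 * d := by ring
  rw [h2]
  exact this

theorem line_D {F : Po} {d m : ℕ} (hF : F.IsHomogeneous d) (hv : ∀ v ∈ H4Config, vanishesToOrderR F v m)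
    {r : ℍ[ℝ]} (hr : r ∈ D) (h : ℍ[ℝ]) : Polynomial.X ^ m ∣ line r h F := by
  obtain ⟨v, hvc, c, hc⟩ := D_to_cfg hr
  have hrc : r = c • qt v := by
    have : vec r = vec (c • qt v) := by rw [vec_smul, vec_qt, hc]
    rw [← qt_vec r, this, qt_vec]
  have hc0 : c ≠ 0 := by
    rintro rfl
    have := D_normSq hr
    rw [hrc, zero_smul] at this
    simp at this
  have h1 := order_line m F (qt v) (c⁻¹ • h) (by rw [vec_qt]; exact hv v hvc)
  have h2 : line r h F = Polynomial.C (c ^ d) * line (qt v) (c⁻¹ • h) F := by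
    apply Polynomial.funext
    intro s
    rw [Polynomial.eval_mul, Polynomial.eval_C, eval_line, eval_line, ← ev_smul hF, hrc]
    congr 1
    rw [smul_add, smul_comm c s, smul_smul c, mul_inv_cancel₀ hc0, one_smul]
  rw [h2]
  exact h1.mul_left _

theorem prod_dvd {ι : Type*} (s : Finset ι) (f : ι → Polynomial ℝ) (g : Polynomial ℝ) (h : ∀ i ∈ s, g ∣ f i) :
    g ^ s.card ∣ ∏ i ∈ s, f i := by
  rw [← Finset.prod_const]
  exact Finset.prod_dvd_prod_of_dvd _ _ h

theorem GG_line {F : Po} {d m : ℕ} (hF : F.IsHomogeneous d) (hv : ∀ v ∈ H4Config, vanishesToOrderR F v m)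
    (h1 h2 h3 : ℝ) : Polynomial.X ^ (28800 * m) ∣ ln h1 h2 h3 (GG F) := by
  have key : ∀ e, Polynomial.X ^ (14400 * m) ∣ ∏ p ∈ D, ∏ q ∈ D, ln h1 h2 h3 (sub (act p q e) F) := by
    intro e
    have h : Polynomial.X ^ (14400 * m) = ((Polynomial.X ^ m) ^ 120 : Polynomial ℝ) ^ 120 := by
      rw [← pow_mul, ← pow_mul]; congr 1; ring
    rw [h]
    conv_lhs => rw [← D_card]
    apply prod_dvd
    intro p hp
    apply prod_dvd
    intro q hq
    rw [ln, line_sub]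
    apply line_D hF hv
    cases e <;> simp [D_mul hp hq]
  rw [GG, map_mul, map_prod, map_prod]
  simp only [map_prod]
  have := mul_dvd_mul (key true) (key false)
  rw [← pow_add] at this
  convert this using 2; ring
end H4

namespace H4
open Quaternion

/-! ### Distinctness of the group elements and a Vandermonde argument -/

theorem comm_real {r : ℍ[ℝ]} (h : ∀ x, r * x = x * r) : r.imI = 0 ∧ r.imJ = 0 ∧ r.imK = 0 := by
  have h1 : ∀ x : ℍ[ℝ], (r * x).imJ = (x * r).imJ := fun x => by rw [h x]
  have h2 : ∀ x : ℍ[ℝ], (r * x).imK = (x * r).imK := fun x => by rw [h x]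
  simp only [Quaternion.imJ_mul, Quaternion.imK_mul] at h1 h2
  have a1 := h1 ⟨0, 1, 0, 0⟩
  have a2 := h2 ⟨0, 1, 0, 0⟩
  have a3 := h2 ⟨0, 0, 1, 0⟩
  simp at a1 a2 a3
  refine ⟨?_, ?_, ?_⟩ <;> linarith

theorem anti_zero {r : ℍ[ℝ]} (h : ∀ x, r * x = star x * r) : r = 0 := by
  have h1 : ∀ x : ℍ[ℝ], (r * x).re = (star x * r).re := fun x => by rw [h x]
  have h2 : ∀ x : ℍ[ℝ], (r * x).imI = (star x * r).imI := fun x => by rw [h x]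
  simp only [Quaternion.re_mul, Quaternion.imI_mul, Quaternion.re_star, Quaternion.imI_star,
    Quaternion.imJ_star, Quaternion.imK_star] at h1 h2
  have a0 := h2 ⟨0, 1, 0, 0⟩
  have a1 := h1 ⟨0, 1, 0, 0⟩
  have a2 := h1 ⟨0, 0, 1, 0⟩
  have a3 := h1 ⟨0, 0, 0, 1⟩
  simp at a0 a1 a2 a3
  have b0 : r.re = 0 := by linarith
  have b1 : r.imI = 0 := by linarith
  have b2 : r.imJ = 0 := by linarith
  have b3 : r.imK = 0 := by linarith
  ext
  · exact b0
  · exact b1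
  · exact b2
  · exact b3

theorem trans_eq {p q p' q' : ℍ[ℝ]} (hp' : p' ∈ D) (hq : q ∈ D) {y z : ℍ[ℝ]} (σ : ℝ)
    (h : p * y * q = σ • (p' * z * q')) : (star p' * p) * y = σ • (z * (q' * star q)) := by
  have := congrArg (fun t => star p' * t * star q) h
  have e1 : star p' * (p * y * q) * star q = (star p' * p) * y * (q * star q) := by simp only [mul_assoc]
  have e2 : star p' * (σ • (p' * z * q')) * star q = σ • ((star p' * p') * z * (q' * star q)) := by
    simp only [mul_smul_comm, smul_mul_assoc, mul_assoc]
  rw [e1, e2, D_mul_star hq, D_star_mul hp', mul_one, one_mul] at this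
  exact this

theorem dist_same {p q p' q' : ℍ[ℝ]} (hp : p ∈ D) (hq : q ∈ D) (hp' : p' ∈ D) (σ : ℝ) (hσ : σ = 1 ∨ σ = -1)
    (h : ∀ x, p * x * q = σ • (p' * x * q')) : (p = p' ∨ p = -p') ∧ (q = q' ∨ q = -q') := by
  have h1 := fun x => trans_eq hp' hq σ (h x)
  have h2 := h1 1
  rw [mul_one, one_mul] at h2
  have h3 : ∀ x, (star p' * p) * x = x * (star p' * p) := by
    intro x
    rw [h1 x, h2, mul_smul_comm]
  obtain ⟨i1, i2, i3⟩ := comm_real h3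
  have hr : star p' * p ∈ D := D_mul (D_star hp') hp
  have hn := D_normSq hr
  rw [Quaternion.normSq_def', i1, i2, i3] at hn
  have ht : (star p' * p).re = 1 ∨ (star p' * p).re = -1 := by
    have : ((star p' * p).re - 1) * ((star p' * p).re + 1) = 0 := by linarith
    rcases mul_eq_zero.1 this with h | h
    · left; linarith
    · right; linarith
  have hr' : star p' * p = 1 ∨ star p' * p = -1 := by
    rcases ht with h | h
    · left; ext <;> simp [h, i1, i2, i3]
    · right; ext <;> simp [h, i1, i2, i3]
  have hpr : p = p' * (star p' * p) := by rw [← mul_assoc, D_mul_star hp', one_mul]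
  have hqr : q' = (q' * star q) * q := by rw [mul_assoc, D_star_mul hq, mul_one]
  have hs : q' * star q = 1 ∨ q' * star q = -1 := by
    rcases hr' with e | e <;> rcases hσ with e' | e' <;> rw [e, e'] at h2
    · left; rw [h2, one_smul]
    · right; rw [h2, neg_smul, one_smul, neg_neg]
    · right; rw [h2, one_smul]
    · left; rw [neg_smul, one_smul] at h2; exact (neg_injective h2).symm
  constructor
  · rcases hr' with e | e
    · left; rw [hpr, e, mul_one]
    · right; rw [hpr, e, mul_neg, mul_one]
  · rcases hs with e | e
    · left; rw [hqr, e, one_mul]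
    · right; rw [hqr, e, neg_mul, one_mul, neg_neg]

theorem dist_diff {p q p' q' : ℍ[ℝ]} (hp : p ∈ D) (hq : q ∈ D) (hp' : p' ∈ D) (σ : ℝ)
    (h : ∀ x, p * x * q = σ • (p' * star x * q')) : False := by
  have h1 := fun x => trans_eq hp' hq σ (h x)
  have h2 := h1 1
  rw [mul_one, star_one, one_mul] at h2
  have h3 : ∀ x, (star p' * p) * x = star x * (star p' * p) := by
    intro x
    rw [h1 x, h2, mul_smul_comm]
  have := D_normSq (D_mul (D_star hp') hp)
  rw [anti_zero h3] at this
  simp at this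

/-- representatives modulo sign -/
noncomputable def VV : Finset ℍ[ℝ] := V.toFinset.map ⟨emb, emb_inj⟩
theorem V_length : V.length = 60 := by decide +kernel
theorem VV_card : VV.card = 60 := by
  rw [VV, Finset.card_map, List.toFinset_card_of_nodup (List.nodup_append.1 L_nodup).1, V_length]
theorem mem_VV {r : ℍ[ℝ]} : r ∈ VV ↔ ∃ v ∈ V, emb v = r := by simp [VV]
theorem VV_D {r : ℍ[ℝ]} (h : r ∈ VV) : r ∈ D := by
  obtain ⟨v, hv, rfl⟩ := mem_VV.1 h
  exact mem_D.2 ⟨v, List.mem_append_left _ hv, rfl⟩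
theorem VV_neg {r : ℍ[ℝ]} (h : r ∈ VV) (h' : -r ∈ VV) : False := by
  obtain ⟨v, hv, rfl⟩ := mem_VV.1 h
  obtain ⟨u, hu, e⟩ := mem_VV.1 h'
  rw [emb_neg] at e
  have := emb_inj e
  exact (List.nodup_append.1 L_nodup).2.2 u hu (qneg v) (List.mem_map_of_mem hv) this
theorem VV_eq {r s : ℍ[ℝ]} (hr : r ∈ VV) (hs : s ∈ VV) (h : r = s ∨ r = -s) : r = s := by
  rcases h with h | h
  · exact h
  · rw [h] at hr; exact (VV_neg hs hr).elim

abbrev Gt := ℍ[ℝ] × ℍ[ℝ] × Bool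
noncomputable def Gam : Finset Gt := VV ×ˢ VV ×ˢ Finset.univ
theorem Gam_card : Gam.card = 7200 := by
  rw [Gam, Finset.card_product, Finset.card_product, VV_card, Finset.card_univ, Fintype.card_bool]
theorem mem_Gam {g : Gt} : g ∈ Gam ↔ g.1 ∈ VV ∧ g.2.1 ∈ VV := by simp [Gam]
attribute [irreducible] VV Gam

/-- adjoint of the group action -/
noncomputable def adj : Gt → (ℍ[ℝ] →ₗ[ℝ] ℍ[ℝ])
  | (p, q, true) => act (star p) (star q) true
  | (p, q, false) => act q p false
theorem dot_adj (g : Gt) (c x : ℍ[ℝ]) : dot c (act g.1 g.2.1 g.2.2 x) = dot (adj g c) x := by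
  obtain ⟨p, q, e⟩ := g
  cases e
  · simp only [adj, act_false]
    rw [dot_act, dot_star]
    congr 1
    simp [mul_assoc]
  · simp only [adj, act_true]
    rw [dot_act]

theorem star_pm {p p' : ℍ[ℝ]} (h : star p = star p' ∨ star p = - star p') : p = p' ∨ p = -p' := by
  rcases h with h | h
  · left; exact star_injective h
  · right; rw [← star_neg] at h; exact star_injective h

theorem adj_dist {g g' : Gt} (hg : g ∈ Gam) (hg' : g' ∈ Gam) (σ : ℝ) (hσ : σ = 1 ∨ σ = -1)
    (h : ∀ x, adj g x = σ • adj g' x) : g = g' := by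
  obtain ⟨p, q, e⟩ := g
  obtain ⟨p', q', e'⟩ := g'
  obtain ⟨hp, hq⟩ := mem_Gam.1 hg
  obtain ⟨hp', hq'⟩ := mem_Gam.1 hg'
  simp only at hp hq hp' hq'
  have dp := VV_D hp
  have dq := VV_D hq
  have dp' := VV_D hp'
  have dq' := VV_D hq'
  cases e <;> cases e' <;> simp only [adj, act_true, act_false] at h
  · have := dist_same dq dp dq' σ hσ (fun x => by simpa using h (star x))
    rw [VV_eq hp hp' this.2, VV_eq hq hq' this.1]
  · exact (dist_diff dq dp (D_star dp') σ (fun x => by simpa using h (star x))).elim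
  · exact (dist_diff (D_star dp) (D_star dq) dq' σ h).elim
  · have := dist_same (D_star dp) (D_star dq) (D_star dp') σ hσ h
    rw [VV_eq hp hp' (star_pm this.1), VV_eq hq hq' (star_pm this.2)]

theorem exists_generic : ∃ c : ℍ[ℝ], ∀ g ∈ Gam, ∀ g' ∈ Gam, g ≠ g' →
    adj g c - adj g' c ≠ 0 ∧ adj g c + adj g' c ≠ 0 := by
  classical
  by_contra hcon
  push Not at hcon
  let pp : (Gam × Gam × Bool) → Subspace ℝ ℍ[ℝ] := fun t =>
    if t.1 = t.2.1 then ⊥ else LinearMap.ker (adj t.1 - (if t.2.2 then (1 : ℝ) else -1) • adj t.2.1)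
  have hu : (⋃ i, (pp i : Set ℍ[ℝ])) = Set.univ := by
    apply Set.eq_univ_of_forall
    intro c
    obtain ⟨g, hg, g', hg', hne, h⟩ := hcon c
    have hne' : (⟨g, hg⟩ : Gam) ≠ ⟨g', hg'⟩ := fun e => hne (congrArg Subtype.val e)
    rw [Set.mem_iUnion]
    by_cases h0 : adj g c - adj g' c = 0
    · refine ⟨(⟨g, hg⟩, ⟨g', hg'⟩, true), ?_⟩
      simp only [pp, if_neg hne', SetLike.mem_coe, LinearMap.mem_ker]
      simpa using h0
    · refine ⟨(⟨g, hg⟩, ⟨g', hg'⟩, false), ?_⟩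
      simp only [pp, if_neg hne', SetLike.mem_coe, LinearMap.mem_ker]
      simpa using h h0
  obtain ⟨⟨g, g', b⟩, hi⟩ := Subspace.exists_eq_top_of_iUnion_eq_univ hu
  simp only [pp] at hi
  by_cases hgg : g = g'
  · rw [if_pos hgg] at hi
    exact bot_ne_top hi
  · rw [if_neg hgg, LinearMap.ker_eq_top] at hi
    apply hgg
    apply Subtype.ext
    refine adj_dist g.2 g'.2 (if b = true then (1 : ℝ) else -1) (by cases b <;> simp) ?_
    intro x
    have := LinearMap.congr_fun hi x
    rw [LinearMap.sub_apply, LinearMap.smul_apply, LinearMap.zero_apply, sub_eq_zero] at this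
    exact this

theorem lin_ne {r : ℍ[ℝ]} (hr : r ≠ 0) : lin r ≠ 0 := by
  intro h
  have := ev_lin r r
  rw [h, map_zero, dot_eq] at this
  apply hr
  rw [← Quaternion.normSq_eq_zero, Quaternion.normSq_def']
  linarith
theorem nP_ne : nP ≠ 0 := by
  intro h
  have := ev_nP 1
  rw [h] at this
  simp at this

theorem dot_addl (a b x : ℍ[ℝ]) : dot (a + b) x = dot a x + dot b x := by simp [dot_eq]; ring
theorem dot_subl (a b x : ℍ[ℝ]) : dot (a - b) x = dot a x - dot b x := by simp [dot_eq]; ring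

theorem vander (N : ℕ) (hN : Gam.card = N) (c : ℍ[ℝ])
    (hc : ∀ g ∈ Gam, ∀ g' ∈ Gam, g ≠ g' → adj g c - adj g' c ≠ 0 ∧ adj g c + adj g' c ≠ 0)
    (A : Fin N → Po) (hA : ∀ j, Inv (A j))
    (h : ∑ j, A j * ((lin c) ^ (2 * (j : ℕ)) * nP ^ (N - 1 - j)) = 0) : ∀ j, A j = 0 := by
  classical
  set W : Po := ∏ t ∈ (Gam ×ˢ Gam).filter (fun t => t.1 ≠ t.2),
    (lin (adj t.1 c - adj t.2 c) * lin (adj t.1 c + adj t.2 c)) with hW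
  have hW0 : W ≠ 0 := by
    rw [hW]
    refine Finset.prod_ne_zero_iff.2 fun t ht => ?_
    rw [Finset.mem_filter, Finset.mem_product] at ht
    obtain ⟨h1, h2⟩ := hc t.1 ht.1.1 t.2 ht.1.2 ht.2
    exact mul_ne_zero (lin_ne h1) (lin_ne h2)
  intro j
  have key : A j * nP ^ (N - 1 - j) * W = 0 := by
    apply po_ext
    intro x
    rw [map_zero, map_mul]
    by_cases hx : ev x W = 0
    · rw [hx, mul_zero]
    have hinj : Set.InjOn (fun g => (dot (adj g c) x) ^ 2) Gam := by
      intro g hg g' hg' hgg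
      by_contra hne
      apply hx
      rw [hW, map_prod]
      refine Finset.prod_eq_zero (i := (g, g')) ?_ ?_
      · rw [Finset.mem_filter, Finset.mem_product]; exact ⟨⟨hg, hg'⟩, hne⟩
      · simp only at hgg
        rw [map_mul, ev_lin, ev_lin, dot_addl, dot_subl]
        linear_combination hgg
    let Q : Polynomial ℝ := ∑ i : Fin N, Polynomial.C (ev x (A i) * (normSq x) ^ (N - 1 - (i : ℕ))) * Polynomial.X ^ (i : ℕ)
    have hQc : ∀ i : Fin N, Q.coeff i = ev x (A i) * (normSq x) ^ (N - 1 - (i : ℕ)) := by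
      intro i
      simp only [Q, Polynomial.finset_sum_coeff, Polynomial.coeff_C_mul, Polynomial.coeff_X_pow]
      rw [Finset.sum_eq_single i]
      · simp
      · intro b _ hb
        rw [if_neg, mul_zero]
        intro e; exact hb (Fin.ext e.symm)
      · intro hh; exact (hh (Finset.mem_univ _)).elim
    have hdeg : Q.degree < N := by
      rw [Polynomial.degree_lt_iff_coeff_zero]
      intro m hm
      simp only [Q, Polynomial.finset_sum_coeff, Polynomial.coeff_C_mul, Polynomial.coeff_X_pow]
      refine Finset.sum_eq_zero fun i _ => ?_
      rw [if_neg, mul_zero]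
      have := i.2
      omega
    have hQ : Q = 0 := by
      refine Polynomial.eq_zero_of_degree_lt_of_eval_finset_eq_zero (Gam.image (fun g => (dot (adj g c) x) ^ 2)) ?_ ?_
      · rw [Finset.card_image_of_injOn hinj, hN]; exact hdeg
      · intro y hy
        obtain ⟨g, hg, rfl⟩ := Finset.mem_image.1 hy
        obtain ⟨hp, hq⟩ := mem_Gam.1 hg
        have := congrArg (ev (act g.1 g.2.1 g.2.2 x)) h
        rw [map_zero, map_sum] at this
        rw [← this]
        simp only [Q, Polynomial.eval_finset_sum, Polynomial.eval_mul, Polynomial.eval_C, Polynomial.eval_pow, Polynomial.eval_X]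
        refine Finset.sum_congr rfl fun i _ => ?_
        rw [map_mul, map_mul, map_pow, map_pow, hA i _ (VV_D hp) _ (VV_D hq), nP_inv _ (VV_D hp) _ (VV_D hq),
          ev_lin, dot_adj, ev_nP, pow_mul]
        ring
    have := hQc j
    rw [hQ, Polynomial.coeff_zero] at this
    rw [map_mul, map_pow, ev_nP, ← this, zero_mul]
  rcases mul_eq_zero.1 key with h1 | h1
  · rcases mul_eq_zero.1 h1 with h2 | h2
    · exact h2
    · exact (pow_ne_zero _ nP_ne h2).elim
  · exact (hW0 h1).elim
end H4

namespace H4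
open Quaternion

/-! ### Assembly -/

noncomputable def mon (ν : ℕ) (s : Fin 3 →₀ ℕ) : Po :=
  nP ^ (ν - (6 * s 0 + 10 * s 1 + 15 * s 2)) * (aP ^ s 0 * bP ^ s 1 * cP ^ s 2)
theorem mon_inv (ν : ℕ) (s : Fin 3 →₀ ℕ) : Inv (mon ν s) :=
  (nP_inv.pow _).mul (((aP_inv.pow _).mul (bP_inv.pow _)).mul (cP_inv.pow _))
theorem mon_hom {ν : ℕ} {s : Fin 3 →₀ ℕ} (hs : s ∈ Idx ν) : (mon ν s).IsHomogeneous (2 * ν) := by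
  have h := (nP_hom.pow (ν - (6 * s 0 + 10 * s 1 + 15 * s 2))).mul
    (((aP_hom.pow (s 0)).mul (bP_hom.pow (s 1))).mul (cP_hom.pow (s 2)))
  have e : 2 * (ν - (6 * s 0 + 10 * s 1 + 15 * s 2)) + (12 * s 0 + 20 * s 1 + 30 * s 2) = 2 * ν := by
    have := Idx_wt hs
    omega
  rw [e] at h
  exact h

noncomputable def SS (ν : ℕ) (u : Idx ν → ℝ) : Po := ∑ s, C (u s) * mon ν s
theorem SS_inv (ν : ℕ) (u : Idx ν → ℝ) : Inv (SS ν u) :=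
  Inv.sum _ _ fun _ _ => (Inv.const _).mul (mon_inv _ _)

theorem lemmaS' (ν m : ℕ) (u : Idx ν → ℝ) (hu : u ≠ 0)
    (hdiv : ∀ h1 h2 h3, Polynomial.X ^ m ∣ ln h1 h2 h3 (SS ν u)) : 9 * m ≤ 5 * ν := by
  classical
  let R : P3 := ∑ s : Idx ν, monomial (s : Fin 3 →₀ ℕ) (u s)
  have hRc : ∀ s : Idx ν, R.coeff s = u s := by
    intro s
    simp only [R, MvPolynomial.coeff_sum, MvPolynomial.coeff_monomial]
    rw [Finset.sum_eq_single s]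
    · simp
    · intro b _ hb
      rw [if_neg]
      intro e; exact hb (Subtype.ext e)
    · intro hh; exact (hh (Finset.mem_univ _)).elim
  have hR0 : R ≠ 0 := by
    intro h
    apply hu
    funext s
    rw [← hRc s, h]; rfl
  have hsup : ∀ d ∈ R.support, 6 * d 0 + 10 * d 1 + 15 * d 2 ≤ ν := by
    intro d hd
    by_contra hlt
    rw [MvPolynomial.mem_support_iff] at hd
    apply hd
    simp only [R, MvPolynomial.coeff_sum, MvPolynomial.coeff_monomial]
    refine Finset.sum_eq_zero fun s _ => ?_
    rw [if_neg]
    intro e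
    apply hlt
    rw [← e]
    exact Idx_wt s.2
  refine lemmaS (SS ν u) R ν m hR0 hsup ?_ hdiv
  intro x hx
  simp only [SS, R, map_sum, Finset.mul_sum]
  refine Finset.sum_congr rfl fun s _ => ?_
  rw [map_mul, ev_C, aeval_monomial, Finsupp.prod_fintype _ _ (fun i => pow_zero _), Fin.prod_univ_three]
  simp only [mon, map_mul, map_pow, ev_nP, Matrix.cons_val_zero, Matrix.cons_val_one, Matrix.cons_val,
    Algebra.algebraMap_self, RingHom.id_apply, div_pow, ← pow_mul]
  have hw := Idx_wt s.2
  obtain ⟨t, ht⟩ := Nat.exists_eq_add_of_le hw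
  have e1 : ν - (6 * (s : Fin 3 →₀ ℕ) 0 + 10 * (s : Fin 3 →₀ ℕ) 1 + 15 * (s : Fin 3 →₀ ℕ) 2) = t := by omega
  have e2 : normSq x ^ ν = normSq x ^ t * (normSq x ^ (6 * (s : Fin 3 →₀ ℕ) 0) * normSq x ^ (10 * (s : Fin 3 →₀ ℕ) 1) *
      normSq x ^ (15 * (s : Fin 3 →₀ ℕ) 2)) := by
    rw [← pow_add, ← pow_add, ← pow_add]; congr 1; omega
  rw [e1, e2]
  field_simp

theorem sum_id {ι κ κ' : Type*} [Fintype ι] [Fintype κ] [Fintype κ'] (M : κ → Po) (M' : κ' → Po) (G : Po)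
    (w : ι → Po) (u : ι × (κ ⊕ κ') → ℝ) :
    ∑ j, ((∑ s, C (u (j, Sum.inl s)) * M s) + G * ∑ s, C (u (j, Sum.inr s)) * M' s) * w j =
      ∑ t, C (u t) * (Sum.elim M (fun s => G * M' s) t.2 * w t.1) := by
  rw [Fintype.sum_prod_type]
  refine Finset.sum_congr rfl fun j _ => ?_
  rw [Fintype.sum_sum_type, add_mul, Finset.mul_sum, Finset.sum_mul, Finset.sum_mul]
  refine congrArg₂ _ (Finset.sum_congr rfl fun s _ => ?_) (Finset.sum_congr rfl fun s _ => ?_)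
  · rw [Sum.elim_inl]; ring
  · rw [Sum.elim_inr]; ring

theorem final_contra (N : ℕ) (hN : Gam.card = N) (hN' : N = 7200) (m d : ℕ) (F : Po) (hF0 : F ≠ 0)
    (hF : F.IsHomogeneous d) (hv : ∀ v ∈ H4Config, vanishesToOrderR F v m) : 18 * m ≤ 5 * d := by
  by_contra hlt
  push Not at hlt
  obtain ⟨c, hc⟩ := exists_generic
  obtain ⟨ν', hν'⟩ := count_ineq (14400 * d)
  obtain ⟨k, hk⟩ : ∃ k, k = 5 * ν' + 1 := ⟨_, rfl⟩
  obtain ⟨ν, hν⟩ : ∃ ν, ν = ν' + (5 * ν' + 1) * (14400 * d) := ⟨_, rfl⟩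
  have hcard := hν' ν hν
  rw [← hk] at hν
  have hGk : (GG F ^ k).IsHomogeneous (28800 * d * k) := (GG_hom hF).pow k
  have hGi := (GG_inv F).pow k
  have hG0 : GG F ^ k ≠ 0 := pow_ne_zero _ (GG_ne hF0)
  have hGd : ∀ h1 h2 h3, Polynomial.X ^ (28800 * m * k) ∣ ln h1 h2 h3 (GG F ^ k) := by
    intro h1 h2 h3
    rw [map_pow, pow_mul]
    exact pow_dvd_pow_of_dvd (GG_line hF hv h1 h2 h3) k
  generalize GG F ^ k = G at hGk hGi hG0 hGd
  let w : Fin N → Po := fun j => (lin c) ^ (2 * (j : ℕ)) * nP ^ (N - 1 - j)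
  have hw : ∀ j, (w j).IsHomogeneous (2 * (N - 1)) := by
    intro j
    have h := ((lin_hom c).pow (2 * (j : ℕ))).mul (nP_hom.pow (N - 1 - j))
    have e : 1 * (2 * (j : ℕ)) + 2 * (N - 1 - j) = 2 * (N - 1) := by
      have := j.2
      omega
    rw [e] at h
    exact h
  let P : Fin N × (Idx ν ⊕ Idx ν') → Po := fun t =>
    Sum.elim (fun s : Idx ν => mon ν s) (fun s : Idx ν' => G * mon ν' s) t.2 * w t.1
  have hP : ∀ t, (P t).IsHomogeneous (2 * ν + 14398) := by
    rintro ⟨j, s | s⟩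
    · have h := (mon_hom s.2).mul (hw j)
      have e : 2 * ν + 2 * (N - 1) = 2 * ν + 14398 := by omega
      rw [e] at h
      exact h
    · have h := (hGk.mul (mon_hom s.2)).mul (hw j)
      have e : 28800 * d * k + 2 * ν' + 2 * (N - 1) = 2 * ν + 14398 := by
        have : 2 * (k * (14400 * d)) = 28800 * d * k := by ring
        omega
      rw [e] at h
      exact h
  obtain ⟨u, hu0, hu⟩ := dep P _ hP (by
    rw [Fintype.card_prod, Fintype.card_sum, Fintype.card_fin, Fintype.card_coe, Fintype.card_coe, hN']
    exact hcard)
  let A : Fin N → Po := fun j => SS ν (fun s => u (j, Sum.inl s)) + G * SS ν' (fun s => u (j, Sum.inr s))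
  have hA : ∀ j, Inv (A j) := fun j => (SS_inv _ _).add (hGi.mul (SS_inv _ _))
  have hsum : ∑ j, A j * ((lin c) ^ (2 * (j : ℕ)) * nP ^ (N - 1 - j)) = 0 := by
    rw [← hu]
    exact sum_id (fun s : Idx ν => mon ν s) (fun s : Idx ν' => mon ν' s) G w u
  have hA0 := vander N hN c hc A hA hsum
  have h1 : ∀ j, (fun s => u (j, Sum.inl s)) = (0 : Idx ν → ℝ) := by
    intro j
    by_contra hne
    have e : SS ν (fun s => u (j, Sum.inl s)) = - (G * SS ν' (fun s => u (j, Sum.inr s))) :=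
      eq_neg_of_add_eq_zero_left (hA0 j)
    have := lemmaS' ν (28800 * m * k) _ hne (by
      intro h1 h2 h3
      rw [e, map_neg, map_mul, dvd_neg]
      exact (hGd h1 h2 h3).mul_right _)
    have e3 : (5 * d + 1) * k ≤ 18 * m * k := Nat.mul_le_mul_right _ hlt
    have e4 : (5 * d + 1) * k = 5 * (d * k) + k := by ring
    have e5 : 18 * m * k = 18 * (m * k) := by ring
    have e6 : 28800 * m * k = 28800 * (m * k) := by ring
    have e7 : k * (14400 * d) = 14400 * (d * k) := by ring
    rw [e4, e5] at e3
    rw [e6] at this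
    rw [e7] at hν
    generalize m * k = a at *
    generalize d * k = b at *
    omega
  apply hu0
  funext ⟨j, s⟩
  rcases s with s | s
  · exact congrFun (h1 j) s
  · have h2 : (fun s => u (j, Sum.inr s)) = (0 : Idx ν' → ℝ) := by
      by_contra hne
      have e := hA0 j
      have e0 : SS ν (fun s => u (j, Sum.inl s)) = 0 := by
        rw [h1 j]; simp [SS]
      simp only [A, e0, zero_add] at e
      have e1 := (mul_eq_zero.1 e).resolve_left hG0
      have := lemmaS' ν' (5 * ν' + 1) _ hne (by
        intro h1 h2 h3
        rw [e1, map_zero]; exact dvd_zero _)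
      omega
    exact congrFun h2 s

end H4

/-- The Waldschmidt constant of the H4 configuration equals 18/5. -/
theorem waldschmidt_H4 :
    sInf { x : ℝ | ∃ m : ℕ, 1 ≤ m ∧ x = (alphaSymbolicR H4Config m : ℝ) / m } = 18 / 5 := by
  exact H4.reduce fun m d F hF0 hF hv => H4.final_contra 7200 H4.Gam_card rfl m d F hF0 hF hv
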